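/- For every finite quiver Q = (I, Ω), every dimension vector α ∈ ℕ^I and every subset V ⊆ ℕ^I, there exists a polynomial M ∈ ℤ[t] such that for every prime power q, M(q) equals the number of GL_α(𝔽_q)-orbits of representations x ∈ R(Q,α)(𝔽_q) with the property that every indecomposable direct summand of x ⊗ 𝔽̄_q has dimension vector belonging to V. -/

import Mathlib

open Matrix

namespace QRep

variable {I Ω : Type} (src tgt : Ω → I)

/-- A representation of the quiver with arrow set `Ω`, tail map `src`, head map `tgt`,
of dimension vector `β`, over the field `K`: a matrix of size `β (tgt a) × β (src a)`
for every arrow `a`. -/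
def Rep (K : Type) [Field K] (β : I → ℕ) : Type :=
  ∀ a : Ω, Matrix (Fin (β (tgt a))) (Fin (β (src a))) K

/-- Isomorphism of representations (of possibly different dimension vectors). -/
def RepIso {K : Type} [Field K] {β γ : I → ℕ} (x : Rep src tgt K β) (y : Rep src tgt K γ) :
    Prop :=
  ∃ e : ∀ i, (Fin (β i) → K) ≃ₗ[K] (Fin (γ i) → K),
    ∀ a : Ω, (Matrix.mulVecLin (y a)).comp (e (src a) : (Fin (β (src a)) → K) →ₗ[K] _)
      = ((e (tgt a) : (Fin (β (tgt a)) → K) →ₗ[K] _)).comp (Matrix.mulVecLin (x a))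

/-- Direct sum (block diagonal) of two representations. -/
def dsum {K : Type} [Field K] {β γ : I → ℕ} (x : Rep src tgt K β) (y : Rep src tgt K γ) :
    Rep src tgt K (β + γ) :=
  fun a => Matrix.reindex finSumFinEquiv finSumFinEquiv (Matrix.fromBlocks (x a) 0 0 (y a))

/-- A representation is indecomposable if its dimension vector is nonzero and it is not
isomorphic to a direct sum of two representations of nonzero dimension vectors. -/
def Indec {K : Type} [Field K] {β : I → ℕ} (x : Rep src tgt K β) : Prop :=
  β ≠ 0 ∧ ∀ (β₁ β₂ : I → ℕ) (y : Rep src tgt K β₁) (z : Rep src tgt K β₂),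
    β₁ ≠ 0 → β₂ ≠ 0 → ¬ RepIso src tgt x (dsum src tgt y z)

/-- Base change of a representation along a ring homomorphism of fields. -/
def baseChange {K L : Type} [Field K] [Field L] (f : K →+* L) {β : I → ℕ}
    (x : Rep src tgt K β) : Rep src tgt L β :=
  fun a => (x a).map f

/-- `x` is of level at most `V`: every indecomposable direct summand of
`x ⊗ K̄` has dimension vector belonging to `V`. -/
def LevelAtMost {K : Type} [Field K] {β : I → ℕ} (x : Rep src tgt K β)
    (V : Set (I → ℕ)) : Prop :=
  ∀ (γ δ : I → ℕ) (Y : Rep src tgt (AlgebraicClosure K) γ)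
    (z : Rep src tgt (AlgebraicClosure K) δ), Indec src tgt Y →
    RepIso src tgt (baseChange src tgt (algebraMap K (AlgebraicClosure K)) x)
      (dsum src tgt Y z) → γ ∈ V

/-- The action of `GL_β(K)` on representations of dimension vector `β`. -/
def glAct {K : Type} [Field K] {β : I → ℕ} (g : ∀ i, GL (Fin (β i)) K)
    (x : Rep src tgt K β) : Rep src tgt K β :=
  fun a => ((g (tgt a) : Matrix (Fin (β (tgt a))) (Fin (β (tgt a))) K) * x a) *
    (((g (src a))⁻¹ : GL (Fin (β (src a))) K) : Matrix (Fin (β (src a))) (Fin (β (src a))) K)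

/-- The number of `GL_β(K)`-orbits of representations of dimension vector `β`
satisfying the property `P`. -/
noncomputable def orbitCount {K : Type} [Field K] (β : I → ℕ)
    (P : Rep src tgt K β → Prop) : ℕ :=
  Nat.card (Quot fun x y : {x : Rep src tgt K β // P x} =>
    ∃ g : ∀ i, GL (Fin (β i)) K, glAct src tgt g x.1 = y.1)

end QRep

section
open Polynomial

namespace QRep

/-- Functions of `q` that are, for `q ≥ 2`, quotients of integral polynomials with a monic
denominator. -/
def ratFun : Subring (ℕ → ℚ) where
  carrier := {f | ∃ P D : ℤ[X], D.Monic ∧ ∀ q : ℕ, 2 ≤ q →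
    D.eval (q : ℤ) ≠ 0 ∧ f q * (D.eval (q : ℤ) : ℤ) = (P.eval (q : ℤ) : ℤ)}
  mul_mem' := by
    rintro f g ⟨P, D, hD, h⟩ ⟨P', D', hD', h'⟩
    refine ⟨P * P', D * D', hD.mul hD', fun q hq => ?_⟩
    obtain ⟨h1, h2⟩ := h q hq
    obtain ⟨h1', h2'⟩ := h' q hq
    refine ⟨by simp [h1, h1'], ?_⟩
    simp only [Pi.mul_apply, eval_mul, Int.cast_mul, ← h2, ← h2']
    ring
  one_mem' := ⟨1, 1, monic_one, fun q _ => by simp⟩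
  add_mem' := by
    rintro f g ⟨P, D, hD, h⟩ ⟨P', D', hD', h'⟩
    refine ⟨P * D' + P' * D, D * D', hD.mul hD', fun q hq => ?_⟩
    obtain ⟨h1, h2⟩ := h q hq
    obtain ⟨h1', h2'⟩ := h' q hq
    refine ⟨by simp [h1, h1'], ?_⟩
    simp only [Pi.add_apply, eval_mul, eval_add, Int.cast_mul, Int.cast_add, ← h2, ← h2']
    ring
  zero_mem' := ⟨0, 1, monic_one, fun q _ => by simp⟩
  neg_mem' := by
    rintro f ⟨P, D, hD, h⟩
    refine ⟨-P, D, hD, fun q hq => ⟨(h q hq).1, ?_⟩⟩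
    simp only [Pi.neg_apply, eval_neg, Int.cast_neg, ← (h q hq).2]
    ring

theorem eval_mem_ratFun (P : ℤ[X]) : (fun q : ℕ => ((P.eval (q : ℤ) : ℤ) : ℚ)) ∈ ratFun :=
  ⟨P, 1, monic_one, fun q _ => by simp⟩

theorem inv_eval_mem_ratFun (D : ℤ[X]) (hD : D.Monic)
    (h : ∀ q : ℕ, 2 ≤ q → D.eval (q : ℤ) ≠ 0) :
    (fun q : ℕ => ((D.eval (q : ℤ) : ℤ) : ℚ)⁻¹) ∈ ratFun :=
  ⟨1, D, hD, fun q hq => ⟨h q hq, by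
    have : ((D.eval (q : ℤ) : ℤ) : ℚ) ≠ 0 := by exact_mod_cast h q hq
    simp [this]⟩⟩

theorem pow_mem_ratFun (k : ℕ) : (fun q : ℕ => (q : ℚ) ^ k) ∈ ratFun := by
  simpa using eval_mem_ratFun (X ^ k)

theorem inv_gl_mem_ratFun (n : ℕ) :
    (fun q : ℕ => (∏ i ∈ Finset.range n, ((q : ℚ) ^ n - (q : ℚ) ^ i))⁻¹) ∈ ratFun := by
  have := inv_eval_mem_ratFun (∏ i ∈ Finset.range n, (X ^ n - X ^ i))
    (monic_prod_of_monic _ _ fun i hi => by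
      apply monic_X_pow_sub
      simpa [degree_X_pow] using Finset.mem_range.1 hi)
    (fun q hq => by
      rw [eval_prod, Finset.prod_ne_zero_iff]
      intro i hi
      have hi := Finset.mem_range.1 hi
      have : (q : ℤ) ^ i < (q : ℤ) ^ n := by
        exact_mod_cast Nat.pow_lt_pow_right hq hi
      simp only [eval_sub, eval_pow, eval_X]
      omega)
  simpa [eval_prod] using this

/-- An element of `ratFun` with integral values at the primes is an integral polynomial. -/
theorem exists_poly_of_ratFun {f : ℕ → ℚ} (hf : f ∈ ratFun)
    (hz : ∀ p : ℕ, p.Prime → ∃ z : ℤ, f p = z) :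
    ∃ M : ℤ[X], ∀ q : ℕ, 2 ≤ q → f q = (M.eval (q : ℤ) : ℤ) := by
  obtain ⟨P, D, hD, h⟩ := hf
  have key : P %ₘ D = 0 := by
    by_contra hR
    set R := P %ₘ D with hRdef
    have hdeg : R.degree < D.degree := degree_modByMonic_lt P hD
    have hinj : Function.Injective (Int.castRingHom ℝ) := Int.cast_injective
    have hlim := Polynomial.div_tendsto_atTop_zero_of_degree_lt (R.map (Int.castRingHom ℝ))
      (D.map (Int.castRingHom ℝ)) (by
        rwa [degree_map_eq_of_injective hinj, degree_map_eq_of_injective hinj])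
    have hlim2 := hlim.comp tendsto_natCast_atTop_atTop
    have hev : ∀ᶠ n : ℕ in Filter.atTop, |((R.eval (n : ℤ) : ℤ) : ℝ) / ((D.eval (n : ℤ) : ℤ) : ℝ)| < 1 := by
      have := hlim2.eventually (Metric.ball_mem_nhds (0 : ℝ) one_pos)
      filter_upwards [this] with n hn
      have e1 : ∀ Q : ℤ[X], (Q.map (Int.castRingHom ℝ)).eval (n : ℝ) = ((Q.eval (n : ℤ) : ℤ) : ℝ) := by
        intro Q
        simp
      simpa [e1, abs_div] using hn
    obtain ⟨N, hN⟩ := Filter.eventually_atTop.1 hev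
    have hroot : ∀ p : ℕ, p.Prime → N ≤ p → R.eval (p : ℤ) = 0 := by
      intro p hp hNp
      obtain ⟨z, hzp⟩ := hz p hp
      obtain ⟨h1, h2⟩ := h p hp.two_le
      have h3 : z * D.eval (p : ℤ) = P.eval (p : ℤ) := by
        rw [hzp] at h2; exact_mod_cast h2
      have h4 : P.eval (p : ℤ) = R.eval (p : ℤ) + D.eval (p : ℤ) * (P /ₘ D).eval (p : ℤ) := by
        conv_lhs => rw [← modByMonic_add_div P D]
        simp [hRdef]
      have h5 : R.eval (p : ℤ) = (z - (P /ₘ D).eval (p : ℤ)) * D.eval (p : ℤ) := by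
        linear_combination -h4 - h3
      have h6 := hN p hNp
      rw [h5] at h6 ⊢
      have hD0 : ((D.eval (p : ℤ) : ℤ) : ℝ) ≠ 0 := by exact_mod_cast h1
      rw [Int.cast_mul, mul_div_assoc, div_self hD0, mul_one] at h6
      have h7 : |z - (P /ₘ D).eval (p : ℤ)| < 1 := by exact_mod_cast h6
      rw [Int.abs_lt_one_iff.1 h7, zero_mul]
    apply hR
    apply eq_zero_of_infinite_isRoot
    refine Set.Infinite.mono ?_ (Set.Infinite.image (s := {p : ℕ | p.Prime ∧ N ≤ p})
      (f := fun p : ℕ => (p : ℤ)) (Nat.cast_injective.injOn) ?_)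
    · rintro _ ⟨p, ⟨hp, hNp⟩, rfl⟩
      exact hroot p hp hNp
    · rw [Set.infinite_iff_exists_gt]
      intro a
      obtain ⟨p, hp1, hp2⟩ := Nat.exists_infinite_primes (max N (a + 1))
      exact ⟨p, ⟨hp2, le_trans (le_max_left _ _) hp1⟩, lt_of_lt_of_le (Nat.lt_succ_self a) (le_trans (le_max_right _ _) hp1)⟩
  refine ⟨P /ₘ D, fun q hq => ?_⟩
  obtain ⟨h1, h2⟩ := h q hq
  have h4 : P.eval (q : ℤ) = D.eval (q : ℤ) * (P /ₘ D).eval (q : ℤ) := by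
    conv_lhs => rw [← modByMonic_add_div P D, key]
    simp
  rw [h4] at h2
  have hD0 : ((D.eval (q : ℤ) : ℤ) : ℚ) ≠ 0 := by exact_mod_cast h1
  apply mul_right_cancel₀ hD0
  rw [h2]; push_cast; ring

end QRep

end

section
open PowerSeries

namespace QRep

/-- `s` is the logarithmic derivative `z F' / F` of `F`. -/
def LD (F s : PowerSeries ℚ) : Prop := X * d⁄dX ℚ F = F * s

theorem LD.mul {F G s t : PowerSeries ℚ} (hF : LD F s) (hG : LD G t) : LD (F * G) (s + t) := by
  unfold LD at *
  rw [Derivation.leibniz, smul_eq_mul, smul_eq_mul]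
  linear_combination F * hG + G * hF

theorem LD.one : LD 1 0 := by
  simp [LD]

theorem LD.inv {F s : PowerSeries ℚ} (h0 : constantCoeff F ≠ 0) (hF : LD F s) : LD F⁻¹ (-s) := by
  unfold LD at *
  rw [derivative_inv']
  have h := PowerSeries.inv_mul_cancel F h0
  linear_combination (-F⁻¹ ^ 2) * hF - F⁻¹ * s * h

theorem LD.prod {ι : Type} (S : Finset ι) (F s : ι → PowerSeries ℚ) (h : ∀ i ∈ S, LD (F i) (s i)) :
    LD (∏ i ∈ S, F i) (∑ i ∈ S, s i) := by
  classical
  induction S using Finset.induction_on with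
  | empty => simpa using LD.one
  | insert a S ha ih =>
    rw [Finset.prod_insert ha, Finset.sum_insert ha]
    exact (h a (by simp)).mul (ih fun i hi => h i (by simp [hi]))

theorem coeff_X_mul_derivative (F : PowerSeries ℚ) (n : ℕ) :
    coeff n (X * d⁄dX ℚ F) = n * coeff n F := by
  cases n with
  | zero => simp
  | succ n => rw [coeff_succ_X_mul, coeff_derivative]; push_cast; ring

theorem LD.rescale {F s : PowerSeries ℚ} (c : ℚ) (h : LD F s) :
    LD (rescale c F) (rescale c s) := by
  unfold LD at *
  rw [← map_mul, ← h]
  ext n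
  rw [coeff_X_mul_derivative, coeff_rescale, coeff_rescale, coeff_X_mul_derivative]
  ring

theorem LD.expand {F s : PowerSeries ℚ} (d : ℕ) (hd : d ≠ 0) (h : LD F s) :
    LD (expand d hd F) ((d : ℚ) • expand d hd s) := by
  unfold LD at *
  rw [mul_smul_comm, ← map_mul, ← h]
  ext n
  rw [coeff_X_mul_derivative, coeff_expand, coeff_smul, coeff_expand]
  split_ifs with hn
  · obtain ⟨m, rfl⟩ := hn
    rw [Nat.mul_div_cancel_left _ (Nat.pos_of_ne_zero hd), coeff_X_mul_derivative]
    push_cast; simp only [smul_eq_mul]; ring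
  · simp

theorem LD.coeff_eq {F G s t : PowerSeries ℚ} (hF : LD F s) (hG : LD G t)
    (hF0 : constantCoeff F = 1) (hG0 : constantCoeff G = 1) (n : ℕ)
    (hst : ∀ j ≤ n, coeff j s = coeff j t) : coeff n F = coeff n G := by
  have hs0 : coeff 0 s = 0 := by
    have := congrArg (coeff 0) hF
    rw [coeff_X_mul_derivative] at this
    simpa [hF0] using this.symm
  have ht0 : coeff 0 t = 0 := by
    have := congrArg (coeff 0) hG
    rw [coeff_X_mul_derivative] at this
    simpa [hG0] using this.symm
  induction n using Nat.strong_induction_on with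
  | _ n ih =>
  rcases Nat.eq_zero_or_pos n with rfl | hn
  · simp [hF0, hG0]
  have h1 := congrArg (coeff n) hF
  have h2 := congrArg (coeff n) hG
  rw [coeff_X_mul_derivative, coeff_mul] at h1 h2
  have h3 : ∑ p ∈ Finset.HasAntidiagonal.antidiagonal n, coeff p.1 F * coeff p.2 s
      = ∑ p ∈ Finset.HasAntidiagonal.antidiagonal n, coeff p.1 G * coeff p.2 t := by
    refine Finset.sum_congr rfl fun p hp => ?_
    have hp := Finset.HasAntidiagonal.mem_antidiagonal.1 hp
    rcases Nat.eq_zero_or_pos p.2 with h | h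
    · rw [h, hs0, ht0]; simp
    · rw [hst p.2 (by omega), ih p.1 (by omega) (fun j hj => hst j (by omega))]
  rw [h3, ← h2] at h1
  exact mul_left_cancel₀ (by positivity) h1

/-- The ratio of the number of nilpotent matrices and the number of invertible matrices of size `n`
over a field with `Q` elements. -/
noncomputable def nu (n : ℕ) (Q : ℚ) : ℚ :=
  Q ^ (n ^ 2 - n) * (∏ i ∈ Finset.range n, (Q ^ n - Q ^ i))⁻¹

theorem nu_zero (Q : ℚ) : nu 0 Q = 1 := by simp [nu]

theorem nu_succ (n : ℕ) (Q : ℚ) (hQ : 1 < Q) :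
    (Q ^ (n + 1) - 1) * nu (n + 1) Q = Q ^ n * nu n Q := by
  have h0 : Q ≠ 0 := by positivity
  have h1 : Q ^ (n + 1) - 1 ≠ 0 := by
    have := one_lt_pow₀ hQ (Nat.succ_ne_zero n)
    exact sub_ne_zero.2 this.ne'
  have h2 : (∏ i ∈ Finset.range (n + 1), (Q ^ (n + 1) - Q ^ i))
      = (Q ^ (n + 1) - 1) * Q ^ n * ∏ i ∈ Finset.range n, (Q ^ n - Q ^ i) := by
    rw [Finset.prod_range_succ', pow_zero]
    have : ∏ i ∈ Finset.range n, (Q ^ (n + 1) - Q ^ (i + 1))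
      = ∏ i ∈ Finset.range n, (Q * (Q ^ n - Q ^ i)) :=
      Finset.prod_congr rfl fun i _ => by ring
    rw [this, Finset.prod_mul_distrib, Finset.prod_const, Finset.card_range]
    ring
  have h3 : (n + 1) ^ 2 - (n + 1) = (n ^ 2 - n) + n + n := by
    have : n ≤ n ^ 2 := Nat.le_self_pow (by norm_num) n
    zify [this, Nat.le_self_pow (two_ne_zero) (n + 1)]
    ring
  unfold nu
  rw [h2, h3, mul_inv, mul_inv, pow_add (Q) (n ^ 2 - n + n), pow_add Q (n ^ 2 - n)]
  have h4 : Q ^ n ≠ 0 := pow_ne_zero _ h0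
  set a := Q ^ (n + 1) - 1
  set b := Q ^ n
  set c := (∏ i ∈ Finset.range n, (b - Q ^ i))⁻¹
  calc a * (Q ^ (n ^ 2 - n) * b * b * (a⁻¹ * b⁻¹ * c))
      = (a * a⁻¹) * (b * b⁻¹) * (b * (Q ^ (n ^ 2 - n) * c)) := by ring
    _ = _ := by rw [mul_inv_cancel₀ h1, mul_inv_cancel₀ h4]; ring

theorem nu_mem_ratFun (n : ℕ) : (fun q : ℕ => nu n q) ∈ ratFun :=
  ratFun.mul_mem (pow_mem_ratFun (n ^ 2 - n)) (inv_gl_mem_ratFun n)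

theorem LD_inv_one_sub : LD (mk fun _ => 1) (mk fun m => if m = 0 then 0 else 1) := by
  unfold LD
  ext n
  rw [coeff_X_mul_derivative, coeff_mul, Finset.Nat.sum_antidiagonal_eq_sum_range_succ_mk]
  simp only [coeff_mk, mul_one, one_mul]
  rw [← Finset.sum_range_reflect]
  rw [Finset.sum_range_succ']
  have : ∀ i ∈ Finset.range n, (if n - (n + 1 - 1 - (i + 1)) = 0 then (0 : ℚ) else 1) = 1 := by
    intro i hi
    have := Finset.mem_range.1 hi
    rw [if_neg (by omega)]
  simp only [Nat.add_sub_cancel, Nat.succ_eq_add_one] at this ⊢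
  rw [Finset.sum_congr rfl this]
  simp

theorem LD_nu (Q : ℚ) (hQ : 1 < Q) :
    LD (mk fun n => nu n Q) (mk fun m => if m = 0 then 0 else (Q ^ m - 1)⁻¹) := by
  set N : PowerSeries ℚ := mk fun n => nu n Q with hN
  have hN0 : constantCoeff N = 1 := by
    rw [← coeff_zero_eq_constantCoeff_apply, hN, coeff_mk, nu_zero]
  have hne : N ≠ 0 := by
    intro h; rw [h] at hN0; simp at hN0
  set s := X * d⁄dX ℚ N * N⁻¹ with hs
  have hLD : LD N s := by
    have := PowerSeries.mul_inv_cancel N (by rw [hN0]; exact one_ne_zero)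
    unfold LD
    rw [hs]
    linear_combination (-(X * d⁄dX ℚ N)) * this
  have hfun : PowerSeries.rescale Q N = N * (mk fun _ => 1) := by
    have h1 : PowerSeries.rescale Q N * (1 - X) = N := by
      ext n
      rw [mul_sub, mul_one, map_sub, coeff_rescale]
      cases n with
      | zero => simp [hN]
      | succ n =>
        rw [coeff_succ_mul_X, coeff_rescale, hN, coeff_mk, coeff_mk, ← nu_succ n Q hQ]
        ring
    calc PowerSeries.rescale Q N = PowerSeries.rescale Q N * ((mk fun _ => 1) * (1 - X)) := by
          have := PowerSeries.mk_one_mul_one_sub_eq_one ℚ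
          change (mk fun _ => 1) * (1 - X) = _ at this
          rw [this, mul_one]
      _ = _ := by
          conv_rhs => rw [← h1]
          ring
  have h1 := hLD.rescale Q
  rw [hfun] at h1
  have h2 := hLD.mul LD_inv_one_sub
  have h3 : PowerSeries.rescale Q s = s + mk fun m => if m = 0 then 0 else 1 := by
    have h4 : N * (mk fun _ => 1) ≠ 0 := by
      rw [← hfun]
      intro h
      have := congrArg (coeff 0) h
      simp [hN0] at this
    exact mul_left_cancel₀ h4 (h1.symm.trans h2)
  convert hLD
  ext m
  rw [coeff_mk]
  split_ifs with hm
  · subst hm; simp [hs]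
  · have := congrArg (coeff m) h3
    rw [coeff_rescale, map_add, coeff_mk, if_neg hm] at this
    have h5 : Q ^ m - 1 ≠ 0 := sub_ne_zero.2 (one_lt_pow₀ hQ hm).ne'
    field_simp
    linear_combination -this

/-- Series with coefficients in `ratFun` whose logarithmic derivative is twisted by an integral
polynomial. -/
theorem exists_LD_poly (N b : ℕ → ℕ → ℚ) (hN : ∀ n, (fun q => N n q) ∈ ratFun)
    (hN0 : ∀ q, N 0 q = 1)
    (hLD : ∀ q, 2 ≤ q → LD (mk fun n => N n q) (mk fun m => b m q)) (a : Polynomial ℤ) :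
    ∃ G : PowerSeries ratFun, constantCoeff G = 1 ∧ ∀ q : ℕ, 2 ≤ q →
      LD (PowerSeries.map ((Pi.evalRingHom (fun _ => ℚ) q).comp ratFun.subtype) G)
        (mk fun m => ((a.eval ((q : ℤ) ^ m) : ℤ) : ℚ) * b m q) := by
  have hne : ∀ G : PowerSeries ratFun, constantCoeff G = 1 → ∀ q : ℕ, constantCoeff
      (PowerSeries.map ((Pi.evalRingHom (fun _ => ℚ) q).comp ratFun.subtype) G) ≠ 0 := by
    intro G h0 q
    rw [← coeff_zero_eq_constantCoeff_apply, coeff_map, coeff_zero_eq_constantCoeff_apply, h0,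
      map_one]
    exact one_ne_zero
  let H : AddSubgroup (Polynomial ℤ) :=
    { carrier := {a | ∃ G : PowerSeries ratFun, constantCoeff G = 1 ∧ ∀ q : ℕ, 2 ≤ q →
        LD (PowerSeries.map ((Pi.evalRingHom (fun _ => ℚ) q).comp ratFun.subtype) G)
          (mk fun m => ((a.eval ((q : ℤ) ^ m) : ℤ) : ℚ) * b m q)}
      add_mem' := by
        rintro a a' ⟨G, h0, h⟩ ⟨G', h0', h'⟩
        refine ⟨G * G', by simp [h0, h0'], fun q hq => ?_⟩
        rw [map_mul]
        convert (h q hq).mul (h' q hq)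
        ext m
        simp [add_mul]
      zero_mem' := by
        refine ⟨1, by simp, fun q hq => ?_⟩
        rw [map_one]
        convert LD.one
        ext m
        simp
      neg_mem' := by
        rintro a ⟨G, h0, h⟩
        refine ⟨invOfUnit G 1, by simp, fun q hq => ?_⟩
        have h1 := (h q hq).inv (hne G h0 q)
        have h2 : PowerSeries.map ((Pi.evalRingHom (fun _ => ℚ) q).comp ratFun.subtype)
            (invOfUnit G 1) =
            (PowerSeries.map ((Pi.evalRingHom (fun _ => ℚ) q).comp ratFun.subtype) G)⁻¹ := by
          rw [PowerSeries.eq_inv_iff_mul_eq_one (hne G h0 q), ← map_mul,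
            invOfUnit_mul _ _ (by simp [h0]), map_one]
        rw [h2]
        convert h1
        ext m
        simp }
  suffices h : a ∈ H from h
  have hX : ∀ k, (Polynomial.X ^ k : Polynomial ℤ) ∈ H := by
    intro k
    refine ⟨mk fun n => ⟨fun q => ((q : ℚ) ^ k) ^ n * N n q, ratFun.mul_mem
      (by simpa [← pow_mul] using pow_mem_ratFun (k * n)) (hN n)⟩, ?_, fun q hq => ?_⟩
    · rw [← coeff_zero_eq_constantCoeff_apply, coeff_mk]
      ext q
      simp [hN0]
    · convert (hLD q hq).rescale ((q : ℚ) ^ k)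
      · ext n; simp
      · ext m; simp [← pow_mul, mul_comm]
  induction a using Polynomial.induction_on' with
  | add p r hp hr => exact H.add_mem hp hr
  | monomial n c =>
    have := H.zsmul_mem (hX n) c
    rwa [zsmul_eq_mul, ← Polynomial.C_eq_intCast, Polynomial.C_mul_X_pow_eq_monomial] at this

end QRep

end

section
open PowerSeries

namespace QRep

/-- Substitution of the monomial with exponent `β` into a power series. -/
noncomputable def phi {J : Type} (β : J →₀ ℕ) (hβ : β ≠ 0) :
    PowerSeries ℚ →ₐ[ℚ] MvPowerSeries J ℚ :=
  substAlgHom (HasSubst.monomial hβ (1 : ℚ))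

theorem smul_left_inj_of_ne {J : Type} (β : J →₀ ℕ) (hβ : β ≠ 0) {m n : ℕ} (h : m • β = n • β) : m = n := by
  obtain ⟨i, hi⟩ := DFunLike.ne_iff.1 hβ
  have := DFunLike.congr_fun h i
  simp only [Finsupp.coe_smul, Pi.smul_apply, smul_eq_mul] at this
  exact Nat.eq_of_mul_eq_mul_right (Nat.pos_of_ne_zero hi) this

section
variable {J : Type} (β : J →₀ ℕ) (hβ : β ≠ 0)

theorem coeff_phi (F : PowerSeries ℚ) (γ : J →₀ ℕ) [DecidableEq J] :
    MvPowerSeries.coeff γ (phi β hβ F) =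
      ∑ᶠ n : ℕ, if γ = n • β then coeff n F else 0 := by
  unfold phi
  rw [coe_substAlgHom, coeff_subst (HasSubst.monomial hβ (1 : ℚ))]
  refine finsum_congr fun n => ?_
  rw [MvPowerSeries.monomial_pow, one_pow, MvPowerSeries.coeff_monomial]
  split_ifs <;> simp

theorem coeff_phi_smul (F : PowerSeries ℚ) (n : ℕ) :
    MvPowerSeries.coeff (n • β) (phi β hβ F) = coeff n F := by
  classical
  rw [coeff_phi, finsum_eq_single _ n, if_pos rfl]
  intro m hm
  rw [if_neg]
  intro h
  exact hm (smul_left_inj_of_ne β hβ h).symm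

theorem coeff_phi_of_ne (F : PowerSeries ℚ) (γ : J →₀ ℕ) (h : ∀ n : ℕ, γ ≠ n • β) :
    MvPowerSeries.coeff γ (phi β hβ F) = 0 := by
  classical
  rw [coeff_phi]
  exact finsum_eq_zero_of_forall_eq_zero fun n => if_neg (h n)

theorem phi_expand (d : ℕ) (hd : d ≠ 0) (hdβ : d • β ≠ 0) (F : PowerSeries ℚ) :
    phi β hβ (expand d hd F) = phi (d • β) hdβ F := by
  ext γ
  by_cases hn : ∃ n : ℕ, γ = n • β
  · obtain ⟨n, rfl⟩ := hn
    rw [coeff_phi_smul, coeff_expand]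
    split_ifs with h
    · obtain ⟨m, rfl⟩ := h
      rw [Nat.mul_div_cancel_left _ (Nat.pos_of_ne_zero hd), mul_comm, mul_smul, coeff_phi_smul]
    · rw [coeff_phi_of_ne]
      intro m hm
      rw [← mul_smul] at hm
      exact h ⟨m, by rw [smul_left_inj_of_ne β hβ hm, mul_comm]⟩
  · push Not at hn
    rw [coeff_phi_of_ne _ _ _ _ hn, coeff_phi_of_ne]
    intro m
    rw [← mul_smul]
    exact hn _

end

end QRep

end

namespace QRep

/-- The Fitting idempotent of an element of a finite-dimensional algebra. -/
theorem exists_fitting (K : Type) [Field K] {A : Type} [Ring A] [Algebra K A]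
    [FiniteDimensional K A] (f : A) :
    ∃ (n : ℕ) (g : A), 0 < n ∧ Commute f g ∧ f ^ n * (f ^ n * g) = f ^ n := by
  let S := Algebra.adjoin K {f}
  let f' : S := ⟨f, Algebra.self_mem_adjoin_singleton K f⟩
  let _ : CommRing S := Algebra.adjoinCommRingOfComm K (by simp)
  have : IsArtinianRing S := IsArtinianRing.of_finite K S
  obtain ⟨n, y, h⟩ := IsArtinian.exists_pow_succ_smul_dvd f' (1 : S)
  simp only [smul_eq_mul, mul_one, Nat.succ_eq_add_one] at h
  have h1 : ∀ j, f' ^ (n + 1) = f' ^ (n + 1 + j) * y ^ j := by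
    intro j
    induction j with
    | zero => simp
    | succ j ih =>
      rw [ih]
      calc f' ^ (n + 1 + j) * y ^ j = f' ^ (j + 1) * f' ^ n * y ^ j := by ring
        _ = f' ^ (j + 1) * (f' ^ (n + 1) * y) * y ^ j := by rw [h]
        _ = _ := by ring
  have h2 : f' ^ (n + 1) * (f' ^ (n + 1) * y ^ (n + 1)) = f' ^ (n + 1) := by
    conv_rhs => rw [h1 (n + 1)]
    ring
  refine ⟨n + 1, (y ^ (n + 1) : S), Nat.succ_pos n, ?_, ?_⟩
  · exact congrArg Subtype.val (mul_comm f' (y ^ (n + 1)))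
  · exact congrArg Subtype.val h2

theorem isNilpotent_or_isUnit (K : Type) [Field K] {A : Type} [Ring A] [Algebra K A]
    [FiniteDimensional K A] (h : ∀ e : A, e * e = e → e = 0 ∨ e = 1) (f : A) :
    IsNilpotent f ∨ IsUnit f := by
  obtain ⟨n, g, hn, hc, he⟩ := exists_fitting K f
  have hidem : (f ^ n * g) * (f ^ n * g) = f ^ n * g := by
    rw [mul_assoc, ← mul_assoc g, ← (hc.pow_left n).eq, ← mul_assoc, ← mul_assoc,
      mul_assoc (f ^ n), he]
  rcases h _ hidem with h0 | h1
  · left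
    exact ⟨n, by rw [← he, h0, mul_zero]⟩
  · right
    have h2 : g * f ^ n = 1 := by rw [← (hc.pow_left n).eq, h1]
    have : IsUnit (f ^ n) := ⟨⟨f ^ n, g, h1, h2⟩, rfl⟩
    exact (isUnit_pow_iff hn.ne').1 this

theorem isUnit_of_isUnit_mul_right {A : Type} [Ring A] [Nontrivial A] (hA : ∀ x : A, IsNilpotent x ∨ IsUnit x) {y x : A}
    (h : IsUnit (y * x)) : IsUnit x := by
  rcases hA x with hx | hx
  · exfalso
    obtain ⟨n, hn⟩ := hx
    have : ∀ m, x ^ m = 0 → False := by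
      intro m
      induction m with
      | zero => simp
      | succ m ih =>
        intro hm
        apply ih
        apply h.mul_left_cancel
        rw [mul_zero, mul_assoc, ← pow_succ', hm, mul_zero]
    exact this n hn
  · exact hx

theorem mem_jacobson_iff_not_isUnit {A : Type} [Ring A] [Nontrivial A] (hA : ∀ x : A, IsNilpotent x ∨ IsUnit x) {x : A} :
    x ∈ Ring.jacobson A ↔ ¬ IsUnit x := by
  constructor
  · intro h hu
    exact (Ring.jacobson_lt_top A).ne (Ideal.eq_top_of_isUnit_mem _ h hu)
  · intro h
    rw [← Ideal.jacobson_bot, Ideal.mem_jacobson_iff]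
    intro y
    have h1 : IsNilpotent (y * x) :=
      (hA (y * x)).resolve_right fun hu => h (isUnit_of_isUnit_mul_right hA hu)
    obtain ⟨u, hu⟩ := h1.isUnit_add_one
    refine ⟨((u⁻¹ : Aˣ) : A), ?_⟩
    have : ((u⁻¹ : Aˣ) : A) * (y * x + 1) = 1 := by rw [← hu]; simp
    rw [Submodule.mem_bot, mul_assoc, ← mul_add_one, this, sub_self]

end QRep

section
open CategoryTheory

namespace QRep

section
variable {C : Type} [Category.{0} C] [Preadditive C]

/-- `X` is the direct sum of `Y` and `Z`. -/
def IsSum (X Y Z : C) : Prop :=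
  ∃ (i : Y ⟶ X) (p : X ⟶ Y) (j : Z ⟶ X) (r : X ⟶ Z),
    i ≫ p = 𝟙 Y ∧ j ≫ r = 𝟙 Z ∧ i ≫ r = 0 ∧ j ≫ p = 0 ∧ p ≫ i + r ≫ j = 𝟙 X

/-- `X` is nonzero and has no nontrivial idempotent endomorphism. -/
def IndecObj (X : C) : Prop :=
  𝟙 X ≠ 0 ∧ ∀ e : X ⟶ X, e ≫ e = e → e = 0 ∨ e = 𝟙 X

/-- The morphisms `X ⟶ J` all of whose composites `J ⟶ X ⟶ J` are in the radical. -/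
def radT (J X : C) : Submodule (End J) (X ⟶ J) where
  carrier := {f | ∀ g : J ⟶ X, End.of (g ≫ f) ∈ Ring.jacobson (End J)}
  add_mem' := by
    intro a b ha hb g
    rw [Preadditive.comp_add]
    exact add_mem (ha g) (hb g)
  zero_mem' := by
    intro g
    rw [Limits.comp_zero]
    exact zero_mem _
  smul_mem' := by
    intro c f hf g
    have : End.of (g ≫ (c • f)) = c * End.of (g ≫ f) := by
      simp only [End.mul_def, End.smul_right]
      exact (Category.assoc _ _ _).symm
    rw [this]
    exact Ideal.mul_mem_left _ _ (hf g)

theorem mem_radT {J X : C} {f : X ⟶ J} :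
    f ∈ radT J X ↔ ∀ g : J ⟶ X, End.of (g ≫ f) ∈ Ring.jacobson (End J) := Iff.rfl

/-- The quotient of `X ⟶ J` by the radical. -/
abbrev TT (J X : C) : Type := (X ⟶ J) ⧸ radT J X

/-- Contravariant functoriality of `TT J`. -/
def tmap (J : C) {X Y : C} (f : X ⟶ Y) : TT J Y →ₗ[End J] TT J X :=
  (radT J Y).mapQ (radT J X)
    { toFun := fun g => f ≫ g
      map_add' := fun a b => Preadditive.comp_add _ _ _ f a b
      map_smul' := fun c a => by simp [End.smul_right] }
    (by
      intro g hg k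
      have := hg (k ≫ f)
      simpa using this)

theorem tmap_mk (J : C) {X Y : C} (f : X ⟶ Y) (g : Y ⟶ J) :
    tmap J f (Submodule.Quotient.mk g) = Submodule.Quotient.mk (f ≫ g) := rfl

theorem tmap_id (J X : C) : tmap J (𝟙 X) = LinearMap.id := by
  ext g
  simp [tmap_mk]

theorem tmap_comp (J : C) {X Y Z : C} (f : X ⟶ Y) (g : Y ⟶ Z) :
    tmap J (f ≫ g) = tmap J f ∘ₗ tmap J g := by
  ext h
  simp [tmap_mk]

theorem tmap_add (J : C) {X Y : C} (f g : X ⟶ Y) : tmap J (f + g) = tmap J f + tmap J g := by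
  ext h
  simp [tmap_mk]

theorem tmap_zero (J X Y : C) : tmap J (0 : X ⟶ Y) = 0 := by
  ext h
  simp [tmap_mk]

/-- `TT J` turns isomorphisms into linear equivalences. -/
def tEquivOfIso (J : C) {X Y : C} (e : X ≅ Y) : TT J X ≃ₗ[End J] TT J Y :=
  LinearEquiv.ofLinearMap (tmap J e.inv) (tmap J e.hom)
    (by rw [← tmap_comp, e.inv_hom_id, tmap_id]) (by rw [← tmap_comp, e.hom_inv_id, tmap_id])

theorem nonempty_tEquiv_of_isSum (J : C) {X Y Z : C} (h : IsSum X Y Z) :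
    Nonempty (TT J X ≃ₗ[End J] (TT J Y × TT J Z)) := by
  obtain ⟨i, p, j, r, h1, h2, h3, h4, h5⟩ := h
  refine ⟨LinearEquiv.ofLinearMap ((tmap J i).prod (tmap J j))
    ((tmap J p).coprod (tmap J r)) ?_ ?_⟩
  · apply LinearMap.prod_ext
    · apply LinearMap.ext
      intro x
      apply Prod.ext
      · change tmap J i (tmap J p x + tmap J r 0) = x
        rw [map_zero, add_zero, ← LinearMap.comp_apply, ← tmap_comp, h1, tmap_id]; rfl
      · change tmap J j (tmap J p x + tmap J r 0) = 0
        rw [map_zero, add_zero, ← LinearMap.comp_apply, ← tmap_comp, h4, tmap_zero]; rfl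
    · apply LinearMap.ext
      intro x
      apply Prod.ext
      · change tmap J i (tmap J p 0 + tmap J r x) = 0
        rw [map_zero, zero_add, ← LinearMap.comp_apply, ← tmap_comp, h3, tmap_zero]; rfl
      · change tmap J j (tmap J p 0 + tmap J r x) = x
        rw [map_zero, zero_add, ← LinearMap.comp_apply, ← tmap_comp, h2, tmap_id]; rfl
  · apply LinearMap.ext
    intro x
    change tmap J p (tmap J i x) + tmap J r (tmap J j x) = x
    rw [← LinearMap.comp_apply, ← LinearMap.comp_apply, ← tmap_comp, ← tmap_comp,
      ← LinearMap.add_apply, ← tmap_add, h5, tmap_id]; rfl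

theorem IndecObj.nontrivial {X : C} (h : IndecObj X) : Nontrivial (End X) :=
  ⟨⟨𝟙 X, 0, h.1⟩⟩

theorem IndecObj.nonempty_iso_of_section {J X : C} (hJ : IndecObj J) (hX : IndecObj X)
    {i : J ⟶ X} {p : X ⟶ J} (h : i ≫ p = 𝟙 J) : Nonempty (J ≅ X) := by
  rcases hX.2 (p ≫ i) (by rw [Category.assoc, reassoc_of% h]) with h0 | h1
  · exfalso
    apply hJ.1
    have : i ≫ (p ≫ i) ≫ p = 𝟙 J := by simp [h]
    rw [← this, h0]; simp
  · exact ⟨⟨i, p, h, h1⟩⟩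

theorem IndecObj.of_iso {X Y : C} (h : IndecObj X) (e : X ≅ Y) : IndecObj Y := by
  constructor
  · intro h0
    apply h.1
    rw [← e.hom_inv_id, ← Category.id_comp e.inv, h0]; simp
  · intro f hf
    rcases h.2 (e.hom ≫ f ≫ e.inv) (by simp [reassoc_of% hf]) with h0 | h1
    · left
      have : e.inv ≫ (e.hom ≫ f ≫ e.inv) ≫ e.hom = f := by simp
      rw [← this, h0]; simp
    · right
      have : e.inv ≫ (e.hom ≫ f ≫ e.inv) ≫ e.hom = f := by simp
      rw [← this, h1]; simp

end

section
variable {C : Type} [Category.{0} C] [Preadditive C] (K : Type) [Field K] [Linear K C]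

instance scalarTower_end (X Y : C) : IsScalarTower K (End Y) (X ⟶ Y) where
  smul_assoc := by
    intro k f g
    exact Linear.comp_smul _ _ _ g k f

instance finite_end (X : C) [h : FiniteDimensional K (X ⟶ X)] : FiniteDimensional K (End X) := h

instance finite_TT (J X : C) [h : FiniteDimensional K (X ⟶ J)] : FiniteDimensional K (TT J X) :=
  Module.Finite.of_surjective ((radT J X).mkQ.restrictScalars K) (radT J X).mkQ_surjective

/-- The dimension of `TT J X` over the ground field. -/
noncomputable def tdim (J X : C) : ℕ := Module.finrank K (TT J X)

theorem tdim_congr (J : C) {X Y : C} (e : X ≅ Y) : tdim K J X = tdim K J Y :=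
  ((tEquivOfIso J e).restrictScalars K).finrank_eq

variable [∀ X Y : C, FiniteDimensional K (X ⟶ Y)]

section
include K

theorem IndecObj.nilp_or_unit {X : C} (h : IndecObj X) (f : End X) :
    IsNilpotent f ∨ IsUnit f :=
  isNilpotent_or_isUnit K (A := End X) (fun e he => h.2 e he) f

theorem IndecObj.mem_radT {J X : C} (h : IndecObj J) {f : X ⟶ J} :
    f ∈ radT J X ↔ ∀ g : J ⟶ X, ¬ IsUnit (End.of (g ≫ f)) := by
  have := h.nontrivial
  rw [QRep.mem_radT]
  exact forall_congr' fun g => mem_jacobson_iff_not_isUnit (h.nilp_or_unit K)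

theorem tdim_isSum (J : C) {X Y Z : C} (h : IsSum X Y Z) :
    tdim K J X = tdim K J Y + tdim K J Z := by
  obtain ⟨e⟩ := nonempty_tEquiv_of_isSum J h
  rw [tdim, (e.restrictScalars K).finrank_eq, Module.finrank_prod]
  rfl

theorem exists_section_of_tdim_ne_zero {J X : C} (hJ : IndecObj J) (h : tdim K J X ≠ 0) :
    ∃ (i : J ⟶ X) (p : X ⟶ J), i ≫ p = 𝟙 J := by
  by_contra hno
  apply h
  have : radT J X = ⊤ := by
    rw [eq_top_iff]
    intro f _
    rw [hJ.mem_radT K]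
    intro g hu
    obtain ⟨u, hu⟩ := hu
    exact hno ⟨((u⁻¹ : (End J)ˣ) : End J) ≫ g, f, by
      rw [Category.assoc]
      change ((u⁻¹ : (End J)ˣ) : End J) ≫ End.of (g ≫ f) = 𝟙 J
      rw [← hu]
      exact Units.mul_inv u⟩
  have : Subsingleton (TT J X) := Submodule.Quotient.subsingleton_iff.2 this
  exact Module.finrank_zero_of_subsingleton

theorem mk_ne_zero_of_section {J X : C} (hJ : IndecObj J) {i : J ⟶ X} {p : X ⟶ J}
    (h : i ≫ p = 𝟙 J) : (Submodule.Quotient.mk p : TT J X) ≠ 0 := by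
  rw [Ne, Submodule.Quotient.mk_eq_zero, hJ.mem_radT K]
  intro hn
  refine hn i ?_
  rw [h]
  exact isUnit_one (M := End J)

theorem tdim_ne_zero_of_section {J X : C} (hJ : IndecObj J) {i : J ⟶ X} {p : X ⟶ J}
    (h : i ≫ p = 𝟙 J) : tdim K J X ≠ 0 := by
  intro h0
  have := Module.finrank_zero_iff.1 h0
  exact mk_ne_zero_of_section K hJ h (Subsingleton.elim _ _)

theorem IndecObj.tdim_self_pos {J : C} (hJ : IndecObj J) : 0 < tdim K J J :=
  Nat.pos_of_ne_zero (tdim_ne_zero_of_section K hJ (i := 𝟙 J) (p := 𝟙 J) (by simp))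

theorem IndecObj.nonempty_iso_of_tdim_ne_zero {J X : C} (hJ : IndecObj J) (hX : IndecObj X)
    (h : tdim K J X ≠ 0) : Nonempty (J ≅ X) := by
  obtain ⟨i, p, hip⟩ := exists_section_of_tdim_ne_zero K hJ h
  exact hJ.nonempty_iso_of_section hX hip

end

end

section
variable {C : Type} [Category.{0} C] [Preadditive C] [IsIdempotentComplete C]

theorem exists_complement_of_section {J X : C} {i : J ⟶ X} {p : X ⟶ J} (h : i ≫ p = 𝟙 J) :
    ∃ (Z : C) (j : Z ⟶ X) (r : X ⟶ Z),
      j ≫ r = 𝟙 Z ∧ i ≫ r = 0 ∧ j ≫ p = 0 ∧ p ≫ i + r ≫ j = 𝟙 X := by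
  obtain ⟨Z, j, r, h1, h2⟩ := IsIdempotentComplete.idempotents_split X (𝟙 X - p ≫ i) (by
    simp [Preadditive.sub_comp, Preadditive.comp_sub, reassoc_of% h])
  refine ⟨Z, j, r, h1, ?_, ?_, ?_⟩
  · have : i ≫ (r ≫ j) ≫ r = i ≫ r := by simp [h1]
    rw [← this, h2]
    simp [Preadditive.sub_comp, Preadditive.comp_sub, reassoc_of% h]
  · have : j ≫ (r ≫ j) ≫ p = j ≫ p := by simp [reassoc_of% h1]
    rw [← this, h2]
    simp [Preadditive.sub_comp, h]
  · rw [h2]; simp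

theorem isSum_of_section {J X : C} {i : J ⟶ X} {p : X ⟶ J} (h : i ≫ p = 𝟙 J) :
    ∃ Z, IsSum X J Z := by
  obtain ⟨Z, j, r, h'⟩ := exists_complement_of_section h
  exact ⟨Z, i, p, j, r, h, h'⟩

end
end QRep

end

section
open CategoryTheory

namespace QRep

section
variable {C : Type} [Category.{0} C] [Preadditive C]

/-- Isomorphic summands have isomorphic sums. -/
theorem IsSum.nonempty_iso {X Y Z X' Y' Z' : C} (h : IsSum X Y Z) (h' : IsSum X' Y' Z')
    (e : Y ≅ Y') (f : Z ≅ Z') : Nonempty (X ≅ X') := by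
  obtain ⟨i, p, j, r, h1, h2, h3, h4, h5⟩ := h
  obtain ⟨i', p', j', r', h1', h2', h3', h4', h5'⟩ := h'
  refine ⟨⟨p ≫ e.hom ≫ i' + r ≫ f.hom ≫ j', p' ≫ e.inv ≫ i + r' ≫ f.inv ≫ j, ?_, ?_⟩⟩
  · simp [Preadditive.add_comp, Preadditive.comp_add, reassoc_of% h1', reassoc_of% h2',
      reassoc_of% h3', reassoc_of% h4', h5]
  · simp [Preadditive.add_comp, Preadditive.comp_add, reassoc_of% h1, reassoc_of% h2,
      reassoc_of% h3, reassoc_of% h4, h5']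

theorem IsSum.symm {X Y Z : C} (h : IsSum X Y Z) : IsSum X Z Y := by
  obtain ⟨i, p, j, r, h1, h2, h3, h4, h5⟩ := h
  exact ⟨j, r, i, p, h2, h1, h4, h3, by rw [add_comm, h5]⟩

theorem IsSum.of_iso {X X' Y Z : C} (h : IsSum X Y Z) (e : X ≅ X') : IsSum X' Y Z := by
  obtain ⟨i, p, j, r, h1, h2, h3, h4, h5⟩ := h
  refine ⟨i ≫ e.hom, e.inv ≫ p, j ≫ e.hom, e.inv ≫ r, by simpa, by simpa, by simpa, by simpa, ?_⟩
  have : e.inv ≫ (p ≫ i + r ≫ j) ≫ e.hom = 𝟙 X' := by rw [h5]; simp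
  simpa [Preadditive.add_comp, Preadditive.comp_add] using this

/-- A nonzero retract that is not everything gives a decomposition. -/
theorem not_indecObj_of_isSum {X Y Z : C} (h : IsSum X Y Z) (hY : 𝟙 Y ≠ 0) (hZ : 𝟙 Z ≠ 0) :
    ¬ IndecObj X := by
  obtain ⟨i, p, j, r, h1, h2, h3, h4, h5⟩ := h
  intro hX
  rcases hX.2 (p ≫ i) (by simp [reassoc_of% h1]) with h0 | h0
  · apply hY
    have : i ≫ (p ≫ i) ≫ p = 𝟙 Y := by simp [h1]
    rw [← this, h0]; simp
  · apply hZ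
    have : j ≫ (p ≫ i) ≫ r = 𝟙 Z := by rw [h0]; simpa
    rw [← this]; simp [reassoc_of% h4]

variable (K : Type) [Field K] [Linear K C] [∀ X Y : C, FiniteDimensional K (X ⟶ Y)]

section
include K

theorem finrank_end_lt_of_isSum {X Y Z : C} (h : IsSum X Y Z) (hZ : 𝟙 Z ≠ 0) :
    Module.finrank K (Y ⟶ Y) < Module.finrank K (X ⟶ X) := by
  obtain ⟨i, p, j, r, h1, h2, h3, h4, h5⟩ := h
  let φ : (Y ⟶ Y) →ₗ[K] (X ⟶ X) :=
    { toFun := fun f => p ≫ f ≫ i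
      map_add' := fun a b => by simp [Preadditive.add_comp, Preadditive.comp_add]
      map_smul' := fun c a => by simp }
  have hφ : Function.Injective φ := by
    rw [injective_iff_map_eq_zero]
    intro f hf
    have : i ≫ (p ≫ f ≫ i) ≫ p = f := by simp [reassoc_of% h1, h1]
    rw [← this]
    change i ≫ φ f ≫ p = 0
    rw [hf]; simp
  rw [← LinearMap.finrank_range_of_inj hφ]
  apply Submodule.finrank_lt
  rw [Ne, LinearMap.range_eq_top]
  intro hs
  obtain ⟨f, hf⟩ := hs (𝟙 X)
  apply hZ
  have : j ≫ (p ≫ f ≫ i) ≫ r = 𝟙 Z := by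
    change j ≫ φ f ≫ r = 𝟙 Z
    rw [hf]; simpa
  rw [← this]; simp [reassoc_of% h4]

variable [IsIdempotentComplete C]

/-- Every nonzero object has an indecomposable summand. -/
theorem exists_indec_section (X : C) (hX : 𝟙 X ≠ 0) :
    ∃ (J : C) (i : J ⟶ X) (p : X ⟶ J), IndecObj J ∧ i ≫ p = 𝟙 J := by
  induction h : Module.finrank K (X ⟶ X) using Nat.strong_induction_on generalizing X with
  | _ n ih =>
  by_cases hI : IndecObj X
  · exact ⟨X, 𝟙 X, 𝟙 X, hI, by simp⟩
  · have : ∃ e : X ⟶ X, e ≫ e = e ∧ e ≠ 0 ∧ e ≠ 𝟙 X := by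
      by_contra hno
      push Not at hno
      refine hI ⟨hX, fun e he => ?_⟩
      by_cases h0 : e = 0
      · exact Or.inl h0
      · exact Or.inr (hno e he h0)
    obtain ⟨e, he, h0, h1⟩ := this
    obtain ⟨Y, i, p, hip, hpi⟩ := IsIdempotentComplete.idempotents_split X e he
    obtain ⟨Z, j, r, hZs⟩ := exists_complement_of_section hip
    have hsum : IsSum X Y Z := ⟨i, p, j, r, hip, hZs⟩
    have hY : 𝟙 Y ≠ 0 := by
      intro hY
      apply h0
      rw [← hpi, ← Category.comp_id p, hY]; simp
    have hZ : 𝟙 Z ≠ 0 := by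
      intro hZ
      apply h1
      have hj : j = 0 := by rw [← Category.id_comp j, hZ]; simp
      rw [← hpi, ← hZs.2.2.2, hj]; simp
    obtain ⟨J, i', p', hJ, hip'⟩ := ih _ (h ▸ finrank_end_lt_of_isSum K hsum hZ) Y hY rfl
    exact ⟨J, i' ≫ i, p ≫ p', hJ, by simp [reassoc_of% hip, hip']⟩

/-- Krull–Schmidt: the numbers `tdim` determine an object. -/
theorem nonempty_iso_of_tdim_eq (X Y : C)
    (h : ∀ J : C, IndecObj J → tdim K J X = tdim K J Y) : Nonempty (X ≅ Y) := by
  induction hn : Module.finrank K (X ⟶ X) using Nat.strong_induction_on generalizing X Y with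
  | _ n ih =>
  by_cases hX : 𝟙 X = 0
  · have hY : 𝟙 Y = 0 := by
      by_contra hY
      obtain ⟨J, i, p, hJ, hip⟩ := exists_indec_section K Y hY
      obtain ⟨i', p', hip'⟩ := exists_section_of_tdim_ne_zero K hJ
        (h J hJ ▸ tdim_ne_zero_of_section K hJ hip)
      apply hJ.1
      rw [← hip', ← Category.id_comp p', hX]; simp
    exact ⟨⟨0, 0, by rw [hX]; simp, by rw [hY]; simp⟩⟩
  · obtain ⟨J, i, p, hJ, hip⟩ := exists_indec_section K X hX
    obtain ⟨Z, hs⟩ := isSum_of_section hip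
    obtain ⟨i', p', hip'⟩ := exists_section_of_tdim_ne_zero K hJ
        (h J hJ ▸ tdim_ne_zero_of_section K hJ hip)
    obtain ⟨Z', hs'⟩ := isSum_of_section hip'
    obtain ⟨e⟩ := ih _ (hn ▸ finrank_end_lt_of_isSum K hs.symm hJ.1) Z Z' (fun J' hJ' => by
      have := h J' hJ'
      rw [tdim_isSum K J' hs, tdim_isSum K J' hs'] at this
      omega) rfl
    exact hs.nonempty_iso hs' (Iso.refl J) e

end
end
end QRep

end

namespace QRep

/-- The number of surjective linear maps from dimension `c` to dimension `d`. -/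
def surjNum (c d : ℕ) (Q : ℚ) : ℚ := ∏ i ∈ Finset.range d, (Q ^ c - Q ^ i)

section
variable {K : Type*} [Field K] [Finite K]

theorem card_linearIndependent_rat {V : Type*} [AddCommGroup V] [Module K V]
    [FiniteDimensional K V] (k : ℕ) :
    (Nat.card {s : Fin k → V // LinearIndependent K s} : ℚ) =
      surjNum (Module.finrank K V) k (Nat.card K) := by
  have : Fintype K := Fintype.ofFinite K
  have : Finite V := Module.finite_of_finite K
  have : Fintype V := Fintype.ofFinite V
  rw [surjNum]
  rcases le_or_gt k (Module.finrank K V) with h | h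
  · rw [card_linearIndependent h, Finset.prod_range, Nat.cast_prod]
    refine Finset.prod_congr rfl fun i _ => ?_
    rw [Nat.card_eq_fintype_card, Nat.cast_sub]
    · push_cast; rfl
    · exact Nat.pow_le_pow_right Fintype.card_pos (by omega)
  · rw [Finset.prod_eq_zero (Finset.mem_range.2 h) (sub_self _)]
    have : IsEmpty {s : Fin k → V // LinearIndependent K s} := ⟨fun s => by
      have := s.2.fintype_card_le_finrank
      simp at this
      omega⟩
    simp

theorem card_hom {V W : Type*} [AddCommGroup V] [Module K V]
    [FiniteDimensional K V] [AddCommGroup W] [Module K W] [FiniteDimensional K W] :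
    Nat.card (V →ₗ[K] W) = Nat.card K ^ (Module.finrank K V * Module.finrank K W) := by
  have : Finite (V →ₗ[K] W) := Module.finite_of_finite K
  rw [Module.natCard_eq_pow_finrank (K := K), Module.finrank_linearMap]

theorem card_injective {V W : Type*} [AddCommGroup V] [Module K V]
    [FiniteDimensional K V] [AddCommGroup W] [Module K W] [FiniteDimensional K W] :
    (Nat.card {f : V →ₗ[K] W // Function.Injective f} : ℚ) =
      surjNum (Module.finrank K W) (Module.finrank K V) (Nat.card K) := by
  rw [← card_linearIndependent_rat]
  congr 1
  let b := Module.finBasis K V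
  refine Nat.card_congr ((b.constr K).symm.toEquiv.subtypeEquiv fun f => ?_)
  change _ ↔ LinearIndependent K ((b.constr K).symm f)
  obtain ⟨s, rfl⟩ := (b.constr K).surjective f
  rw [LinearEquiv.symm_apply_apply]
  have : s = (b.constr K s) ∘ b := by ext i; simp
  conv_rhs => rw [this]
  rw [← LinearMap.ker_eq_bot]
  constructor
  · intro h
    exact b.linearIndependent.map' _ h
  · intro h
    rw [LinearMap.ker_eq_bot', ]
    intro v hv
    have h2 := linearIndependent_iff.1 h (b.repr v) (by
      rw [← Finsupp.apply_linearCombination, b.linearCombination_repr, hv])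
    exact b.repr.map_eq_zero_iff.1 h2

theorem card_surjective {V W : Type*} [AddCommGroup V] [Module K V]
    [FiniteDimensional K V] [AddCommGroup W] [Module K W] [FiniteDimensional K W] :
    (Nat.card {f : V →ₗ[K] W // Function.Surjective f} : ℚ) =
      surjNum (Module.finrank K V) (Module.finrank K W) (Nat.card K) := by
  rw [← Subspace.dual_finrank_eq (V := V), ← Subspace.dual_finrank_eq (V := W), ← card_injective]
  congr 1
  have : Finite (V →ₗ[K] W) := Module.finite_of_finite K
  have : Finite (Module.Dual K W →ₗ[K] Module.Dual K V) := Module.finite_of_finite K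
  have hb : Function.Bijective (fun f : V →ₗ[K] W => f.dualMap) := by
    refine (Nat.bijective_iff_injective_and_card _).2 ⟨fun f g h => ?_, ?_⟩
    · ext v
      rw [← sub_eq_zero]
      refine (Module.forall_dual_apply_eq_zero_iff K _).1 fun φ => ?_
      have := LinearMap.congr_fun (LinearMap.congr_fun h φ) v
      simpa [sub_eq_zero] using this
    · rw [card_hom, card_hom, Subspace.dual_finrank_eq, Subspace.dual_finrank_eq, mul_comm]
  exact Nat.card_congr ((Equiv.ofBijective _ hb).subtypeEquiv fun f =>
    LinearMap.dualMap_injective_iff.symm)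

/-- Fibres of a surjective additive map all have the size of the kernel. -/
theorem card_fiber_mul {A B : Type*} [AddCommGroup A] [AddCommGroup B] [Finite A] (f : A →+ B)
    (hf : Function.Surjective f) (P : B → Prop) :
    Nat.card {a // P (f a)} = Nat.card f.ker * Nat.card {b // P b} := by
  rw [← Nat.card_prod]
  choose s hs using hf
  refine Nat.card_congr
    { toFun := fun a => (⟨a.1 - s (f a.1), by simp [AddMonoidHom.mem_ker, hs]⟩, ⟨f a.1, a.2⟩)
      invFun := fun x => ⟨x.1.1 + s x.2.1, by
        have := x.1.2
        rw [AddMonoidHom.mem_ker] at this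
        simpa [this, hs] using x.2.2⟩
      left_inv := fun a => by simp
      right_inv := ?_ }
  rintro ⟨⟨a, ha⟩, b, hb⟩
  rw [AddMonoidHom.mem_ker] at ha
  simp [ha, hs]

/-- The number of maps whose range spans `W` together with a given subspace. -/
theorem card_range_sup_eq_top {V W : Type*} [AddCommGroup V] [Module K V]
    [FiniteDimensional K V] [AddCommGroup W] [Module K W] [FiniteDimensional K W]
    (M : Submodule K W) :
    (Nat.card {u : V →ₗ[K] W // LinearMap.range u ⊔ M = ⊤} : ℚ) =
      (Nat.card K : ℚ) ^ (Module.finrank K V * Module.finrank K M) *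
      surjNum (Module.finrank K V) (Module.finrank K W - Module.finrank K M) (Nat.card K) := by
  have : Finite (V →ₗ[K] W) := Module.finite_of_finite K
  let φ : (V →ₗ[K] W) →+ (V →ₗ[K] W ⧸ M) :=
    { toFun := fun u => M.mkQ ∘ₗ u
      map_zero' := by simp
      map_add' := fun a b => by rw [LinearMap.comp_add] }
  have hφ : Function.Surjective φ := by
    intro u
    obtain ⟨s, hs⟩ := M.mkQ.exists_rightInverse_of_surjective M.range_mkQ
    exact ⟨s ∘ₗ u, by change M.mkQ ∘ₗ s ∘ₗ u = u; rw [← LinearMap.comp_assoc, hs]; rfl⟩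
  have h1 := card_fiber_mul φ hφ (fun u => Function.Surjective u)
  have h2 : Nat.card φ.ker = Nat.card (V →ₗ[K] M) := by
    refine Nat.card_congr
      { toFun := fun u => u.1.codRestrict M fun v => by
          have := LinearMap.congr_fun (AddMonoidHom.mem_ker.1 u.2) v
          exact (Submodule.Quotient.mk_eq_zero M).1 this
        invFun := fun u => ⟨M.subtype ∘ₗ u, by
          rw [AddMonoidHom.mem_ker]
          change M.mkQ ∘ₗ M.subtype ∘ₗ u = 0
          ext v
          simp⟩
        left_inv := fun u => rfl
        right_inv := fun u => rfl }
  have h3 : Nat.card {u : V →ₗ[K] W // LinearMap.range u ⊔ M = ⊤} =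
      Nat.card {u // Function.Surjective (φ u)} := by
    refine Nat.card_congr (Equiv.subtypeEquivRight fun u => ?_)
    change _ ↔ Function.Surjective (M.mkQ ∘ₗ u)
    rw [← LinearMap.range_eq_top, LinearMap.range_comp, ← Submodule.comap_injective_of_surjective
      M.mkQ_surjective |>.eq_iff, Submodule.comap_map_mkQ, Submodule.comap_top, sup_comm]
  rw [h3, h1, h2, card_hom, Nat.cast_mul, card_surjective, Nat.cast_pow]
  congr 2
  have := M.finrank_quotient_add_finrank
  omega

end
end QRep

namespace QRep

section
variable {K : Type*} [Field K] [Finite K]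
variable {V A : Type*} [AddCommGroup V] [Module K V] [FiniteDimensional K V]
  [AddCommGroup A] [Module K A] [FiniteDimensional K A]

/-- Factorisations of `n` through `A` as a surjection followed by an injection. -/
theorem card_factorizations {V' : Type*} [AddCommGroup V'] [Module K V']
    [FiniteDimensional K V'] (n : V →ₗ[K] V')
    (h : Module.finrank K (LinearMap.range n) = Module.finrank K A) :
    (Nat.card {t : (A →ₗ[K] V') × (V →ₗ[K] A) // (Function.Injective t.1 ∧
      Function.Surjective t.2) ∧ t.1 ∘ₗ t.2 = n} : ℚ) =
      surjNum (Module.finrank K A) (Module.finrank K A) (Nat.card K) := by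
  have hcard := card_injective (K := K) (V := A) (W := LinearMap.range n)
  rw [h] at hcard
  rw [← hcard]
  congr 1
  symm
  have hbij : ∀ f : A →ₗ[K] LinearMap.range n, Function.Injective f → Function.Bijective f :=
    fun f hf => ⟨hf, (LinearMap.injective_iff_surjective_of_finrank_eq_finrank h.symm).1 hf⟩
  refine Nat.card_congr (Equiv.ofBijective
    (fun f : {f : A →ₗ[K] LinearMap.range n // Function.Injective f} =>
    ⟨((LinearMap.range n).subtype ∘ₗ f.1,
    (LinearEquiv.ofBijective f.1 (hbij f.1 f.2)).symm.toLinearMap ∘ₗ n.rangeRestrict),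
    ⟨?_, ?_⟩, ?_⟩) ⟨?_, ?_⟩)
  · exact Subtype.val_injective.comp f.2
  · exact (LinearEquiv.surjective (LinearEquiv.ofBijective f.1 (hbij f.1 f.2)).symm).comp
      n.surjective_rangeRestrict
  · ext v
    change ((f.1 ((LinearEquiv.ofBijective f.1 (hbij f.1 f.2)).symm (n.rangeRestrict v)) :
      LinearMap.range n) : V') = n v
    have := (LinearEquiv.ofBijective f.1 (hbij f.1 f.2)).apply_symm_apply (n.rangeRestrict v)
    rw [LinearEquiv.ofBijective_apply] at this
    rw [this]; rfl
  · intro f g hfg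
    have := congrArg (fun t => t.1.1) hfg
    apply Subtype.ext
    ext a
    exact LinearMap.congr_fun this a
  · rintro ⟨⟨i, p⟩, ⟨hi, hp⟩, hn⟩
    simp only at hi hp hn
    have hr : ∀ a, i a ∈ LinearMap.range n := fun a => by
      obtain ⟨v, rfl⟩ := hp a
      exact ⟨v, by rw [← hn]; rfl⟩
    have hinj : Function.Injective (i.codRestrict _ hr) := fun a b hab =>
      hi (congrArg Subtype.val hab)
    refine ⟨⟨i.codRestrict _ hr, hinj⟩, ?_⟩
    apply Subtype.ext
    refine Prod.ext rfl ?_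
    ext v
    change (LinearEquiv.ofBijective (i.codRestrict _ hr) (hbij _ hinj)).symm
      (n.rangeRestrict v) = p v
    rw [LinearEquiv.symm_apply_eq]
    apply Subtype.ext
    change n v = i (p v)
    rw [← hn]; rfl

/-- Surjections with prescribed restriction along an injection. -/
theorem card_surjective_extending (i : A →ₗ[K] V) (hi : Function.Injective i) (m : A →ₗ[K] A) :
    (Nat.card {p : V →ₗ[K] A // Function.Surjective p ∧ p ∘ₗ i = m} : ℚ) =
      (Nat.card K : ℚ) ^ ((Module.finrank K V - Module.finrank K A) *
        Module.finrank K (LinearMap.range m)) *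
      surjNum (Module.finrank K V - Module.finrank K A)
        (Module.finrank K A - Module.finrank K (LinearMap.range m)) (Nat.card K) := by
  have h1 := card_range_sup_eq_top (V := V ⧸ LinearMap.range i) (LinearMap.range m)
  have h2 : Module.finrank K (V ⧸ LinearMap.range i) =
      Module.finrank K V - Module.finrank K A := by
    have := (LinearMap.range i).finrank_quotient_add_finrank
    rw [LinearMap.finrank_range_of_inj hi] at this
    omega
  rw [h2] at h1
  rw [← h1]
  congr 1
  symm
  obtain ⟨l, hl⟩ := i.exists_leftInverse_of_injective (LinearMap.ker_eq_bot.2 hi)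
  have hl' : ∀ a, l (i a) = a := fun a => LinearMap.congr_fun hl a
  let π := (LinearMap.range i).mkQ
  have hπ : ∀ a, π (i a) = 0 := fun a => by simp [π]
  have hrange : ∀ u : V ⧸ LinearMap.range i →ₗ[K] A,
      Function.Surjective (m ∘ₗ l + u ∘ₗ π) ↔ LinearMap.range u ⊔ LinearMap.range m = ⊤ := by
    intro u
    rw [← LinearMap.range_eq_top]
    suffices LinearMap.range (m ∘ₗ l + u ∘ₗ π) = LinearMap.range u ⊔ LinearMap.range m by
      rw [this]
    apply le_antisymm
    · rintro _ ⟨v, rfl⟩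
      rw [sup_comm]
      exact Submodule.add_mem_sup ⟨l v, rfl⟩ ⟨π v, rfl⟩
    · refine sup_le ?_ ?_
      · rintro _ ⟨c, rfl⟩
        obtain ⟨v, rfl⟩ := (LinearMap.range i).mkQ_surjective c
        refine ⟨v - i (l v), ?_⟩
        change m (l (v - i (l v))) + u (π (v - i (l v))) = u (π v)
        simp [hl', hπ]
      · rintro _ ⟨a, rfl⟩
        refine ⟨i a, ?_⟩
        change m (l (i a)) + u (π (i a)) = m a
        simp [hl', hπ]
  refine Nat.card_congr (Equiv.ofBijective (fun u => ⟨m ∘ₗ l + u.1 ∘ₗ π, ?_, ?_⟩) ⟨?_, ?_⟩)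
  · exact (hrange u.1).2 u.2
  · ext a
    change m (l (i a)) + u.1 (π (i a)) = m a
    simp [hl', hπ]
  · intro u w huw
    apply Subtype.ext
    have := congrArg Subtype.val huw
    have := add_left_cancel this
    ext v
    exact LinearMap.congr_fun this v
  · rintro ⟨p, hp, hpm⟩
    have hpm' : ∀ a, p (i a) = m a := fun a => LinearMap.congr_fun hpm a
    let u : V ⧸ LinearMap.range i →ₗ[K] A := (LinearMap.range i).liftQ (p - m ∘ₗ l) (by
      rintro _ ⟨a, rfl⟩
      simp [hl', hpm'])
    have hu : m ∘ₗ l + u ∘ₗ π = p := by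
      ext v
      change m (l v) + (p v - m (l v)) = p v
      abel
    exact ⟨⟨u, (hrange u).1 (by rwa [hu])⟩, Subtype.ext hu⟩

theorem isNilpotent_comp_of_comp {K V A : Type*} [Field K] [AddCommGroup V] [Module K V]
    [AddCommGroup A] [Module K A] (i : A →ₗ[K] V) (p : V →ₗ[K] A)
    (h : IsNilpotent (p ∘ₗ i : Module.End K A)) : IsNilpotent (i ∘ₗ p : Module.End K V) := by
  obtain ⟨k, hk⟩ := h
  refine ⟨k + 1, ?_⟩
  have : ∀ k, (i ∘ₗ p : Module.End K V) ^ (k + 1) =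
      i ∘ₗ ((p ∘ₗ i : Module.End K A) ^ k) ∘ₗ p := by
    intro k
    induction k with
    | zero => rw [pow_zero, zero_add, pow_one]; rfl
    | succ k ih => rw [pow_succ, ih, pow_succ]; rfl
  rw [this, hk]
  ext; simp

theorem isNilpotent_comp_comm {K V A : Type*} [Field K] [AddCommGroup V] [Module K V]
    [AddCommGroup A] [Module K A] {i : A →ₗ[K] V} {p : V →ₗ[K] A} :
    IsNilpotent (i ∘ₗ p : Module.End K V) ↔ IsNilpotent (p ∘ₗ i : Module.End K A) :=
  ⟨isNilpotent_comp_of_comp p i, isNilpotent_comp_of_comp i p⟩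

variable {V' A' : Type*} [AddCommGroup V'] [Module K V'] [FiniteDimensional K V']
  [AddCommGroup A'] [Module K A'] [FiniteDimensional K A']

theorem card_ext_zero (i : A →ₗ[K] V) (p' : V' →ₗ[K] A')
    (hi : Function.Injective i) (hp' : Function.Surjective p') :
    Nat.card {x : V →ₗ[K] V' // x ∘ₗ i = 0 ∧ p' ∘ₗ x = 0} =
      Nat.card K ^ ((Module.finrank K V - Module.finrank K A) *
        (Module.finrank K V' - Module.finrank K A')) := by
  have h2 : Module.finrank K (V ⧸ LinearMap.range i) =
      Module.finrank K V - Module.finrank K A := by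
    have := (LinearMap.range i).finrank_quotient_add_finrank
    rw [LinearMap.finrank_range_of_inj hi] at this
    omega
  have h3 : Module.finrank K (LinearMap.ker p') =
      Module.finrank K V' - Module.finrank K A' := by
    have := p'.finrank_range_add_finrank_ker
    rw [LinearMap.range_eq_top.2 hp', finrank_top] at this
    omega
  rw [← h2, ← h3, ← card_hom]
  exact Nat.card_congr
    { toFun := fun x => (LinearMap.range i).liftQ
        (x.1.codRestrict (LinearMap.ker p') fun v => LinearMap.congr_fun x.2.2 v) (by
          rintro _ ⟨a, rfl⟩
          exact Subtype.ext (LinearMap.congr_fun x.2.1 a))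
      invFun := fun u => ⟨(LinearMap.ker p').subtype ∘ₗ u ∘ₗ (LinearMap.range i).mkQ, by
          ext a
          have : (LinearMap.range i).mkQ (i a) = 0 := by simp
          change ((u ((LinearMap.range i).mkQ (i a)) : LinearMap.ker p') : V') = 0
          rw [this]; simp, by
          ext v
          simp⟩
      left_inv := fun x => rfl
      right_inv := fun u => by
        ext v
        rfl }

/-- Intertwiners of `i ∘ p` and `i' ∘ p'` in terms of those of `p ∘ i` and `p' ∘ i'`. -/
theorem card_intertwiners (i : A →ₗ[K] V) (p : V →ₗ[K] A) (i' : A' →ₗ[K] V') (p' : V' →ₗ[K] A')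
    (hi : Function.Injective i) (hp : Function.Surjective p)
    (hi' : Function.Injective i') (hp' : Function.Surjective p') :
    Nat.card {x : V →ₗ[K] V' // x ∘ₗ (i ∘ₗ p) = (i' ∘ₗ p') ∘ₗ x} =
      Nat.card K ^ ((Module.finrank K V - Module.finrank K A) *
        (Module.finrank K V' - Module.finrank K A')) *
      Nat.card {y : A →ₗ[K] A' // y ∘ₗ (p ∘ₗ i) = (p' ∘ₗ i') ∘ₗ y} := by
  rw [← card_ext_zero i p' hi hp', ← Nat.card_prod]
  obtain ⟨l, hl⟩ := i.exists_leftInverse_of_injective (LinearMap.ker_eq_bot.2 hi)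
  obtain ⟨s, hs⟩ := p'.exists_rightInverse_of_surjective (LinearMap.range_eq_top.2 hp')
  have hl' : ∀ a, l (i a) = a := fun a => LinearMap.congr_fun hl a
  have hs' : ∀ a, p' (s a) = a := fun a => LinearMap.congr_fun hs a
  symm
  refine Nat.card_congr (Equiv.ofBijective (fun t => ⟨t.1.1 + (i' ∘ₗ t.2.1 ∘ₗ l +
    s ∘ₗ (t.2.1 ∘ₗ p - p' ∘ₗ i' ∘ₗ t.2.1 ∘ₗ l)), ?_⟩) ⟨?_, ?_⟩)
  · obtain ⟨⟨x, hx1, hx2⟩, y, hy⟩ := t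
    have hx1 : ∀ a, x (i a) = 0 := fun a => LinearMap.congr_fun hx1 a
    have hx2 : ∀ a, p' (x a) = 0 := fun a => LinearMap.congr_fun hx2 a
    have hy : ∀ a, y (p (i a)) = p' (i' (y a)) := fun a => LinearMap.congr_fun hy a
    ext v
    simp [hx1, hx2, hl', hs', hy]
  · rintro ⟨⟨x, hx1, hx2⟩, y, hy⟩ ⟨⟨x', hx1', hx2'⟩, y', hy'⟩ h
    have h := fun v => LinearMap.congr_fun (congrArg Subtype.val h) v
    have hx1 : ∀ a, x (i a) = 0 := fun a => LinearMap.congr_fun hx1 a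
    have hy0 : ∀ a, y (p (i a)) = p' (i' (y a)) := fun a => LinearMap.congr_fun hy a
    have hx1' : ∀ a, x' (i a) = 0 := fun a => LinearMap.congr_fun hx1' a
    have hy0' : ∀ a, y' (p (i a)) = p' (i' (y' a)) := fun a => LinearMap.congr_fun hy' a
    have hyy : y = y' := by
      ext a
      have := h (i a)
      simp [hx1, hx1', hl', hy0, hy0'] at this
      exact hi' this
    subst hyy
    have hxx : x = x' := by
      ext v
      have := h v
      simpa using this
    subst hxx
    rfl
  · rintro ⟨x, hx⟩
    have hx : ∀ v, x (i (p v)) = i' (p' (x v)) := fun v => LinearMap.congr_fun hx v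
    obtain ⟨r, hr⟩ := p.exists_rightInverse_of_surjective (LinearMap.range_eq_top.2 hp)
    have hr' : ∀ a, p (r a) = a := fun a => LinearMap.congr_fun hr a
    let y : A →ₗ[K] A' := p' ∘ₗ x ∘ₗ r
    have hy1 : ∀ a, i' (y a) = x (i a) := fun a => by
      change i' (p' (x (r a))) = _
      rw [← hx, hr']
    have hy2 : ∀ v, p' (x v) = y (p v) := fun v => hi' (by rw [← hx, hy1])
    refine ⟨⟨⟨x - (i' ∘ₗ y ∘ₗ l + s ∘ₗ (y ∘ₗ p - p' ∘ₗ i' ∘ₗ y ∘ₗ l)), ?_, ?_⟩, ⟨y, ?_⟩⟩, ?_⟩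
    · ext a
      simp [hl', hy1, hy2]
    · ext a
      simp [hs', hy1, hy2]
    · ext a
      simp [hy1, hy2]
    · apply Subtype.ext
      simp

end
end QRep

namespace QRep

/-- Sums over fibres of a map. -/
theorem sum_comp_eq_sum_card_fiber {X Y : Type*} [Fintype X] [Fintype Y] (f : X → Y) (F : Y → ℚ) :
    ∑ x, F (f x) = ∑ y, F y * (Nat.card {x // f x = y} : ℚ) := by
  classical
  rw [← Finset.sum_fiberwise (s := Finset.univ) (g := f)]
  refine Finset.sum_congr rfl fun y _ => ?_
  rw [Finset.sum_congr rfl (g := fun _ => F y) (fun x hx => by rw [(Finset.mem_filter.1 hx).2]),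
    Finset.sum_const, nsmul_eq_mul, mul_comm, Nat.card_eq_fintype_card, Fintype.card_subtype]

/-- The number of elements satisfying fibrewise conditions. -/
theorem card_subtype_pi {I : Type*} [Fintype I] {T : I → Type*} (P : ∀ i, T i → Prop) :
    Nat.card {t : ∀ i, T i // ∀ i, P i (t i)} = ∏ i, Nat.card {t // P i t} := by
  rw [Nat.card_congr (Equiv.subtypePiEquivPi (p := fun i t => P i t)), Nat.card_pi]

/-- The number of surjections `p` and injections `i` with prescribed `p ∘ i` of rank `r`. -/
def factNum (n b r : ℕ) (Q : ℚ) : ℚ :=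
  surjNum n b Q * (Q ^ ((n - b) * r) * surjNum (n - b) (b - r) Q)

section
variable {K : Type*} [Field K] [Finite K]
variable {V A : Type*} [AddCommGroup V] [Module K V] [FiniteDimensional K V]
  [AddCommGroup A] [Module K A] [FiniteDimensional K A]

theorem card_swapped_factorizations (m : A →ₗ[K] A) :
    (Nat.card {t : (A →ₗ[K] V) × (V →ₗ[K] A) // (Function.Injective t.1 ∧
      Function.Surjective t.2) ∧ t.2 ∘ₗ t.1 = m} : ℚ) =
      factNum (Module.finrank K V) (Module.finrank K A)
        (Module.finrank K (LinearMap.range m)) (Nat.card K) := by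
  have : Finite (A →ₗ[K] V) := Module.finite_of_finite K
  have : Finite (V →ₗ[K] A) := Module.finite_of_finite K
  have e : {t : (A →ₗ[K] V) × (V →ₗ[K] A) // (Function.Injective t.1 ∧
      Function.Surjective t.2) ∧ t.2 ∘ₗ t.1 = m} ≃
      Σ i : {i : A →ₗ[K] V // Function.Injective i},
        {p : V →ₗ[K] A // Function.Surjective p ∧ p ∘ₗ i.1 = m} :=
    { toFun := fun t => ⟨⟨t.1.1, t.2.1.1⟩, ⟨t.1.2, t.2.1.2, t.2.2⟩⟩
      invFun := fun s => ⟨(s.1.1, s.2.1), ⟨s.1.2, s.2.2.1⟩, s.2.2.2⟩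
      left_inv := fun _ => rfl
      right_inv := fun _ => rfl }
  have : Fintype {i : A →ₗ[K] V // Function.Injective i} := Fintype.ofFinite _
  rw [Nat.card_congr e, Nat.card_sigma, Nat.cast_sum,
    Finset.sum_congr rfl (fun i _ => card_surjective_extending i.1 i.2 m), Finset.sum_const,
    nsmul_eq_mul, Finset.card_univ, ← Nat.card_eq_fintype_card, card_injective]
  rfl

theorem surjNum_self_ne_zero (n : ℕ) {Q : ℚ} (hQ : 1 < Q) : surjNum n n Q ≠ 0 := by
  rw [surjNum, Finset.prod_ne_zero_iff]
  intro i hi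
  rw [sub_ne_zero]
  exact (pow_lt_pow_right₀ hQ (Finset.mem_range.1 hi)).ne'

theorem one_lt_natCard_rat (K : Type*) [Field K] [Finite K] : (1 : ℚ) < Nat.card K := by
  exact_mod_cast Finite.one_lt_card

/-- The number of linear maps of given rank. -/
theorem card_rank_mul {V' : Type*} [AddCommGroup V'] [Module K V'] [FiniteDimensional K V']
    (r : ℕ) :
    (Nat.card {f : V →ₗ[K] V' // Module.finrank K (LinearMap.range f) = r} : ℚ) *
      surjNum r r (Nat.card K) =
    surjNum (Module.finrank K V') r (Nat.card K) * surjNum (Module.finrank K V) r (Nat.card K) := by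
  have : Finite (V →ₗ[K] V') := Module.finite_of_finite K
  have : Finite ((Fin r → K) →ₗ[K] V') := Module.finite_of_finite K
  have : Finite (V →ₗ[K] (Fin r → K)) := Module.finite_of_finite K
  have : Fintype {f : V →ₗ[K] V' // Module.finrank K (LinearMap.range f) = r} := Fintype.ofFinite _
  have hr : Module.finrank K (Fin r → K) = r := by simp
  have h1 := card_injective (K := K) (V := Fin r → K) (W := V')
  have h2 := card_surjective (K := K) (V := V) (W := Fin r → K)
  rw [hr] at h1 h2
  rw [← h1, ← h2, ← Nat.cast_mul, ← Nat.card_prod]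
  let X := {f : (Fin r → K) →ₗ[K] V' // Function.Injective f} ×
    {f : V →ₗ[K] Fin r → K // Function.Surjective f}
  have : Fintype X := Fintype.ofFinite _
  let g : X → {f : V →ₗ[K] V' // Module.finrank K (LinearMap.range f) = r} := fun t =>
    ⟨t.1.1 ∘ₗ t.2.1, by
      rw [LinearMap.range_comp, LinearMap.range_eq_top.2 t.2.2, Submodule.map_top,
        LinearMap.finrank_range_of_inj t.1.2, hr]⟩
  have h3 := sum_comp_eq_sum_card_fiber g (fun _ => 1)
  rw [Finset.sum_const, Finset.card_univ, nsmul_eq_mul, mul_one] at h3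
  change _ = (Nat.card X : ℚ)
  rw [Nat.card_eq_fintype_card (α := X), h3]
  rw [Finset.sum_congr rfl (g := fun _ => surjNum r r (Nat.card K : ℚ)), Finset.sum_const,
    nsmul_eq_mul, Finset.card_univ, Nat.card_eq_fintype_card]
  rintro ⟨n, hn⟩ -
  rw [one_mul]
  have h4 := card_factorizations (A := Fin r → K) n (by rw [hn, hr])
  rw [hr] at h4
  rw [← h4]
  congr 1
  exact Nat.card_congr
    { toFun := fun t => ⟨(t.1.1.1, t.1.2.1), ⟨t.1.1.2, t.1.2.2⟩, congrArg Subtype.val t.2⟩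
      invFun := fun t => ⟨(⟨t.1.1, t.2.1.1⟩, ⟨t.1.2, t.2.1.2⟩), Subtype.ext t.2.2⟩
      left_inv := fun _ => rfl
      right_inv := fun _ => rfl }

end

/-- `surjNum` of a sum of dimensions. -/
theorem surjNum_add (c d e : ℕ) (K : Type) [Field K] [Finite K] :
    surjNum (c + d) e (Nat.card K) = ∑ r ∈ Finset.range (e + 1),
      (surjNum e r (Nat.card K) * surjNum c r (Nat.card K) / surjNum r r (Nat.card K)) *
      ((Nat.card K : ℚ) ^ (d * r) * surjNum d (e - r) (Nat.card K)) := by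
  have hfr : ∀ n : ℕ, Module.finrank K (Fin n → K) = n := fun n => by simp
  have h1 := card_surjective (K := K) (V := (Fin c → K) × (Fin d → K)) (W := Fin e → K)
  rw [Module.finrank_prod, hfr, hfr, hfr] at h1
  rw [← h1]
  have : Finite ((Fin c → K) →ₗ[K] (Fin e → K)) := Module.finite_of_finite K
  have : Finite ((Fin d → K) →ₗ[K] (Fin e → K)) := Module.finite_of_finite K
  have : Fintype ((Fin c → K) →ₗ[K] (Fin e → K)) := Fintype.ofFinite _
  have e' : {f : (Fin c → K) × (Fin d → K) →ₗ[K] (Fin e → K) // Function.Surjective f} ≃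
      Σ f : (Fin c → K) →ₗ[K] (Fin e → K), {u : (Fin d → K) →ₗ[K] (Fin e → K) //
        LinearMap.range u ⊔ LinearMap.range f = ⊤} :=
    ((LinearMap.coprodEquiv K (M := Fin c → K) (M₂ := Fin d → K)
      (M₃ := Fin e → K)).toEquiv.subtypeEquiv (fun s => by
        change LinearMap.range s.2 ⊔ LinearMap.range s.1 = ⊤ ↔ Function.Surjective (s.1.coprod s.2)
        rw [← LinearMap.range_eq_top, LinearMap.range_coprod, sup_comm])).symm.trans
      (Equiv.subtypeProdEquivSigmaSubtype fun (f : (Fin c → K) →ₗ[K] (Fin e → K))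
        (u : (Fin d → K) →ₗ[K] (Fin e → K)) => LinearMap.range u ⊔ LinearMap.range f = ⊤)
  rw [Nat.card_congr e', Nat.card_sigma, Nat.cast_sum,
    Finset.sum_congr rfl (fun i _ => card_range_sup_eq_top (LinearMap.range i)), hfr, hfr]
  have hle : ∀ f : (Fin c → K) →ₗ[K] (Fin e → K), Module.finrank K (LinearMap.range f) ∈
      Finset.range (e + 1) := fun f => by
    have := (LinearMap.range f).finrank_le
    rw [hfr] at this
    simp; omega
  rw [← Finset.sum_fiberwise_of_maps_to (fun f _ => hle f)]
  refine Finset.sum_congr rfl fun r _ => ?_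
  rw [Finset.sum_congr rfl (g := fun _ => (Nat.card K : ℚ) ^ (d * r) *
    surjNum d (e - r) (Nat.card K)) (fun f hf => by rw [(Finset.mem_filter.1 hf).2]),
    Finset.sum_const, nsmul_eq_mul]
  congr 1
  rw [eq_div_iff (surjNum_self_ne_zero _ (one_lt_natCard_rat K))]
  have h2 := card_rank_mul (K := K) (V := Fin c → K) (V' := Fin e → K) r
  rw [hfr, hfr] at h2
  rw [← h2, Nat.card_eq_fintype_card (α := {f // _}), Fintype.card_subtype]

/-- All linear maps, by rank. -/
theorem sum_card_rank (c e : ℕ) (K : Type) [Field K] [Finite K] :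
    (Nat.card K : ℚ) ^ (c * e) = ∑ r ∈ Finset.range (e + 1),
      surjNum e r (Nat.card K) * surjNum c r (Nat.card K) / surjNum r r (Nat.card K) := by
  have hfr : ∀ n : ℕ, Module.finrank K (Fin n → K) = n := fun n => by simp
  have : Finite ((Fin c → K) →ₗ[K] (Fin e → K)) := Module.finite_of_finite K
  have : Fintype ((Fin c → K) →ₗ[K] (Fin e → K)) := Fintype.ofFinite _
  have h := card_hom (K := K) (V := Fin c → K) (W := Fin e → K)
  rw [hfr, hfr] at h
  have hle : ∀ f : (Fin c → K) →ₗ[K] (Fin e → K), Module.finrank K (LinearMap.range f) ∈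
      Finset.range (e + 1) := fun f => by
    have := (LinearMap.range f).finrank_le
    rw [hfr] at this
    simp; omega
  rw [← Nat.cast_pow, ← h, Nat.card_eq_fintype_card, ← Finset.card_univ,
    Finset.card_eq_sum_card_fiberwise (fun f _ => hle f), Nat.cast_sum]
  refine Finset.sum_congr rfl fun r _ => ?_
  rw [eq_div_iff (surjNum_self_ne_zero _ (one_lt_natCard_rat K))]
  have h2 := card_rank_mul (K := K) (V := Fin c → K) (V' := Fin e → K) r
  rw [hfr, hfr] at h2
  rw [← h2, Nat.card_eq_fintype_card (α := {f // _}), Fintype.card_subtype]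

end QRep

namespace QRep

section
variable {I Ω : Type} [Fintype Ω] (src tgt : Ω → I)

/-- Tuples of endomorphisms. -/
abbrev EndT (K : Type) [Field K] (α : I → ℕ) : Type :=
  ∀ i, (Fin (α i) → K) →ₗ[K] (Fin (α i) → K)

/-- The number of representations commuting with `n`. -/
noncomputable def wt {K : Type} [Field K] {α : I → ℕ} (n : EndT K α) : ℚ :=
  ∏ a : Ω, (Nat.card {x : (Fin (α (src a)) → K) →ₗ[K] (Fin (α (tgt a)) → K) //
    x ∘ₗ n (src a) = n (tgt a) ∘ₗ x} : ℚ)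

/-- All components are nilpotent. -/
def NilT {K : Type} [Field K] {α : I → ℕ} (n : EndT K α) : Prop :=
  ∀ i, IsNilpotent (n i : Module.End K (Fin (α i) → K))

/-- All components are nilpotent, of given ranks. -/
def NilRk {K : Type} [Field K] {α : I → ℕ} (β : I → ℕ) (n : EndT K α) : Prop :=
  NilT n ∧ ∀ i, Module.finrank K (LinearMap.range (n i)) = β i

/-- The number of pairs of a representation and a commuting nilpotent of given ranks. -/
noncomputable def rkSum (K : Type) [Field K] (α β : I → ℕ) : ℚ :=
  ∑ᶠ n : {n : EndT K α // NilRk β n}, wt src tgt n.1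

instance finite_linearMap (K : Type) [Field K] [Finite K] (m n : ℕ) :
    Finite ((Fin m → K) →ₗ[K] (Fin n → K)) := Module.finite_of_finite K

theorem nilSum_eq [Fintype I] [DecidableEq I] (K : Type) [Field K] [Finite K] (β : I → ℕ)
    (F : (I → ℕ) → ℚ) :
    ∑ᶠ m : {m : EndT K β // NilT m},
      wt src tgt m.1 * F (fun i => Module.finrank K (LinearMap.range (m.1 i))) =
    ∑ γ ∈ Fintype.piFinset (fun i => Finset.range (β i + 1)), rkSum src tgt K β γ * F γ := by
  classical
  have := Fintype.ofFinite {m : EndT K β // NilT m}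
  rw [finsum_eq_sum_of_fintype]
  rw [← Finset.sum_fiberwise_of_maps_to (s := Finset.univ)
    (t := Fintype.piFinset (fun i => Finset.range (β i + 1)))
    (g := fun m i => Module.finrank K (LinearMap.range (m.1 i)))]
  · refine Finset.sum_congr rfl fun γ _ => ?_
    have := Fintype.ofFinite {m : EndT K β // NilRk γ m}
    rw [rkSum, finsum_eq_sum_of_fintype, Finset.sum_mul]
    refine Finset.sum_bij' (fun m hm => ⟨m.1, m.2, fun i => ?_⟩) (fun m _ => ⟨m.1, m.2.1⟩)
      ?_ ?_ ?_ ?_ ?_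
    · exact congrFun (Finset.mem_filter.1 hm).2 i
    · intro m hm
      exact Finset.mem_univ _
    · intro m _
      exact Finset.mem_filter.2 ⟨Finset.mem_univ _, funext m.2.2⟩
    · intro m hm
      rfl
    · intro m hm
      rfl
    · intro m hm
      exact congrArg (fun t => wt src tgt m.1 * F t) (Finset.mem_filter.1 hm).2
  · intro m _
    rw [Fintype.mem_piFinset]
    intro i
    have := (LinearMap.range (m.1 i)).finrank_le
    simp at this
    simp; omega

theorem rkSum_rec [Fintype I] [DecidableEq I] (K : Type) [Field K] [Finite K] (α β : I → ℕ) :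
    rkSum src tgt K α β * ∏ i, surjNum (β i) (β i) (Nat.card K) =
    (Nat.card K : ℚ) ^ (∑ a, (α (src a) - β (src a)) * (α (tgt a) - β (tgt a))) *
    ∑ γ ∈ Fintype.piFinset (fun i => Finset.range (β i + 1)), rkSum src tgt K β γ *
      ∏ i, factNum (α i) (β i) (γ i) (Nat.card K) := by
  classical
  have hfr : ∀ n : ℕ, Module.finrank K (Fin n → K) = n := fun n => by simp
  let T : I → Type := fun i => ((Fin (β i) → K) →ₗ[K] (Fin (α i) → K)) ×
    ((Fin (α i) → K) →ₗ[K] (Fin (β i) → K))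
  let G : ∀ i, T i → Prop := fun i t => Function.Injective t.1 ∧ Function.Surjective t.2
  let X : Type := {t : ∀ i, T i // (∀ i, G i (t i)) ∧
    NilT (K := K) (α := α) (fun i => (t i).1 ∘ₗ (t i).2)}
  have := Fintype.ofFinite X
  have := Fintype.ofFinite {n : EndT K α // NilRk β n}
  have := Fintype.ofFinite {m : EndT K β // NilT m}
  let g1 : X → {n : EndT K α // NilRk β n} := fun t => ⟨fun i => (t.1 i).1 ∘ₗ (t.1 i).2, t.2.2,
    fun i => by
      rw [LinearMap.range_comp, LinearMap.range_eq_top.2 (t.2.1 i).2, Submodule.map_top,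
        LinearMap.finrank_range_of_inj (t.2.1 i).1, hfr]⟩
  let g2 : X → {m : EndT K β // NilT m} := fun t => ⟨fun i => (t.1 i).2 ∘ₗ (t.1 i).1,
    fun i => isNilpotent_comp_comm.1 (t.2.2 i)⟩
  have h1 := sum_comp_eq_sum_card_fiber g1 (fun n => wt src tgt n.1)
  have h2 := sum_comp_eq_sum_card_fiber g2 (fun n => wt src tgt n.1)
  have h3 : ∀ t, wt src tgt (g1 t).1 = (Nat.card K : ℚ) ^
      (∑ a, (α (src a) - β (src a)) * (α (tgt a) - β (tgt a))) * wt src tgt (g2 t).1 := by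
    intro t
    rw [wt, wt, ← Finset.prod_pow_eq_pow_sum, ← Finset.prod_mul_distrib]
    refine Finset.prod_congr rfl fun a _ => ?_
    have := card_intertwiners (t.1 (src a)).1 (t.1 (src a)).2 (t.1 (tgt a)).1 (t.1 (tgt a)).2
      (t.2.1 _).1 (t.2.1 _).2 (t.2.1 _).1 (t.2.1 _).2
    rw [hfr, hfr, hfr, hfr] at this
    exact_mod_cast this
  have h4 : ∀ n : {n : EndT K α // NilRk β n}, (Nat.card {t // g1 t = n} : ℚ) =
      ∏ i, surjNum (β i) (β i) (Nat.card K) := by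
    intro n
    have e : {t // g1 t = n} ≃ {t : ∀ i, T i // ∀ i, (Function.Injective (t i).1 ∧
        Function.Surjective (t i).2) ∧ (t i).1 ∘ₗ (t i).2 = n.1 i} :=
      { toFun := fun t => ⟨t.1.1, fun i => ⟨t.1.2.1 i, congrFun (congrArg Subtype.val t.2) i⟩⟩
        invFun := fun t => ⟨⟨t.1, fun i => (t.2 i).1, fun i => by
          have := n.2.1 i
          rw [← (t.2 i).2] at this
          exact this⟩, Subtype.ext (funext fun i => (t.2 i).2)⟩
        left_inv := fun _ => rfl
        right_inv := fun _ => rfl }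
    rw [Nat.card_congr e, card_subtype_pi (fun i (t : T i) => (Function.Injective t.1 ∧
        Function.Surjective t.2) ∧ t.1 ∘ₗ t.2 = n.1 i), Nat.cast_prod]
    refine Finset.prod_congr rfl fun i _ => ?_
    have := card_factorizations (A := Fin (β i) → K) (n.1 i) (by rw [n.2.2 i, hfr])
    rw [hfr] at this
    exact this
  have h5 : ∀ m : {m : EndT K β // NilT m}, (Nat.card {t // g2 t = m} : ℚ) =
      ∏ i, factNum (α i) (β i) (Module.finrank K (LinearMap.range (m.1 i))) (Nat.card K) := by
    intro m
    have e : {t // g2 t = m} ≃ {t : ∀ i, T i // ∀ i, (Function.Injective (t i).1 ∧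
        Function.Surjective (t i).2) ∧ (t i).2 ∘ₗ (t i).1 = m.1 i} :=
      { toFun := fun t => ⟨t.1.1, fun i => ⟨t.1.2.1 i, congrFun (congrArg Subtype.val t.2) i⟩⟩
        invFun := fun t => ⟨⟨t.1, fun i => (t.2 i).1, fun i => isNilpotent_comp_comm.2 (by
          have := m.2 i
          rw [← (t.2 i).2] at this
          exact this)⟩, Subtype.ext (funext fun i => (t.2 i).2)⟩
        left_inv := fun _ => rfl
        right_inv := fun _ => rfl }
    rw [Nat.card_congr e, card_subtype_pi (fun i (t : T i) => (Function.Injective t.1 ∧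
        Function.Surjective t.2) ∧ t.2 ∘ₗ t.1 = m.1 i), Nat.cast_prod]
    refine Finset.prod_congr rfl fun i _ => ?_
    have := card_swapped_factorizations (V := Fin (α i) → K) (m.1 i)
    rw [hfr, hfr] at this
    exact this
  have h6 := nilSum_eq src tgt K β (fun γ => ∏ i, factNum (α i) (β i) (γ i) (Nat.card K))
  rw [← h6, finsum_eq_sum_of_fintype, rkSum, finsum_eq_sum_of_fintype, Finset.sum_mul]
  simp_rw [h4] at h1
  simp_rw [h5] at h2
  rw [← h1, ← h2, Finset.mul_sum]
  exact Finset.sum_congr rfl fun t _ => h3 t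

end
end QRep

namespace QRep

theorem surjNum_mem_ratFun (c d : ℕ) : (fun q : ℕ => surjNum c d q) ∈ ratFun := by
  have : (fun q : ℕ => surjNum c d q) =
      ∏ i ∈ Finset.range d, ((fun q : ℕ => (q : ℚ) ^ c) - fun q : ℕ => (q : ℚ) ^ i) := by
    ext q
    simp [surjNum]
  rw [this]
  exact Subring.prod_mem _ fun i _ => sub_mem (pow_mem_ratFun _) (pow_mem_ratFun _)

theorem factNum_mem_ratFun (n b r : ℕ) : (fun q : ℕ => factNum n b r q) ∈ ratFun :=
  mul_mem (surjNum_mem_ratFun _ _) (mul_mem (pow_mem_ratFun _) (surjNum_mem_ratFun _ _))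

section
variable {I Ω : Type} [Fintype Ω] (src tgt : Ω → I)

theorem rkSum_zero (K : Type) [Field K] [Finite K] :
    rkSum src tgt K (0 : I → ℕ) 0 = 1 := by
  have : Unique {n : EndT K (0 : I → ℕ) // NilRk 0 n} :=
    { default := ⟨fun _ => 0, fun i => IsNilpotent.zero, fun i => by simp⟩
      uniq := fun n => by
        apply Subtype.ext
        funext i
        ext v j
        exact j.elim0 }
  rw [rkSum, finsum_unique, wt, Finset.prod_eq_one]
  intro a _
  have hs : Subsingleton ((Fin ((0 : I → ℕ) (src a)) → K) →ₗ[K]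
      (Fin ((0 : I → ℕ) (tgt a)) → K)) := ⟨fun x y => by
    ext v j
    exact j.elim0⟩
  have : Nat.card {x : (Fin ((0 : I → ℕ) (src a)) → K) →ₗ[K] (Fin ((0 : I → ℕ) (tgt a)) → K) //
      x ∘ₗ (default : {n : EndT K (0 : I → ℕ) // NilRk 0 n}).1 (src a) =
        (default : {n : EndT K (0 : I → ℕ) // NilRk 0 n}).1 (tgt a) ∘ₗ x} = 1 := by
    have : Unique {x : (Fin ((0 : I → ℕ) (src a)) → K) →ₗ[K]
        (Fin ((0 : I → ℕ) (tgt a)) → K) //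
      x ∘ₗ (default : {n : EndT K (0 : I → ℕ) // NilRk 0 n}).1 (src a) =
        (default : {n : EndT K (0 : I → ℕ) // NilRk 0 n}).1 (tgt a) ∘ₗ x} :=
      { default := ⟨0, Subsingleton.elim _ _⟩
        uniq := fun x => Subtype.ext (Subsingleton.elim _ _) }
    exact Nat.card_unique
  rw [this, Nat.cast_one]

theorem nilpotent_rank {K : Type} [Field K] {n : ℕ} {f : Module.End K (Fin n → K)}
    (hf : IsNilpotent f) (h : Module.finrank K (LinearMap.range f) = n) : n = 0 := by
  by_contra hn
  have h1 : LinearMap.range f = ⊤ := Submodule.eq_top_of_finrank_eq (by simp [h])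
  have hu : IsUnit f := by
    rw [Module.End.isUnit_iff]
    have := LinearMap.range_eq_top.1 h1
    exact ⟨LinearMap.injective_iff_surjective.2 this, this⟩
  obtain ⟨k, hk⟩ := hf
  have := hu.pow k
  rw [hk, isUnit_zero_iff] at this
  have := congrArg (fun g : Module.End K (Fin n → K) => g (fun _ => 1) ⟨0, by omega⟩) this
  simp at this

theorem rkSum_self (K : Type) [Field K] (α : I → ℕ) (hα : α ≠ 0) :
    rkSum src tgt K α α = 0 := by
  have : IsEmpty {n : EndT K α // NilRk α n} := ⟨fun n => hα <| funext fun i =>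
    nilpotent_rank (n.2.1 i) (n.2.2 i)⟩
  rw [rkSum, finsum_of_isEmpty]

theorem rkSum_of_not_le (K : Type) [Field K] (α β : I → ℕ) (h : ¬ β ≤ α) :
    rkSum src tgt K α β = 0 := by
  have : IsEmpty {n : EndT K α // NilRk β n} := ⟨fun n => h fun i => by
    have := (LinearMap.range (n.1 i)).finrank_le
    rw [n.2.2 i] at this
    simpa using this⟩
  rw [rkSum, finsum_of_isEmpty]

theorem rkSum_ratFun [Fintype I] (α β : I → ℕ) :
    ∃ f ∈ ratFun, ∀ (K : Type) [Field K] [Finite K], rkSum src tgt K α β = f (Nat.card K) := by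
  classical
  induction h : ∑ i, α i using Nat.strong_induction_on generalizing α β with
  | _ N ih =>
  by_cases hle : β ≤ α
  · by_cases heq : β = α
    · subst heq
      by_cases h0 : β = 0
      · subst h0
        exact ⟨1, one_mem _, fun K _ _ => rkSum_zero src tgt K⟩
      · exact ⟨0, zero_mem _, fun K _ _ => rkSum_self src tgt K _ h0⟩
    · have hlt : ∑ i, β i < N := by
        rw [← h]
        obtain ⟨hle', i, hi⟩ := Pi.lt_def.1 (lt_of_le_of_ne hle heq)
        exact Finset.sum_lt_sum (fun i _ => hle i) ⟨i, Finset.mem_univ _, hi⟩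
      choose f hf hfK using fun γ => ih _ hlt β γ rfl
      refine ⟨(fun q : ℕ => (q : ℚ) ^ (∑ a, (α (src a) - β (src a)) * (α (tgt a) - β (tgt a)))) *
        (∑ γ ∈ Fintype.piFinset (fun i => Finset.range (β i + 1)), f γ *
          ∏ i, fun q : ℕ => factNum (α i) (β i) (γ i) q) *
        ∏ i, fun q : ℕ => (∏ j ∈ Finset.range (β i), ((q : ℚ) ^ (β i) - (q : ℚ) ^ j))⁻¹,
        mul_mem (mul_mem (pow_mem_ratFun _) (sum_mem fun γ _ => mul_mem (hf γ)
          (prod_mem fun i _ => factNum_mem_ratFun _ _ _))) (prod_mem fun i _ =>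
            inv_gl_mem_ratFun _), fun K _ _ => ?_⟩
      have hrec := rkSum_rec src tgt K α β
      have hne : ∏ i, surjNum (β i) (β i) (Nat.card K) ≠ 0 :=
        Finset.prod_ne_zero_iff.2 fun i _ => surjNum_self_ne_zero _ (one_lt_natCard_rat K)
      rw [← eq_div_iff hne] at hrec
      rw [hrec, div_eq_mul_inv, ← Finset.prod_inv_distrib]
      simp only [Pi.mul_apply, Finset.sum_apply, Finset.prod_apply]
      congr 2
      exact Finset.sum_congr rfl fun γ _ => by rw [hfK γ K]
  · exact ⟨0, zero_mem _, fun K _ _ => rkSum_of_not_le src tgt K _ _ hle⟩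

/-- The number of pairs of a representation and a commuting nilpotent. -/
noncomputable def nilSum (K : Type) [Field K] (α : I → ℕ) : ℚ :=
  ∑ᶠ m : {m : EndT K α // NilT m}, wt src tgt m.1

theorem nilSum_eq_sum [Fintype I] [DecidableEq I] (K : Type) [Field K] [Finite K] (α : I → ℕ) :
    nilSum src tgt K α =
    ∑ γ ∈ Fintype.piFinset (fun i => Finset.range (α i + 1)), rkSum src tgt K α γ := by
  simpa [nilSum] using nilSum_eq src tgt K α (fun _ => 1)

theorem nilSum_ratFun [Fintype I] (α : I → ℕ) :
    ∃ f ∈ ratFun, ∀ (K : Type) [Field K] [Finite K], nilSum src tgt K α = f (Nat.card K) := by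
  classical
  choose f hf hfK using fun γ => rkSum_ratFun src tgt α γ
  refine ⟨∑ γ ∈ Fintype.piFinset (fun i => Finset.range (α i + 1)), f γ,
    sum_mem fun γ _ => hf γ, fun K _ _ => ?_⟩
  rw [nilSum_eq_sum, Finset.sum_apply]
  exact Finset.sum_congr rfl fun γ _ => hfK γ K

end

section
variable (K : Type) [Field K] [Finite K]

/-- The number of nilpotent endomorphisms of given rank. -/
theorem rkSum_unit (n b : ℕ) :
    rkSum (I := Unit) (Empty.elim : Empty → Unit) Empty.elim K (fun _ => n) (fun _ => b) =
      surjNum n b (Nat.card K) * surjNum (n - 1) b (Nat.card K) / surjNum b b (Nat.card K) := by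
  induction n using Nat.strong_induction_on generalizing b with
  | _ n ih =>
  have hne := surjNum_self_ne_zero b (one_lt_natCard_rat K)
  rcases lt_trichotomy b n with hlt | heq | hgt
  · rw [eq_div_iff hne]
    have h := rkSum_rec (I := Unit) (Empty.elim : Empty → Unit) Empty.elim K
      (fun _ => n) (fun _ => b)
    have h2 : ∑ γ ∈ Fintype.piFinset (fun _ : Unit => Finset.range (b + 1)),
        rkSum (I := Unit) (Empty.elim : Empty → Unit) Empty.elim K (fun _ => b) γ *
          ∏ i, factNum n b (γ i) (Nat.card K) = ∑ r ∈ Finset.range (b + 1),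
        rkSum (I := Unit) (Empty.elim : Empty → Unit) Empty.elim K (fun _ => b) (fun _ => r) *
          factNum n b r (Nat.card K) := by
      refine Finset.sum_nbij' (fun γ => γ ()) (fun r _ => r) ?_ ?_ ?_ ?_ ?_
      · intro γ hγ
        exact Fintype.mem_piFinset.1 hγ ()
      · intro r hr
        exact Fintype.mem_piFinset.2 fun _ => hr
      · intro γ _
        rfl
      · intro γ _
        rfl
      · intro γ _
        simp
    simp only [Finset.univ_unique, Finset.prod_singleton, Finset.univ_eq_empty,
      Finset.sum_empty, pow_zero, one_mul] at h h2
    rw [h, h2]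
    rw [Finset.sum_congr rfl (fun r _ => by rw [ih b hlt r, factNum])]
    rcases Nat.eq_zero_or_pos b with rfl | hb
    · simp [surjNum]
    · have h3 := surjNum_add (b - 1) (n - b) b K
      rw [show b - 1 + (n - b) = n - 1 by omega] at h3
      rw [h3, Finset.mul_sum]
      exact Finset.sum_congr rfl fun r _ => by ring
  · subst heq
    rcases Nat.eq_zero_or_pos b with rfl | hb
    · have := rkSum_zero (I := Unit) (Empty.elim : Empty → Unit) Empty.elim K
      simp only [surjNum, Finset.range_zero, Finset.prod_empty, mul_one, div_one]
      exact this
    · rw [rkSum_self _ _ _ _ (fun h => hb.ne' (congrFun h ()))]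
      have : surjNum (b - 1) b (Nat.card K) = 0 :=
        Finset.prod_eq_zero (i := b - 1) (by simp; omega) (sub_self _)
      rw [this]; simp
  · rw [rkSum_of_not_le _ _ _ _ _ (fun h => by have := h (); simp at this; omega)]
    have : surjNum n b (Nat.card K) = 0 :=
      Finset.prod_eq_zero (i := n) (by simp; omega) (sub_self _)
    rw [this]; simp

/-- The Fine–Herstein theorem on the number of nilpotent matrices. -/
theorem card_nilpotent (n : ℕ) :
    (Nat.card {f : Module.End K (Fin n → K) // IsNilpotent f} : ℚ) =
      (Nat.card K : ℚ) ^ (n ^ 2 - n) := by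
  have h1 := nilSum_eq_sum (I := Unit) (Empty.elim : Empty → Unit) Empty.elim K (fun _ => n)
  have h2 : ∑ γ ∈ Fintype.piFinset (fun _ : Unit => Finset.range (n + 1)),
      rkSum (I := Unit) (Empty.elim : Empty → Unit) Empty.elim K (fun _ => n) γ =
      ∑ r ∈ Finset.range (n + 1),
        rkSum (I := Unit) (Empty.elim : Empty → Unit) Empty.elim K (fun _ => n) (fun _ => r) := by
    refine Finset.sum_nbij' (fun γ => γ ()) (fun r _ => r) ?_ ?_ ?_ ?_ ?_
    · intro γ hγ
      exact Fintype.mem_piFinset.1 hγ ()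
    · intro r hr
      exact Fintype.mem_piFinset.2 fun _ => hr
    · intro γ _
      rfl
    · intro γ _
      rfl
    · intro γ _
      rfl
  rw [h2, Finset.sum_congr rfl (fun r _ => rkSum_unit K n r), ← sum_card_rank] at h1
  rw [show n ^ 2 - n = (n - 1) * n by rw [sq, Nat.sub_mul, one_mul], ← h1, nilSum]
  have e : {m : EndT K (fun _ : Unit => n) // NilT m} ≃
      {f : Module.End K (Fin n → K) // IsNilpotent f} :=
    { toFun := fun m => ⟨m.1 (), m.2 ()⟩
      invFun := fun f => ⟨fun _ => f.1, fun _ => f.2⟩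
      left_inv := fun _ => rfl
      right_inv := fun _ => rfl }
  have := Fintype.ofFinite {m : EndT K (fun _ : Unit => n) // NilT m}
  rw [← Nat.card_congr e, finsum_eq_sum_of_fintype, Finset.sum_congr rfl (g := fun _ => 1)]
  · simp
  · intro m _
    simp [wt]

end
end QRep

section
open CategoryTheory

namespace QRep

section
variable {C : Type} [Category.{0} C] [Preadditive C]

theorem smul_TT_eq_zero {J X : C} {a : End J} (ha : a ∈ Ring.jacobson (End J)) (x : TT J X) :
    a • x = 0 := by
  obtain ⟨f, rfl⟩ := Submodule.Quotient.mk_surjective _ x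
  rw [← Submodule.Quotient.mk_smul, Submodule.Quotient.mk_eq_zero, mem_radT]
  intro g
  have : End.of (g ≫ (a • f)) = a * End.of (g ≫ f) := by
    simp only [End.mul_def, End.smul_right]
    exact (Category.assoc _ _ _).symm
  rw [this]
  exact Ideal.mul_mem_right _ _ ha

variable (K : Type) [Field K] [Linear K C] [∀ X Y : C, FiniteDimensional K (X ⟶ Y)]

theorem radT_self (J : C) : (radT J J : Set (J ⟶ J)) = {f | End.of f ∈ Ring.jacobson (End J)} := by
  ext f
  constructor
  · intro h
    have := h (𝟙 J)
    simpa using this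
  · intro h g
    exact Ideal.mul_mem_right _ _ h

/-- The residue field of the endomorphism ring of an indecomposable object. -/
theorem IndecObj.exists_residue [Finite K] {J : C} (hJ : IndecObj J) :
    ∃ (k : Type) (_ : Field k) (_ : Finite k) (ρ : End J →+* k), Function.Surjective ρ ∧
      (∀ a, ρ a = 0 ↔ a ∈ Ring.jacobson (End J)) ∧ Nat.card k = Nat.card K ^ tdim K J J := by
  have := hJ.nontrivial
  let k := End J ⧸ Ring.jacobson (End J)
  have hfin : Finite (End J) := Module.finite_of_finite K
  have : Finite k := Quotient.finite _
  have hmem : ∀ a : End J, a ∈ Ring.jacobson (End J) ↔ ¬ IsUnit a := fun a =>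
    mem_jacobson_iff_not_isUnit (hJ.nilp_or_unit K)
  have hmk : ∀ a : End J, Ideal.Quotient.mk (Ring.jacobson (End J)) a = 0 ↔
      a ∈ Ring.jacobson (End J) := fun a => Ideal.Quotient.eq_zero_iff_mem
  have hdom : IsDomain k := by
    have : Nontrivial k := by
      refine ⟨⟨1, 0, fun h => ?_⟩⟩
      rw [← map_one (Ideal.Quotient.mk (Ring.jacobson (End J))), hmk, hmem] at h
      exact h isUnit_one
    have : NoZeroDivisors k := by
      refine ⟨fun {a b} h => ?_⟩
      obtain ⟨a, rfl⟩ := Ideal.Quotient.mk_surjective a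
      obtain ⟨b, rfl⟩ := Ideal.Quotient.mk_surjective b
      rw [← map_mul, hmk, hmem] at h
      rw [hmk, hmk, hmem, hmem]
      by_contra! hc
      exact h (hc.1.mul hc.2)
    exact NoZeroDivisors.to_isDomain k
  refine ⟨k, (Finite.isDomain_to_isField k).toField, inferInstance, Ideal.Quotient.mk _, ?_, ?_, ?_⟩
  · exact Ideal.Quotient.mk_surjective
  · exact hmk
  · rw [tdim, ← Module.natCard_eq_pow_finrank (K := K) (V := TT J J)]
    refine Nat.card_congr (Quotient.congr (Equiv.refl _) ?_)
    intro a b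
    have h1 := Submodule.quotientRel_def (Ring.jacobson (End J)) (x := a) (y := b)
    have h2 := Submodule.quotientRel_def (radT J J) (x := a) (y := b)
    have h3 : a - b ∈ radT J J ↔ a - b ∈ Ring.jacobson (End J) :=
      Set.ext_iff.1 (radT_self J) (a - b)
    exact h1.trans (h3.symm.trans h2.symm)

omit [∀ X Y : C, FiniteDimensional K (X ⟶ Y)] [Linear K C] in
theorem tmap_comp_mk {J X : C} (p : X ⟶ J) (g : J ⟶ X) (h : X ⟶ J) :
    tmap J (p ≫ g) (Submodule.Quotient.mk h) =
      End.of (g ≫ h) • (Submodule.Quotient.mk p : TT J X) := by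
  rw [tmap_mk, ← Submodule.Quotient.mk_smul, End.smul_right]
  simp

include K in
theorem IndecObj.tmap_eq_zero {J J' X : C} (hJ : IndecObj J) (hJ' : IndecObj J')
    (hne : IsEmpty (J' ≅ J)) (p : X ⟶ J) (g : J ⟶ X) : tmap J' (p ≫ g) = 0 := by
  apply LinearMap.ext
  intro x
  obtain ⟨h, rfl⟩ := Submodule.Quotient.mk_surjective _ x
  change (Submodule.Quotient.mk ((p ≫ g) ≫ h) : TT J' X) = 0
  rw [Submodule.Quotient.mk_eq_zero, hJ'.mem_radT K]
  rintro u ⟨v, hv⟩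
  have h1 : ((v⁻¹ : (End J')ˣ) : End J') ≫ (u ≫ (p ≫ g) ≫ h) = 𝟙 J' := by
    change ((v⁻¹ : (End J')ˣ) : End J') ≫ End.of (u ≫ (p ≫ g) ≫ h) = 𝟙 J'
    rw [← hv]
    exact Units.mul_inv v
  refine hne.elim (hJ'.nonempty_iso_of_section hJ (i := ((v⁻¹ : (End J')ˣ) : End J') ≫ u ≫ p)
    (p := g ≫ h) ?_).some
  simpa using h1

omit [∀ X Y : C, FiniteDimensional K (X ⟶ Y)] [Linear K C] in
theorem exists_functionals {J X : C} {k : Type} [Field k] {ρ : End J →+* k}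
    (hker : ∀ a, ρ a = 0 ↔ a ∈ Ring.jacobson (End J)) (hρ : Function.Surjective ρ)
    [Module k (TT J X)] [Module.Finite k (TT J X)]
    (hsmul : ∀ (c : End J) (x : TT J X), ρ c • x = c • x) :
    ∃ lam : (J ⟶ X) → Module.Dual k (TT J X),
      (∀ g h, lam g (Submodule.Quotient.mk h) = ρ (End.of (g ≫ h))) ∧
      Function.Surjective lam := by
  have hex : ∀ g : J ⟶ X, ∃ l : Module.Dual k (TT J X),
      ∀ h, l (Submodule.Quotient.mk h) = ρ (End.of (g ≫ h)) := by
    intro g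
    let l0 : TT J X →+ k := QuotientAddGroup.lift _
      (AddMonoidHom.mk' (fun h : X ⟶ J => ρ (End.of (g ≫ h))) (fun a b => by
        rw [Preadditive.comp_add, ← map_add])) (fun a ha => (hker _).2 (ha g))
    have hl0 : ∀ h, l0 (Submodule.Quotient.mk h) = ρ (End.of (g ≫ h)) := fun h => rfl
    refine ⟨{ l0 with map_smul' := ?_ }, hl0⟩
    intro c x
    obtain ⟨c, rfl⟩ := hρ c
    obtain ⟨a, rfl⟩ := Submodule.Quotient.mk_surjective _ x
    change l0 _ = ρ c * l0 _
    rw [hsmul, ← Submodule.Quotient.mk_smul, hl0, hl0, ← map_mul]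
    congr 1
    simp only [End.mul_def, End.smul_right]
    exact (Category.assoc _ _ _).symm
  choose lam hlam using hex
  let D : Submodule k (Module.Dual k (TT J X)) :=
    { carrier := Set.range lam
      add_mem' := by
        rintro _ _ ⟨a, rfl⟩ ⟨b, rfl⟩
        refine ⟨a + b, LinearMap.ext fun x => ?_⟩
        obtain ⟨h, rfl⟩ := Submodule.Quotient.mk_surjective _ x
        rw [LinearMap.add_apply, hlam, hlam, hlam, Preadditive.add_comp, ← map_add]
      zero_mem' := by
        refine ⟨0, LinearMap.ext fun x => ?_⟩
        obtain ⟨h, rfl⟩ := Submodule.Quotient.mk_surjective _ x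
        rw [hlam, Limits.zero_comp, LinearMap.zero_apply]
        exact map_zero ρ
      smul_mem' := by
        rintro c _ ⟨a, rfl⟩
        obtain ⟨c, rfl⟩ := hρ c
        refine ⟨c ≫ a, LinearMap.ext fun x => ?_⟩
        obtain ⟨h, rfl⟩ := Submodule.Quotient.mk_surjective _ x
        rw [LinearMap.smul_apply, hlam, hlam, smul_eq_mul, mul_comm, ← map_mul, End.mul_def,
          Category.assoc] }
  have hD : D = ⊤ := by
    have h0 : D.dualCoannihilator = ⊥ := by
      rw [eq_bot_iff]
      intro x hx
      obtain ⟨h, rfl⟩ := Submodule.Quotient.mk_surjective _ x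
      rw [Submodule.mem_bot, Submodule.Quotient.mk_eq_zero, mem_radT]
      intro g
      rw [← hker, ← hlam]
      exact (Submodule.mem_dualCoannihilator _).1 hx _ ⟨g, rfl⟩
    apply Submodule.eq_top_of_finrank_eq
    have := Subspace.finrank_add_finrank_dualCoannihilator_eq D
    rw [h0, finrank_bot, add_zero] at this
    rw [this, Subspace.dual_finrank_eq]
  refine ⟨lam, hlam, fun l => ?_⟩
  have : l ∈ D := by
    rw [hD]
    exact Submodule.mem_top
  exact this

/-- Every endomorphism of `TT J X` lifts to an endomorphism of `X` acting trivially on the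
other `TT J' X`, and the ring of these endomorphisms is a matrix ring over a finite field. -/
theorem IndecObj.exists_lift [Finite K] {J : C} (hJ : IndecObj J) (X : C) :
    (∀ φ : Module.End (End J) (TT J X), ∃ f : X ⟶ X, tmap J f = φ ∧
      ∀ J' : C, IndecObj J' → IsEmpty (J' ≅ J) → tmap J' f = 0) ∧
    ∃ (k : Type) (_ : Field k) (_ : Finite k) (n : ℕ),
      Nat.card k = Nat.card K ^ tdim K J J ∧ n * tdim K J J = tdim K J X ∧
      Nonempty (Module.End (End J) (TT J X) ≃+* Module.End k (Fin n → k)) := by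
  obtain ⟨k, _, _, ρ, hρ, hker, hcard⟩ := hJ.exists_residue K
  obtain ⟨_, hsmul⟩ : ∃ _ : Module k (TT J X), ∀ (c : End J) (x : TT J X), ρ c • x = c • x := by
    let _ : SMul k (TT J X) := ⟨fun c x => Function.surjInv hρ c • x⟩
    have hsmul : ∀ (c : End J) (x : TT J X), ρ c • x = c • x := by
      intro c x
      change Function.surjInv hρ (ρ c) • x = c • x
      rw [← sub_eq_zero, ← sub_smul]
      apply smul_TT_eq_zero
      rw [← hker, map_sub, Function.surjInv_eq hρ, sub_self]
    exact ⟨Function.Surjective.moduleLeft ρ hρ hsmul, hsmul⟩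
  have hfinT : Finite (TT J X) := Module.finite_of_finite K
  have : Module.Finite k (TT J X) := Module.Finite.of_finite
  let toK : Module.End (End J) (TT J X) ≃+* Module.End k (TT J X) :=
    { toFun := fun φ =>
        { toFun := φ
          map_add' := φ.map_add
          map_smul' := by
            intro c x
            obtain ⟨a, rfl⟩ := hρ c
            rw [hsmul, map_smul, RingHom.id_apply, hsmul] }
      invFun := fun φ =>
        { toFun := φ
          map_add' := φ.map_add
          map_smul' := by
            intro c x
            rw [← hsmul, map_smul, RingHom.id_apply, hsmul] }
      left_inv := fun φ => rfl
      right_inv := fun φ => rfl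
      map_mul' := fun a b => rfl
      map_add' := fun a b => rfl }
  obtain ⟨lam, hlam, hDm⟩ := exists_functionals (X := X) hker hρ hsmul
  let b := Module.finBasis k (TT J X)
  constructor
  · intro φ
    choose g hg using fun i => hDm (b.coord i)
    choose p hp using fun i => Submodule.Quotient.mk_surjective (radT J X) (φ (b i))
    refine ⟨∑ i, p i ≫ g i, ?_, ?_⟩
    · have hs : ∀ s : Finset (Fin (Module.finrank k (TT J X))),
          tmap J (∑ i ∈ s, p i ≫ g i) = ∑ i ∈ s, tmap J (p i ≫ g i) := fun s =>
        map_sum (AddMonoidHom.mk' (fun f : X ⟶ X => tmap J f) (tmap_add J)) _ _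
      rw [hs]
      apply LinearMap.ext
      intro x
      rw [LinearMap.sum_apply]
      have : φ x = toK φ (∑ i, b.coord i x • b i) := by
        have h := b.sum_repr x
        simp only [Module.Basis.coord_apply]
        rw [h]; rfl
      rw [this, map_sum]
      refine Finset.sum_congr rfl fun i _ => ?_
      rw [map_smul, ← hg]
      obtain ⟨h, rfl⟩ := Submodule.Quotient.mk_surjective _ x
      rw [hlam, tmap_comp_mk, hsmul, hp]
      rfl
    · intro J' hJ' hne
      have hs : ∀ s : Finset (Fin (Module.finrank k (TT J X))),
          tmap J' (∑ i ∈ s, p i ≫ g i) = ∑ i ∈ s, tmap J' (p i ≫ g i) := fun s =>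
        map_sum (AddMonoidHom.mk' (fun f : X ⟶ X => tmap J' f) (tmap_add J')) _ _
      rw [hs]
      exact Finset.sum_eq_zero fun i _ => hJ.tmap_eq_zero K hJ' hne _ _
  · refine ⟨k, inferInstance, inferInstance, Module.finrank k (TT J X), hcard, ?_, ?_⟩
    · have h1 : Nat.card (TT J X) = Nat.card k ^ Module.finrank k (TT J X) :=
        Module.natCard_eq_pow_finrank
      have h2 : Nat.card (TT J X) = Nat.card K ^ tdim K J X := Module.natCard_eq_pow_finrank
      rw [hcard, ← pow_mul, h2] at h1
      have h3 : 1 < Nat.card K := Finite.one_lt_card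
      have := Nat.pow_right_injective h3 h1
      rw [mul_comm, this]
    · exact ⟨toK.trans b.equivFun.conjRingEquiv⟩

end
end QRep

end

section
open CategoryTheory

namespace QRep

theorem card_isUnit_end (k : Type) [Field k] [Finite k] (n : ℕ) :
    (Nat.card {f : Module.End k (Fin n → k) // IsUnit f} : ℚ) =
      ∏ i ∈ Finset.range n, ((Nat.card k : ℚ) ^ n - (Nat.card k : ℚ) ^ i) := by
  have := Fintype.ofFinite k
  have h1 : Nat.card {f : Module.End k (Fin n → k) // IsUnit f} = Nat.card (GL (Fin n) k) := by
    refine (Nat.card_congr (Submonoid.unitsTypeEquivIsUnitSubmonoid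
      (M := Module.End k (Fin n → k))).toEquiv).symm.trans ?_
    exact Nat.card_congr (Units.mapEquiv
      (LinearMap.toMatrixAlgEquiv' (R := k) (n := Fin n)).toMulEquiv).toEquiv
  rw [h1, Matrix.card_GL_field, Nat.cast_prod, Finset.prod_range, Nat.card_eq_fintype_card]
  refine Finset.prod_congr rfl fun i _ => ?_
  rw [Nat.cast_sub (Nat.pow_le_pow_right Fintype.card_pos i.2.le)]
  push_cast
  rfl

theorem card_isNilpotent_div_card_isUnit (k : Type) [Field k] [Finite k] (n : ℕ) :
    (Nat.card {f : Module.End k (Fin n → k) // IsNilpotent f} : ℚ) *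
      (Nat.card {f : Module.End k (Fin n → k) // IsUnit f} : ℚ)⁻¹ = nu n (Nat.card k) := by
  rw [card_isUnit_end, card_nilpotent, nu]

section
variable {C : Type} [Category.{0} C] [Preadditive C] [IsIdempotentComplete C]
  (K : Type) [Field K] [Linear K C] [∀ X Y : C, FiniteDimensional K (X ⟶ Y)]

omit [IsIdempotentComplete C] in
theorem tmap_mul (J : C) {X : C} (f g : End X) :
    tmap J (f * g : End X) = tmap J g * tmap J f := tmap_comp J _ _

omit [IsIdempotentComplete C] in
theorem tmap_pow (J : C) {X : C} (f : End X) (n : ℕ) :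
    tmap J (f ^ n : End X) = (tmap J f : Module.End (End J) (TT J X)) ^ n := by
  induction n with
  | zero => exact tmap_id J X
  | succ n ih => rw [pow_succ, tmap_mul, ih, pow_succ']

variable {ι : Type} {S : ι → C}

include K in
theorem exists_fixed_of_idempotent (hS : ∀ s, IndecObj (S s)) {X : C}
    (hcov : ∀ J, IndecObj J → tdim K J X ≠ 0 → ∃ s, Nonempty (J ≅ S s))
    {e : End X} (he : e * e = e) (h0 : e ≠ 0) : ∃ s, ∃ v : TT (S s) X, v ≠ 0 ∧ tmap (S s) e v = v := by
  obtain ⟨Z, i, p, h1, h2⟩ := IsIdempotentComplete.idempotents_split X e he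
  have hZ : 𝟙 Z ≠ 0 := by
    intro hZ
    apply h0
    rw [← h2, ← Category.comp_id p, hZ]
    simp
  obtain ⟨J, u, v, hJ, huv⟩ := exists_indec_section K Z hZ
  obtain ⟨s, ⟨φ⟩⟩ := hcov J hJ (tdim_ne_zero_of_section K hJ (i := u ≫ i) (p := p ≫ v)
    (by simp [reassoc_of% h1, huv]))
  refine ⟨s, Submodule.Quotient.mk (p ≫ v ≫ φ.hom), ?_, ?_⟩
  · apply mk_ne_zero_of_section K (hS s) (i := φ.inv ≫ u ≫ i)
    simp [reassoc_of% h1, reassoc_of% huv]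
  · rw [tmap_mk]
    congr 1
    rw [← h2]
    simp [reassoc_of% h1]

include K in
theorem isNilpotent_iff_tmap (hS : ∀ s, IndecObj (S s)) {X : C}
    (hcov : ∀ J, IndecObj J → tdim K J X ≠ 0 → ∃ s, Nonempty (J ≅ S s)) (f : End X) :
    IsNilpotent f ↔ ∀ s, IsNilpotent (tmap (S s) f : Module.End (End (S s)) (TT (S s) X)) := by
  constructor
  · rintro ⟨n, hn⟩ s
    refine ⟨n, ?_⟩
    rw [← tmap_pow, hn]
    exact tmap_zero _ _ _
  · intro h
    by_contra hf
    obtain ⟨n, g, hn, hc, hfg⟩ := exists_fitting K (A := End X) f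
    have hc' : Commute (f ^ n) g := hc.pow_left n
    have hee : f ^ n * g * (f ^ n * g) = f ^ n * g := by
      calc f ^ n * g * (f ^ n * g) = f ^ n * (g * f ^ n) * g := by simp only [mul_assoc]
        _ = f ^ n * (f ^ n * g) * g := by rw [hc'.eq]
        _ = _ := by rw [hfg]
    obtain ⟨s, v, hv, hv'⟩ := exists_fixed_of_idempotent K hS hcov hee (by
      intro h0
      apply hf
      refine ⟨n, ?_⟩
      rw [← hfg, h0, mul_zero])
    have hE : IsNilpotent (tmap (S s) (f ^ n * g : End X) :
        Module.End (End (S s)) (TT (S s) X)) := by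
      have hcc : Commute (tmap (S s) g : Module.End (End (S s)) (TT (S s) X))
          (tmap (S s) (f ^ n : End X)) := by
        rw [Commute, SemiconjBy, ← tmap_mul, ← tmap_mul, hc'.eq]
      rw [tmap_mul]
      refine hcc.isNilpotent_mul_left ?_
      rw [tmap_pow]
      exact (h s).pow_of_pos hn.ne'
    obtain ⟨m, hm⟩ := hE
    have h1 : ∀ j : ℕ, ((tmap (S s) (f ^ n * g : End X) :
        Module.End (End (S s)) (TT (S s) X)) ^ j) v = v := by
      intro j
      induction j with
      | zero => rfl
      | succ j ih =>
        rw [pow_succ, Module.End.mul_apply]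
        exact (congrArg _ hv').trans ih
    apply hv
    rw [← h1 m, hm]
    rfl

include K in
theorem isUnit_iff_tmap (hS : ∀ s, IndecObj (S s)) {X : C}
    (hcov : ∀ J, IndecObj J → tdim K J X ≠ 0 → ∃ s, Nonempty (J ≅ S s)) (f : End X) :
    IsUnit f ↔ ∀ s, IsUnit (tmap (S s) f : Module.End (End (S s)) (TT (S s) X)) := by
  constructor
  · rintro ⟨u, rfl⟩ s
    refine ⟨⟨tmap (S s) (u : End X), tmap (S s) ((u⁻¹ : (End X)ˣ) : End X), ?_, ?_⟩, rfl⟩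
    · rw [← tmap_mul, Units.inv_mul]
      exact tmap_id _ _
    · rw [← tmap_mul, Units.mul_inv]
      exact tmap_id _ _
  · intro h
    by_contra hf
    obtain ⟨n, g, hn, hc, hfg⟩ := exists_fitting K (A := End X) f
    have hc' : Commute (f ^ n) g := hc.pow_left n
    have hee : f ^ n * g * (f ^ n * g) = f ^ n * g := by
      calc f ^ n * g * (f ^ n * g) = f ^ n * (g * f ^ n) * g := by simp only [mul_assoc]
        _ = f ^ n * (f ^ n * g) * g := by rw [hc'.eq]
        _ = _ := by rw [hfg]
    obtain ⟨s, v, hv, hv'⟩ := exists_fixed_of_idempotent K hS hcov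
      (e := 1 - f ^ n * g) (by
        rw [mul_sub, sub_mul, sub_mul, hee]
        simp) (by
      intro h0
      apply hf
      have h1 : f ^ n * g = 1 := (sub_eq_zero.1 h0).symm
      exact (isUnit_pow_iff hn.ne').1 ⟨⟨f ^ n, g, h1, hc'.eq ▸ h1⟩, rfl⟩)
    apply hv
    have h2 : (tmap (S s) (f ^ n : End X) : Module.End (End (S s)) (TT (S s) X)) v = 0 := by
      rw [← hv', ← Module.End.mul_apply, ← tmap_mul, sub_mul, mul_assoc, ← hc'.eq, hfg, one_mul,
        sub_self, tmap_zero]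
      rfl
    have h3 : IsUnit (tmap (S s) (f ^ n : End X) : Module.End (End (S s)) (TT (S s) X)) := by
      rw [tmap_pow]
      exact (h s).pow n
    exact ((Module.End.isUnit_iff _).1 h3).1 (h2.trans (map_zero _).symm)

/-- The ratio of nilpotent to invertible endomorphisms of `X` is a product over the indecomposable
types of the corresponding ratios for matrix rings. -/
theorem card_nilpotent_mul_card_isUnit_inv [Finite K] [Fintype ι] (hS : ∀ s, IndecObj (S s))
    (hne : ∀ s t, s ≠ t → IsEmpty (S s ≅ S t)) {X : C}
    (hcov : ∀ J, IndecObj J → tdim K J X ≠ 0 → ∃ s, Nonempty (J ≅ S s)) :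
    (Nat.card {f : End X // IsNilpotent f} : ℚ) * (Nat.card {f : End X // IsUnit f} : ℚ)⁻¹ =
      ∏ s, nu (tdim K (S s) X / tdim K (S s) (S s))
        ((Nat.card K : ℚ) ^ tdim K (S s) (S s)) := by
  classical
  let Φ : End X →+ ∀ s, Module.End (End (S s)) (TT (S s) X) :=
    { toFun := fun f s => tmap (S s) f
      map_zero' := funext fun s => tmap_zero _ _ _
      map_add' := fun f g => funext fun s => tmap_add _ _ _ }
  have hΦ : ∀ f s, Φ f s = tmap (S s) f := fun _ _ => rfl
  have hsurj : Function.Surjective Φ := by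
    intro φ
    choose f hf hf' using fun s => ((hS s).exists_lift K X).1 (φ s)
    refine ⟨∑ s, End.of (f s), ?_⟩
    rw [map_sum]
    funext t
    rw [Finset.sum_apply, Finset.sum_eq_single t]
    · exact hf t
    · intro s _ hst
      exact hf' s (S t) (hS t) (hne t s hst.symm)
    · simp
  have hfin : Finite (End X) := Module.finite_of_finite K
  have h1 := card_fiber_mul Φ hsurj
    (fun φ : ∀ s, Module.End (End (S s)) (TT (S s) X) => ∀ s, IsNilpotent (φ s))
  have h2 := card_fiber_mul Φ hsurj
    (fun φ : ∀ s, Module.End (End (S s)) (TT (S s) X) => ∀ s, IsUnit (φ s))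
  simp only [hΦ, ← isNilpotent_iff_tmap K hS hcov, ← isUnit_iff_tmap K hS hcov] at h1 h2
  have hk : (Nat.card Φ.ker : ℚ) ≠ 0 := by
    exact_mod_cast (Nat.card_pos (α := Φ.ker)).ne'
  rw [h1, h2, card_subtype_pi, card_subtype_pi]
  push_cast
  rw [mul_inv, mul_mul_mul_comm, mul_inv_cancel₀ hk, one_mul, ← Finset.prod_inv_distrib,
    ← Finset.prod_mul_distrib]
  refine Finset.prod_congr rfl fun s _ => ?_
  obtain ⟨k, _, _, n, hk, hn, ⟨e⟩⟩ := ((hS s).exists_lift K X).2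
  have h3 : tdim K (S s) X / tdim K (S s) (S s) = n := by
    rw [← hn, Nat.mul_div_cancel _ ((hS s).tdim_self_pos K)]
  rw [h3, ← Nat.cast_pow, ← hk, ← card_isNilpotent_div_card_isUnit]
  have e1 := Nat.card_congr (e.toEquiv.subtypeEquiv (p := fun a => IsNilpotent a)
    (q := fun a => IsNilpotent a) fun a => (IsNilpotent.map_iff e.injective).symm)
  have e2 := Nat.card_congr (e.toEquiv.subtypeEquiv (p := fun a => IsUnit a)
    (q := fun a => IsUnit a) fun a => (MulEquiv.isUnit_map e).symm)
  rw [e1, e2]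

end
end QRep

end

section
open CategoryTheory

namespace QRep

section
variable {I Ω : Type} (src tgt : Ω → I) (K : Type) [Field K]

/-- Representations of arbitrary dimension vector. -/
structure RepObj where
  /-- The dimension vector. -/
  dim : I → ℕ
  /-- The underlying representation. -/
  rep : Rep src tgt K dim

variable {src tgt K}

/-- The space of morphisms of representations. -/
def homSub (X Y : RepObj src tgt K) :
    Submodule K (∀ i, Matrix (Fin (Y.dim i)) (Fin (X.dim i)) K) where
  carrier := {f | ∀ a, Y.rep a * f (src a) = f (tgt a) * X.rep a}
  add_mem' := by
    intro f g hf hg a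
    simp only [Pi.add_apply, Matrix.mul_add, Matrix.add_mul]
    rw [hf a, hg a]
  zero_mem' := by
    intro a
    simp
  smul_mem' := by
    intro c f hf a
    simp only [Pi.smul_apply, Matrix.mul_smul, Matrix.smul_mul]
    rw [hf a]

instance : Category (RepObj src tgt K) where
  Hom X Y := homSub X Y
  id X := ⟨fun i => 1, fun a => by simp⟩
  comp f g := ⟨fun i => g.1 i * f.1 i, fun a => by
    rw [← Matrix.mul_assoc, g.2 a, Matrix.mul_assoc, f.2 a, Matrix.mul_assoc]⟩
  id_comp f := Subtype.ext (funext fun i => Matrix.mul_one _)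
  comp_id f := Subtype.ext (funext fun i => Matrix.one_mul _)
  assoc f g h := Subtype.ext (funext fun i => (Matrix.mul_assoc _ _ _).symm)

theorem hom_ext {X Y : RepObj src tgt K} {f g : X ⟶ Y} (h : ∀ i, f.1 i = g.1 i) : f = g :=
  Subtype.ext (funext h)

instance : Preadditive (RepObj src tgt K) where
  homGroup X Y := inferInstanceAs (AddCommGroup (homSub X Y))
  add_comp X Y Z f g h := hom_ext fun i => Matrix.mul_add _ _ _
  comp_add X Y Z f g h := hom_ext fun i => Matrix.add_mul _ _ _

instance : Linear K (RepObj src tgt K) where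
  homModule X Y := inferInstanceAs (Module K (homSub X Y))
  smul_comp X Y Z c f g := hom_ext fun i => Matrix.mul_smul (g.1 i) c (f.1 i)
  comp_smul X Y Z f c g := hom_ext fun i => Matrix.smul_mul c (g.1 i) (f.1 i)

theorem comp_apply {X Y Z : RepObj src tgt K} (f : X ⟶ Y) (g : Y ⟶ Z) (i : I) :
    (f ≫ g).1 i = g.1 i * f.1 i := rfl

theorem id_apply (X : RepObj src tgt K) (i : I) : (𝟙 X : X ⟶ X).1 i = 1 := rfl

theorem zero_apply (X Y : RepObj src tgt K) (i : I) : (0 : X ⟶ Y).1 i = 0 := rfl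

instance [Finite I] (X Y : RepObj src tgt K) : FiniteDimensional K (X ⟶ Y) := by
  have := Fintype.ofFinite I
  exact inferInstanceAs (FiniteDimensional K (homSub X Y))

theorem exists_idempotent_factor {n : ℕ} (e : Matrix (Fin n) (Fin n) K) (he : e * e = e) :
    ∃ (r : ℕ) (A : Matrix (Fin n) (Fin r) K) (B : Matrix (Fin r) (Fin n) K),
      B * A = 1 ∧ A * B = e := by
  let φ := Matrix.toLin' e
  have hφ : ∀ v, φ (φ v) = φ v := by
    intro v
    rw [← LinearMap.comp_apply, ← Matrix.toLin'_mul, he]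
  let b := Module.finBasis K (LinearMap.range φ)
  let ε := b.equivFun
  let A := (LinearMap.range φ).subtype ∘ₗ ε.symm.toLinearMap
  let B := ε.toLinearMap ∘ₗ φ.rangeRestrict
  have h1 : B ∘ₗ A = LinearMap.id := by
    apply LinearMap.ext
    intro v
    change ε (φ.rangeRestrict (ε.symm v)) = v
    have : φ.rangeRestrict (ε.symm v) = ε.symm v := by
      obtain ⟨w, hw⟩ := (ε.symm v).2
      apply Subtype.ext
      change φ (ε.symm v) = ε.symm v
      rw [← hw, hφ]
    rw [this, LinearEquiv.apply_symm_apply]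
  have h2 : A ∘ₗ B = φ := by
    apply LinearMap.ext
    intro v
    change ((ε.symm (ε (φ.rangeRestrict v)) : LinearMap.range φ) : Fin n → K) = φ v
    rw [LinearEquiv.symm_apply_apply]
    rfl
  refine ⟨_, LinearMap.toMatrix' A, LinearMap.toMatrix' B, ?_, ?_⟩
  · rw [← LinearMap.toMatrix'_comp, h1, LinearMap.toMatrix'_id]
  · rw [← LinearMap.toMatrix'_comp, h2, LinearMap.toMatrix'_toLin']

instance : IsIdempotentComplete (RepObj src tgt K) where
  idempotents_split X e he := by
    choose r A B h1 h2 using fun i => exists_idempotent_factor (e.1 i)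
      (congrFun (congrArg Subtype.val he) i)
    have hA : ∀ i, e.1 i * A i = A i := fun i => by
      rw [← h2, Matrix.mul_assoc, h1, Matrix.mul_one]
    have hB : ∀ i, B i * e.1 i = B i := fun i => by
      rw [← h2, ← Matrix.mul_assoc, h1, Matrix.one_mul]
    refine ⟨⟨r, fun a => B (tgt a) * X.rep a * A (src a)⟩, ⟨A, fun a => ?_⟩, ⟨B, fun a => ?_⟩,
      hom_ext h1, hom_ext h2⟩
    · change X.rep a * A (src a) = A (tgt a) * (B (tgt a) * X.rep a * A (src a))
      rw [← Matrix.mul_assoc, ← Matrix.mul_assoc, h2, ← e.2 a, Matrix.mul_assoc, hA]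
    · change B (tgt a) * X.rep a * A (src a) * B (src a) = B (tgt a) * X.rep a
      rw [Matrix.mul_assoc, h2, Matrix.mul_assoc, e.2 a, ← Matrix.mul_assoc, hB]

theorem isSum_dsum {β γ : I → ℕ} (x : Rep src tgt K β) (y : Rep src tgt K γ) :
    IsSum (⟨_, dsum src tgt x y⟩ : RepObj src tgt K) ⟨_, x⟩ ⟨_, y⟩ := by
  let rows : ∀ {m n k : ℕ}, Matrix (Fin m) (Fin k) K → Matrix (Fin n) (Fin k) K →
      Matrix (Fin (m + n)) (Fin k) K :=
    fun A B => (Matrix.fromRows A B).submatrix finSumFinEquiv.symm (Equiv.refl _)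
  let cols : ∀ {m n k : ℕ}, Matrix (Fin k) (Fin m) K → Matrix (Fin k) (Fin n) K →
      Matrix (Fin k) (Fin (m + n)) K :=
    fun A B => (Matrix.fromCols A B).submatrix (Equiv.refl _) finSumFinEquiv.symm
  have hcr : ∀ {m n k l : ℕ} (A : Matrix (Fin k) (Fin m) K) (B : Matrix (Fin k) (Fin n) K)
      (A' : Matrix (Fin m) (Fin l) K) (B' : Matrix (Fin n) (Fin l) K),
      cols A B * rows A' B' = A * A' + B * B' := by
    intro m n k l A B A' B'
    simp only [rows, cols]
    rw [Matrix.submatrix_mul_equiv, Matrix.fromCols_mul_fromRows]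
    rfl
  have hrc : ∀ {m n k l r : ℕ} (A : Matrix (Fin m) (Fin k) K) (B : Matrix (Fin n) (Fin k) K)
      (A' : Matrix (Fin k) (Fin l) K) (B' : Matrix (Fin k) (Fin r) K),
      rows A B * cols A' B' = Matrix.reindex finSumFinEquiv finSumFinEquiv
        (Matrix.fromBlocks (A * A') (A * B') (B * A') (B * B')) := by
    intro m n k l r A B A' B'
    simp only [rows, cols]
    rw [Matrix.submatrix_mul_equiv, Matrix.fromRows_mul_fromCols]
    rfl
  have hr : ∀ {m n k l : ℕ} (A : Matrix (Fin m) (Fin k) K) (B : Matrix (Fin n) (Fin k) K)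
      (A' : Matrix (Fin k) (Fin l) K), rows A B * A' = rows (A * A') (B * A') := by
    intro m n k l A B A'
    have : A' = A'.submatrix (Equiv.refl _) (Equiv.refl _) := rfl
    simp only [rows]
    conv_lhs => rw [this, Matrix.submatrix_mul_equiv]
    rw [Matrix.fromRows_mul]
  have hc : ∀ {m n k l : ℕ} (A : Matrix (Fin k) (Fin m) K) (B : Matrix (Fin k) (Fin n) K)
      (A' : Matrix (Fin l) (Fin k) K), A' * cols A B = cols (A' * A) (A' * B) := by
    intro m n k l A B A'
    have : A' = A'.submatrix (Equiv.refl _) (Equiv.refl _) := rfl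
    simp only [cols]
    conv_lhs => rw [this, Matrix.submatrix_mul_equiv]
    rw [Matrix.mul_fromCols]
  have hbr : ∀ a {k : ℕ} (A : Matrix (Fin (β (src a))) (Fin k) K) (B : Matrix (Fin (γ (src a))) (Fin k) K),
      dsum src tgt x y a * rows A B = rows (x a * A) (y a * B) := by
    intro a k A B
    simp only [rows]
    rw [dsum, Matrix.reindex_apply, Matrix.submatrix_mul_equiv]
    simp [Matrix.fromBlocks_mul_fromRows]
  have hcb : ∀ a {k : ℕ} (A : Matrix (Fin k) (Fin (β (tgt a))) K) (B : Matrix (Fin k) (Fin (γ (tgt a))) K),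
      cols A B * dsum src tgt x y a = cols (A * x a) (B * y a) := by
    intro a k A B
    simp only [cols]
    rw [dsum, Matrix.reindex_apply, Matrix.submatrix_mul_equiv]
    simp [Matrix.fromCols_mul_fromBlocks]
  refine ⟨⟨fun i => rows 1 0, fun a => ?_⟩, ⟨fun i => cols 1 0, fun a => ?_⟩,
    ⟨fun i => rows 0 1, fun a => ?_⟩, ⟨fun i => cols 0 1, fun a => ?_⟩,
    hom_ext fun i => ?_, hom_ext fun i => ?_, hom_ext fun i => ?_, hom_ext fun i => ?_,
    hom_ext fun i => ?_⟩
  · exact (hbr a _ _).trans (by simp [hr])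
  · exact (hc _ _ _).trans ((by simp : _ = _).trans (hcb a _ _).symm)
  · exact (hbr a _ _).trans (by simp [hr])
  · exact (hc _ _ _).trans ((by simp : _ = _).trans (hcb a _ _).symm)
  · exact (hcr _ _ _ _).trans (by simp [id_apply])
  · exact (hcr _ _ _ _).trans (by simp [id_apply])
  · exact (hcr _ _ _ _).trans (by simp [zero_apply])
  · exact (hcr _ _ _ _).trans (by simp [zero_apply])
  · refine (congrArg₂ (fun a b : Matrix (Fin (β i + γ i)) (Fin (β i + γ i)) K => a + b)
      (hrc _ _ _ _) (hrc _ _ _ _)).trans ?_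
    simp only [Matrix.reindex_apply]
    refine (congrFun (congrFun (Matrix.submatrix_add _ _) _) _).symm.trans ?_
    rw [Matrix.fromBlocks_add]
    simp [id_apply]

/-- The matrices of an isomorphism. -/
theorem nonempty_iso_iff {X Y : RepObj src tgt K} :
    Nonempty (X ≅ Y) ↔ RepIso src tgt X.rep Y.rep := by
  constructor
  · rintro ⟨e⟩
    have h1 : ∀ i, e.inv.1 i * e.hom.1 i = 1 := fun i => by
      rw [← comp_apply, e.hom_inv_id, id_apply]
    have h2 : ∀ i, e.hom.1 i * e.inv.1 i = 1 := fun i => by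
      rw [← comp_apply, e.inv_hom_id, id_apply]
    refine ⟨fun i => Matrix.toLin'OfInv (h1 i) (h2 i), fun a => ?_⟩
    change (Matrix.mulVecLin (Y.rep a)).comp (Matrix.mulVecLin (e.hom.1 (src a))) =
      (Matrix.mulVecLin (e.hom.1 (tgt a))).comp (Matrix.mulVecLin (X.rep a))
    rw [← Matrix.mulVecLin_mul, ← Matrix.mulVecLin_mul, e.hom.2 a]
  · rintro ⟨e, he⟩
    refine ⟨⟨⟨fun i => LinearMap.toMatrix' (e i : _ →ₗ[K] _), fun a => ?_⟩,
      ⟨fun i => LinearMap.toMatrix' ((e i).symm : _ →ₗ[K] _), fun a => ?_⟩,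
      hom_ext fun i => ?_, hom_ext fun i => ?_⟩⟩
    · apply Matrix.toLin'.injective
      rw [Matrix.toLin'_mul, Matrix.toLin'_mul, Matrix.toLin'_toMatrix', Matrix.toLin'_toMatrix']
      exact he a
    · apply Matrix.toLin'.injective
      rw [Matrix.toLin'_mul, Matrix.toLin'_mul, Matrix.toLin'_toMatrix', Matrix.toLin'_toMatrix']
      have := he a
      apply LinearMap.ext
      intro v
      apply (e (tgt a)).injective
      have := LinearMap.congr_fun this ((e (src a)).symm v)
      simp only [LinearMap.comp_apply, LinearEquiv.coe_coe, LinearEquiv.apply_symm_apply] at this ⊢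
      exact this.symm
    · rw [comp_apply, ← LinearMap.toMatrix'_comp]
      simp [id_apply]
    · rw [comp_apply, ← LinearMap.toMatrix'_comp]
      simp [id_apply]

theorem dim_eq_of_iso {X Y : RepObj src tgt K} (e : X ≅ Y) : X.dim = Y.dim := by
  obtain ⟨f, -⟩ := nonempty_iso_iff.1 ⟨e⟩
  funext i
  have := (f i).finrank_eq
  simpa using this

theorem id_eq_zero_iff (X : RepObj src tgt K) : 𝟙 X = 0 ↔ X.dim = 0 := by
  constructor
  · intro h
    funext i
    have h1 : (1 : Matrix (Fin (X.dim i)) (Fin (X.dim i)) K) = 0 := by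
      rw [← id_apply, h, zero_apply]
    by_contra h0
    have : Nonempty (Fin (X.dim i)) := ⟨⟨0, Nat.pos_of_ne_zero h0⟩⟩
    exact one_ne_zero h1
  · intro h
    refine hom_ext fun i => ?_
    ext a
    have h1 : X.dim i = 0 := congrFun h i
    exact absurd a.2 (by omega)

theorem isSum_iff {X Y Z : RepObj src tgt K} :
    IsSum X Y Z ↔ RepIso src tgt X.rep (dsum src tgt Y.rep Z.rep) := by
  constructor
  · intro h
    exact nonempty_iso_iff.1 (h.nonempty_iso (isSum_dsum Y.rep Z.rep) (Iso.refl Y) (Iso.refl Z))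
  · intro h
    obtain ⟨e⟩ := nonempty_iso_iff (X := X) (Y := ⟨_, dsum src tgt Y.rep Z.rep⟩) |>.2 h
    exact (isSum_dsum Y.rep Z.rep).of_iso e.symm

theorem dim_isSum {X Y Z : RepObj src tgt K} (h : IsSum X Y Z) : X.dim = Y.dim + Z.dim := by
  obtain ⟨e⟩ := h.nonempty_iso (isSum_dsum Y.rep Z.rep) (Iso.refl Y) (Iso.refl Z)
  exact dim_eq_of_iso e

theorem indec_iff {X : RepObj src tgt K} : Indec src tgt X.rep ↔ IndecObj X := by
  constructor
  · rintro ⟨h0, h⟩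
    refine ⟨fun h1 => h0 ((id_eq_zero_iff X).1 h1), fun e he => ?_⟩
    obtain ⟨Y, i, p, h1, h2⟩ := IsIdempotentComplete.idempotents_split X e he
    obtain ⟨Z, j, r, h3, h4, h5, h6⟩ := exists_complement_of_section h1
    by_cases hY : Y.dim = 0
    · left
      have := (id_eq_zero_iff Y).2 hY
      rw [← h2, ← Category.comp_id p, this]
      simp
    · by_cases hZ : Z.dim = 0
      · right
        have := (id_eq_zero_iff Z).2 hZ
        rw [← h6, ← Category.comp_id r, this, ← h2]
        simp
      · exact absurd (isSum_iff.1 ⟨i, p, j, r, h1, h3, h4, h5, h6⟩) (h _ _ _ _ hY hZ)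
  · intro h
    refine ⟨fun h0 => h.1 ((id_eq_zero_iff X).2 h0), fun β γ y z hβ hγ hxy => ?_⟩
    exact not_indecObj_of_isSum (isSum_iff (X := X) (Y := ⟨β, y⟩) (Z := ⟨γ, z⟩) |>.2 hxy)
      (fun h => hβ ((id_eq_zero_iff ⟨β, y⟩).1 h)) (fun h => hγ ((id_eq_zero_iff ⟨γ, z⟩).1 h)) h

theorem exists_glAct_iff {β : I → ℕ} (x y : Rep src tgt K β) :
    (∃ g : ∀ i, GL (Fin (β i)) K, glAct src tgt g x = y) ↔
      Nonempty ((⟨β, x⟩ : RepObj src tgt K) ≅ ⟨β, y⟩) := by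
  constructor
  · rintro ⟨g, rfl⟩
    refine ⟨⟨⟨fun i => (g i).1, fun a => ?_⟩, ⟨fun i => ((g i)⁻¹).1, fun a => ?_⟩,
      hom_ext fun i => ?_, hom_ext fun i => ?_⟩⟩
    · change _ * _ * _ * _ = _
      rw [Matrix.mul_assoc, ← Units.val_mul, inv_mul_cancel, Units.val_one, Matrix.mul_one]
    · change _ = _ * (_ * _ * _)
      rw [← Matrix.mul_assoc, ← Matrix.mul_assoc, ← Units.val_mul, inv_mul_cancel, Units.val_one,
        Matrix.one_mul]
    · exact (g i).inv_mul
    · exact (g i).mul_inv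
  · rintro ⟨e⟩
    refine ⟨fun i => ⟨e.hom.1 i, e.inv.1 i, ?_, ?_⟩, ?_⟩
    · exact congrFun (congrArg Subtype.val e.inv_hom_id) i
    · exact congrFun (congrArg Subtype.val e.hom_inv_id) i
    · funext a
      change e.hom.1 (tgt a) * x a * e.inv.1 (src a) = y a
      rw [← e.hom.2 a, Matrix.mul_assoc, ← comp_apply, e.inv_hom_id, id_apply, Matrix.mul_one]

end
end QRep

end

section
open CategoryTheory

namespace QRep

section
variable {I Ω : Type} {src tgt : Ω → I} {K : Type} [Field K]

instance finite_rep [Finite Ω] [Finite K] (α : I → ℕ) : Finite (Rep src tgt K α) :=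
  inferInstanceAs (Finite (∀ a : Ω, Matrix (Fin (α (tgt a))) (Fin (α (src a))) K))

theorem end_mul_apply {X : RepObj src tgt K} (f g : End X) (i : I) :
    (f * g : End X).1 i = f.1 i * g.1 i := rfl

theorem end_pow_apply {X : RepObj src tgt K} (f : End X) (n : ℕ) (i : I) :
    (f ^ n : End X).1 i = f.1 i ^ n := by
  induction n with
  | zero => rw [pow_zero, pow_zero]; rfl
  | succ n ih => rw [pow_succ, pow_succ, end_mul_apply, ih]

theorem isNilpotent_iff_apply [Finite I] {X : RepObj src tgt K} (f : End X) :
    IsNilpotent f ↔ ∀ i, IsNilpotent (f.1 i) := by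
  constructor
  · rintro ⟨n, hn⟩ i
    exact ⟨n, by rw [← end_pow_apply, hn]; rfl⟩
  · intro h
    choose n hn using h
    have := Fintype.ofFinite I
    refine ⟨∑ i, n i, hom_ext fun i => ?_⟩
    rw [end_pow_apply]
    exact pow_eq_zero_of_le (Finset.single_le_sum (fun _ _ => Nat.zero_le _)
      (Finset.mem_univ i)) (hn i)

theorem isUnit_iff_apply {X : RepObj src tgt K} (f : End X) :
    IsUnit f ↔ ∀ i, IsUnit (f.1 i) := by
  constructor
  · rintro ⟨u, rfl⟩ i
    refine ⟨⟨(u : End X).1 i, (↑u⁻¹ : End X).1 i, ?_, ?_⟩, rfl⟩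
    · rw [← end_mul_apply, Units.mul_inv]; rfl
    · rw [← end_mul_apply, Units.inv_mul]; rfl
  · intro h
    choose u hu using h
    have hf : ∀ a, ((u (tgt a))⁻¹).1 * X.rep a = X.rep a * ((u (src a))⁻¹).1 := fun a => by
      have h := f.2 a
      rw [← hu, ← hu] at h
      calc ((u (tgt a))⁻¹).1 * X.rep a
          = ((u (tgt a))⁻¹).1 * (X.rep a * (u (src a)).1) * ((u (src a))⁻¹).1 := by
            rw [Matrix.mul_assoc, Matrix.mul_assoc, Units.mul_inv, Matrix.mul_one]
        _ = _ := by
            rw [h, ← Matrix.mul_assoc, Units.inv_mul, Matrix.one_mul]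
    refine ⟨⟨f, ⟨fun i => ((u i)⁻¹).1, fun a => (hf a).symm⟩, hom_ext fun i => ?_,
      hom_ext fun i => ?_⟩, rfl⟩
    · change f.1 i * ((u i)⁻¹).1 = 1
      rw [← hu, Units.mul_inv]
    · change ((u i)⁻¹).1 * f.1 i = 1
      rw [← hu, Units.inv_mul]

theorem wt_eq [Fintype Ω] {α : I → ℕ} (m : EndT K α) :
    wt src tgt m = Nat.card {x : Rep src tgt K α //
      ∀ a, Matrix.toLin' (x a) ∘ₗ m (src a) = m (tgt a) ∘ₗ Matrix.toLin' (x a)} := by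
  rw [wt, ← Nat.cast_prod, ← card_subtype_pi]
  congr 1
  refine Nat.card_congr (Equiv.subtypeEquiv (Equiv.piCongrRight fun a => Matrix.toLin'.toEquiv)
    fun x => Iff.rfl).symm

theorem nilSum_eq_sum_card [Fintype I] [Fintype Ω] [Finite K] (α : I → ℕ)
    [Fintype (Rep src tgt K α)] :
    nilSum src tgt K α = ∑ x : Rep src tgt K α,
      (Nat.card {f : End (⟨α, x⟩ : RepObj src tgt K) // IsNilpotent f} : ℚ) := by
  have : Finite (EndT K α) := inferInstance
  have : Fintype {m : EndT K α // NilT m} := Fintype.ofFinite _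
  rw [nilSum, finsum_eq_sum_of_fintype]
  simp only [wt_eq]
  rw [← Nat.cast_sum, ← Nat.cast_sum, ← Nat.card_sigma]
  have : ∀ x : Rep src tgt K α, Finite {f : End (⟨α, x⟩ : RepObj src tgt K) // IsNilpotent f} :=
    fun x => by
      have : Finite ((⟨α, x⟩ : RepObj src tgt K) ⟶ ⟨α, x⟩) := Module.finite_of_finite K
      exact inferInstanceAs (Finite {f : ((⟨α, x⟩ : RepObj src tgt K) ⟶ ⟨α, x⟩) //
        IsNilpotent (End.of f)})
  rw [← Nat.card_sigma]
  congr 1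
  refine Nat.card_congr (Equiv.ofBijective (fun p => ⟨p.2.1,
    ⟨⟨fun i => LinearMap.toMatrix' (p.1.1 i), fun a => ?_⟩, ?_⟩⟩) ⟨?_, ?_⟩)
  · have := congrArg LinearMap.toMatrix' (p.2.2 a)
    rw [LinearMap.toMatrix'_comp, LinearMap.toMatrix'_comp, LinearMap.toMatrix'_toLin'] at this
    exact this
  · refine (isNilpotent_iff_apply _).2 fun i => ?_
    exact (p.1.2 i).map (LinearMap.toMatrixAlgEquiv' (R := K) (n := Fin (α i)))
  · rintro ⟨⟨m, hm⟩, x, hx⟩ ⟨⟨m', hm'⟩, x', hx'⟩ h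
    rw [Sigma.mk.injEq] at h
    obtain ⟨h1, h2⟩ := h
    change x = x' at h1
    subst h1
    have h3 := congrArg (fun f => f.1.1) (eq_of_heq h2)
    have : m = m' := by
      funext i
      exact LinearMap.toMatrix'.injective (congrFun h3 i)
    subst this
    rfl
  · rintro ⟨x, f, hf⟩
    refine ⟨⟨⟨fun i => Matrix.toLin' (f.1 i), fun i => ?_⟩, ⟨x, fun a => ?_⟩⟩, ?_⟩
    · exact ((isNilpotent_iff_apply f).1 hf i).map (Matrix.toLinAlgEquiv' (R := K) (n := Fin (α i)))
    · rw [← Matrix.toLin'_mul, ← Matrix.toLin'_mul, f.2 a]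
    · refine congrArg (Sigma.mk x) (Subtype.ext (hom_ext fun i => ?_))
      exact LinearMap.toMatrix'_toLin' _

instance glAction (α : I → ℕ) : MulAction (∀ i, GL (Fin (α i)) K) (Rep src tgt K α) where
  smul g x := glAct src tgt g x
  one_smul x := by
    change glAct src tgt 1 x = x
    funext a
    simp [glAct]
  mul_smul g h x := by
    change glAct src tgt (g * h) x = glAct src tgt g (glAct src tgt h x)
    funext a
    simp [glAct, Matrix.mul_assoc]

theorem card_orbit_mul [Fintype I] [Fintype Ω] [Finite K] {α : I → ℕ} (x : Rep src tgt K α) :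
    (Nat.card {y : Rep src tgt K α // ∃ g : ∀ i, GL (Fin (α i)) K, glAct src tgt g x = y} : ℚ) *
      (Nat.card {f : End (⟨α, x⟩ : RepObj src tgt K) // IsUnit f} : ℚ) =
      ∏ i, surjNum (α i) (α i) (Nat.card K) := by
  have h := Nat.card_congr (MulAction.orbitProdStabilizerEquivGroup (∀ i, GL (Fin (α i)) K) x)
  rw [Nat.card_prod, Nat.card_pi] at h
  have h1 : Nat.card (MulAction.stabilizer (∀ i, GL (Fin (α i)) K) x) =
      Nat.card {f : End (⟨α, x⟩ : RepObj src tgt K) // IsUnit f} := by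
    have key : ∀ g : ∀ i, GL (Fin (α i)) K, glAct src tgt g x = x ↔
        ∀ a, x a * (g (src a)).1 = (g (tgt a)).1 * x a := by
      intro g
      refine funext_iff.trans (forall_congr' fun a => ?_)
      change (g (tgt a)).1 * x a * ((g (src a))⁻¹).1 = x a ↔ _
      constructor
      · intro h
        conv_lhs => rw [← h]
        rw [Matrix.mul_assoc, Units.inv_mul, Matrix.mul_one]
      · intro h
        rw [← h, Matrix.mul_assoc, Units.mul_inv, Matrix.mul_one]
    refine Nat.card_congr (Equiv.ofBijective (fun g => ⟨⟨fun i => (g.1 i).1, (key g.1).1 g.2⟩,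
      (isUnit_iff_apply _).2 fun i => (g.1 i).isUnit⟩) ⟨?_, ?_⟩)
    · intro g h hgh
      apply Subtype.ext
      funext i
      apply Units.ext
      exact congrFun (congrArg (fun f => f.1.1) hgh) i
    · rintro ⟨f, hf⟩
      choose u hu using (isUnit_iff_apply f).1 hf
      refine ⟨⟨u, (key u).2 fun a => ?_⟩, Subtype.ext (hom_ext fun i => hu i)⟩
      rw [hu, hu]
      exact f.2 a
  rw [h1] at h
  have h2 : Nat.card {y : Rep src tgt K α // ∃ g : ∀ i, GL (Fin (α i)) K, glAct src tgt g x = y}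
    = Nat.card (MulAction.orbit (∀ i, GL (Fin (α i)) K) x) := rfl
  rw [h2, ← Nat.cast_mul, h, Nat.cast_prod]
  refine Finset.prod_congr rfl fun i _ => ?_
  have := Fintype.ofFinite K
  rw [Matrix.card_GL_field, surjNum, Finset.prod_range, Nat.cast_prod]
  refine Finset.prod_congr rfl fun j _ => ?_
  rw [Nat.cast_sub]
  · rw [Nat.card_eq_fintype_card]; push_cast; rfl
  · exact Nat.pow_le_pow_right Fintype.card_pos j.2.le

theorem nilSum_eq_mul_sum [Fintype I] [Fintype Ω] [Finite K] {α : I → ℕ} {T : Type} [Fintype T]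
    (c : Rep src tgt K α → T) (hc : Function.Surjective c)
    (hiso : ∀ x y, c x = c y ↔ Nonempty ((⟨α, x⟩ : RepObj src tgt K) ≅ ⟨α, y⟩)) (F : T → ℚ)
    (hF : ∀ x, (Nat.card {f : End (⟨α, x⟩ : RepObj src tgt K) // IsNilpotent f} : ℚ) *
      (Nat.card {f : End (⟨α, x⟩ : RepObj src tgt K) // IsUnit f} : ℚ)⁻¹ = F (c x)) :
    nilSum src tgt K α = (∏ i, surjNum (α i) (α i) (Nat.card K)) * ∑ t, F t := by
  have := Fintype.ofFinite (Rep src tgt K α)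
  have hne : ∀ t, (Nat.card {y : Rep src tgt K α // c y = t} : ℚ) ≠ 0 := fun t => by
    obtain ⟨x, hx⟩ := hc t
    have : Nonempty {y : Rep src tgt K α // c y = t} := ⟨⟨x, hx⟩⟩
    exact Nat.cast_ne_zero.2 Nat.card_pos.ne'
  have horb : ∀ x, (Nat.card {y : Rep src tgt K α // c y = c x} : ℚ) *
      (Nat.card {f : End (⟨α, x⟩ : RepObj src tgt K) // IsUnit f} : ℚ) =
      ∏ i, surjNum (α i) (α i) (Nat.card K) := fun x => by
    rw [← card_orbit_mul x]
    congr 2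
    refine Nat.card_congr (Equiv.subtypeEquivRight fun y => ?_)
    rw [eq_comm, hiso, exists_glAct_iff]
  have hprod : (∏ i, surjNum (α i) (α i) (Nat.card K)) ≠ 0 :=
    Finset.prod_ne_zero_iff.2 fun i _ => surjNum_self_ne_zero _ (one_lt_natCard_rat K)
  rw [nilSum_eq_sum_card]
  have h1 : ∀ x : Rep src tgt K α,
      (Nat.card {f : End (⟨α, x⟩ : RepObj src tgt K) // IsNilpotent f} : ℚ) =
      (fun t => F t * ((∏ i, surjNum (α i) (α i) (Nat.card K)) *
        (Nat.card {y : Rep src tgt K α // c y = t} : ℚ)⁻¹)) (c x) := fun x => by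
    have h0 := horb x
    have hu : (Nat.card {f : End (⟨α, x⟩ : RepObj src tgt K) // IsUnit f} : ℚ) ≠ 0 := fun h => by
      rw [h, mul_zero] at h0
      exact hprod h0.symm
    simp only
    rw [← hF, ← h0]
    have := hne (c x)
    field_simp
  refine (Finset.sum_congr rfl fun x _ => h1 x).trans ?_
  rw [sum_comp_eq_sum_card_fiber c (fun t => F t * ((∏ i, surjNum (α i) (α i) (Nat.card K)) *
        (Nat.card {y : Rep src tgt K α // c y = t} : ℚ)⁻¹)), Finset.mul_sum]
  refine Finset.sum_congr rfl fun t _ => ?_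
  have := hne t
  field_simp

theorem orbitCount_eq_card {α : I → ℕ} {T : Type}
    (c : Rep src tgt K α → T) (hc : Function.Surjective c)
    (hiso : ∀ x y, c x = c y ↔ Nonempty ((⟨α, x⟩ : RepObj src tgt K) ≅ ⟨α, y⟩))
    (P : Rep src tgt K α → Prop) (Q : T → Prop) (hPQ : ∀ x, P x ↔ Q (c x)) :
    orbitCount src tgt α P = Nat.card {t // Q t} := by
  refine Nat.card_congr (Equiv.ofBijective (Quot.lift (fun x => ⟨c x.1, (hPQ x.1).1 x.2⟩) ?_)
    ⟨?_, ?_⟩)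
  · rintro x y h
    exact Subtype.ext ((hiso _ _).2 ((exists_glAct_iff _ _).1 h))
  · rintro ⟨x⟩ ⟨y⟩ h
    exact Quot.sound ((exists_glAct_iff _ _).2 ((hiso _ _).1 (congrArg Subtype.val h)))
  · rintro ⟨t, ht⟩
    obtain ⟨x, rfl⟩ := hc t
    exact ⟨Quot.mk _ ⟨x, (hPQ x).2 ht⟩, rfl⟩

end

end QRep

end

section
open CategoryTheory

namespace QRep

section
variable {C : Type} [Category.{0} C] [Preadditive C]
variable (K : Type) [Field K] [Linear K C]

theorem tdim_eq_of_equiv {J X J' X' : C} (τ : K → K) (hτ : Function.Bijective τ)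
    (j : (X ⟶ J) ≃+ (X' ⟶ J')) (hj : ∀ (c : K) f, j (c • f) = τ c • j f)
    (hr : ∀ f, f ∈ radT J X ↔ j f ∈ radT J' X') : tdim K J X = tdim K J' X' := by
  have h : (radT J X).toAddSubgroup.map (j : (X ⟶ J) →+ (X' ⟶ J')) =
      (radT J' X').toAddSubgroup := by
    ext f
    constructor
    · rintro ⟨g, hg, rfl⟩
      exact (hr g).1 hg
    · intro hf
      refine ⟨j.symm f, (hr _).2 ?_, j.apply_symm_apply f⟩
      rw [j.apply_symm_apply]
      exact hf
  let e : TT J X ≃+ TT J' X' := QuotientAddGroup.congr _ _ j h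
  refine congrArg Cardinal.toNat (rank_eq_of_equiv_equiv τ e hτ fun c x => ?_)
  obtain ⟨f, rfl⟩ := Submodule.Quotient.mk_surjective _ x
  change Submodule.Quotient.mk (j (c • f)) = _
  rw [hj]
  rfl

variable [∀ X Y : C, FiniteDimensional K (X ⟶ Y)]

theorem IndecObj.tdim_congr_left {J J' : C} (hJ : IndecObj J) (e : J ≅ J') (X : C) :
    tdim K J X = tdim K J' X := by
  have hJ' := hJ.of_iso e
  refine tdim_eq_of_equiv K id Function.bijective_id
    { toFun := fun f => f ≫ e.hom
      invFun := fun f => f ≫ e.inv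
      left_inv := fun f => by simp
      right_inv := fun f => by simp
      map_add' := fun f g => by simp [Preadditive.add_comp] } (fun c f => by simp) fun f => ?_
  have key : ∀ u : J ⟶ J, IsUnit (End.of u) ↔ IsUnit (End.of (e.inv ≫ u ≫ e.hom)) := by
    intro u
    rw [isUnit_iff_isIso, isUnit_iff_isIso]
    change IsIso u ↔ IsIso (e.inv ≫ u ≫ e.hom)
    rw [isIso_comp_left_iff, isIso_comp_right_iff]
  rw [hJ.mem_radT K, hJ'.mem_radT K]
  constructor
  · intro h g hg
    apply h (e.hom ≫ g)
    rw [key]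
    simpa using hg
  · intro h g hg
    apply h (e.inv ≫ g)
    rw [key] at hg
    simpa using hg

theorem IndecObj.tdim_eq_zero {J J' : C} (hJ : IndecObj J) (hJ' : IndecObj J')
    (h : IsEmpty (J ≅ J')) : tdim K J J' = 0 := by
  by_contra h0
  exact h.false (hJ.nonempty_iso_of_tdim_ne_zero K hJ' h0).some

theorem tdim_of_id_eq_zero (J : C) {X : C} (hX : 𝟙 X = 0) : tdim K J X = 0 := by
  have : Subsingleton (TT J X) := ⟨fun a b => by
    obtain ⟨f, rfl⟩ := Submodule.Quotient.mk_surjective _ a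
    obtain ⟨g, rfl⟩ := Submodule.Quotient.mk_surjective _ b
    rw [← Category.id_comp f, ← Category.id_comp g, hX, Limits.zero_comp, Limits.zero_comp]⟩
  exact Module.finrank_zero_of_subsingleton

section
variable [IsIdempotentComplete C]
include K

theorem indec_induction {P : C → Prop} (h0 : ∀ X, 𝟙 X = 0 → P X)
    (hs : ∀ X J Z, IsSum X J Z → IndecObj J → P Z → P X) (X : C) : P X := by
  induction hn : Module.finrank K (X ⟶ X) using Nat.strong_induction_on generalizing X with
  | _ n ih =>
  by_cases hX : 𝟙 X = 0
  · exact h0 X hX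
  · obtain ⟨J, i, p, hJ, hip⟩ := exists_indec_section K X hX
    obtain ⟨Z, hZ⟩ := isSum_of_section hip
    exact hs X J Z hZ hJ (ih _ (hn ▸ finrank_end_lt_of_isSum K hZ.symm hJ.1) Z rfl)

theorem tdim_self_dvd {J : C} (hJ : IndecObj J) (X : C) : tdim K J J ∣ tdim K J X := by
  refine indec_induction K (P := fun X => tdim K J J ∣ tdim K J X) (fun X hX => ?_)
    (fun X J' Z h hJ' hZ => ?_) X
  · rw [tdim_of_id_eq_zero K J hX]
    exact dvd_zero _
  · rw [tdim_isSum K J h]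
    refine dvd_add ?_ hZ
    by_cases he : Nonempty (J' ≅ J)
    · rw [tdim_congr K J he.some]
    · rw [hJ.tdim_eq_zero K hJ' ⟨fun e => he ⟨e.symm⟩⟩]
      exact dvd_zero _

end

end

section
variable {I Ω : Type} [Finite I] {src tgt : Ω → I} (K : Type) [Field K]

/-- The multiplicity of an indecomposable `J` in `X`. -/
noncomputable def mult (J X : RepObj src tgt K) : ℕ := tdim K J X / tdim K J J

variable {K}

theorem mult_mul {J : RepObj src tgt K} (hJ : IndecObj J) (X : RepObj src tgt K) :
    mult K J X * tdim K J J = tdim K J X := Nat.div_mul_cancel (tdim_self_dvd K hJ X)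

theorem mult_isSum {J : RepObj src tgt K} (hJ : IndecObj J) {X Y Z : RepObj src tgt K}
    (h : IsSum X Y Z) : mult K J X = mult K J Y + mult K J Z := by
  apply Nat.eq_of_mul_eq_mul_right (hJ.tdim_self_pos K)
  rw [add_mul, mult_mul hJ, mult_mul hJ, mult_mul hJ, tdim_isSum K J h]

theorem mult_of_iso {J J' : RepObj src tgt K} (hJ : IndecObj J) (e : J ≅ J') :
    mult K J J' = 1 := by
  rw [mult, ← tdim_congr K J e, Nat.div_self (hJ.tdim_self_pos K)]

theorem mult_of_isEmpty {J J' : RepObj src tgt K} (hJ : IndecObj J) (hJ' : IndecObj J')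
    (h : IsEmpty (J ≅ J')) : mult K J J' = 0 := by
  rw [mult, hJ.tdim_eq_zero K hJ' h, Nat.zero_div]

theorem mult_ne_zero_iff {J : RepObj src tgt K} (hJ : IndecObj J) {X : RepObj src tgt K} :
    mult K J X ≠ 0 ↔ tdim K J X ≠ 0 := by
  rw [← mult_mul hJ X]
  have := hJ.tdim_self_pos K
  simp
  omega

theorem mult_congr (J : RepObj src tgt K) {X Y : RepObj src tgt K} (e : X ≅ Y) :
    mult K J X = mult K J Y := by
  rw [mult, mult, tdim_congr K J e]

theorem mult_of_dim_zero (J : RepObj src tgt K) {X : RepObj src tgt K} (h : X.dim = 0) :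
    mult K J X = 0 := by
  rw [mult, tdim_of_id_eq_zero K J ((id_eq_zero_iff X).2 h), Nat.zero_div]

theorem dim_le_of_section {X Y : RepObj src tgt K} {i : X ⟶ Y} {p : Y ⟶ X} (h : i ≫ p = 𝟙 X) :
    X.dim ≤ Y.dim := by
  obtain ⟨Z, hZ⟩ := isSum_of_section h
  rw [dim_isSum hZ]
  exact le_self_add

theorem dim_le_of_tdim_ne_zero {J X : RepObj src tgt K} (hJ : IndecObj J)
    (h : tdim K J X ≠ 0) : J.dim ≤ X.dim := by
  obtain ⟨i, p, hip⟩ := exists_section_of_tdim_ne_zero K hJ h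
  exact dim_le_of_section hip

/-- Existence of direct sums with prescribed multiplicities. -/
theorem exists_direct_sum {ι : Type} [Fintype ι] (S : ι → RepObj src tgt K) (m : ι → ℕ) :
    ∃ X : RepObj src tgt K, X.dim = ∑ s, m s • (S s).dim ∧
      ∀ J, tdim K J X = ∑ s, m s * tdim K J (S s) := by
  classical
  induction hn : ∑ s, m s generalizing m with
  | zero =>
    have hm : ∀ s, m s = 0 := fun s => by
      simpa using (Finset.sum_eq_zero_iff.1 hn) s (Finset.mem_univ s)
    refine ⟨⟨0, fun a => 0⟩, by simp [hm], fun J => ?_⟩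
    rw [tdim_of_id_eq_zero K J ((id_eq_zero_iff _).2 rfl)]
    simp [hm]
  | succ n ih =>
    obtain ⟨s, hs⟩ : ∃ s, m s ≠ 0 := by
      by_contra hno
      push Not at hno
      simp [hno] at hn
    have hm : m = Function.update m s (m s - 1) + Pi.single s 1 := by
      funext t
      by_cases ht : t = s
      · subst ht
        simp
        omega
      · simp [ht]
    set m' := Function.update m s (m s - 1) with hm'
    obtain ⟨Z, hZ, hZ'⟩ := ih m' (by
      rw [hm] at hn
      simp only [Pi.add_apply, Finset.sum_add_distrib, Finset.sum_pi_single',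
        Finset.mem_univ, if_true] at hn
      simp at hn
      exact hn)
    have h := isSum_dsum (S s).rep Z.rep
    refine ⟨_, (dim_isSum h).trans ?_, fun J => (tdim_isSum K J h).trans ?_⟩
    · change (S s).dim + Z.dim = _
      rw [hZ, hm]
      simp only [Pi.add_apply, add_smul, Finset.sum_add_distrib]
      rw [add_comm]
      congr 1
      rw [Finset.sum_eq_single s (fun t _ ht => by simp [ht]) (by simp)]
      simp
    · change tdim K J (S s) + tdim K J Z = _
      rw [hZ', hm]
      simp only [Pi.add_apply, add_mul, Finset.sum_add_distrib]
      rw [add_comm]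
      congr 1
      rw [Finset.sum_eq_single s (fun t _ ht => by simp [ht]) (by simp)]
      simp

/-- A complete irredundant list of the indecomposables of dimension at most `α`. -/
structure IsIndecList (α : I → ℕ) {ι : Type} (S : ι → RepObj src tgt K) : Prop where
  indec : ∀ s, IndecObj (S s)
  ne : ∀ s t, s ≠ t → IsEmpty (S s ≅ S t)
  le : ∀ s, (S s).dim ≤ α
  cover : ∀ J, IndecObj J → J.dim ≤ α → ∃ s, Nonempty (J ≅ S s)

variable (src tgt K) in
theorem exists_isIndecList [Finite Ω] [Finite K] (α : I → ℕ) :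
    ∃ (ι : Type) (_ : Fintype ι) (S : ι → RepObj src tgt K), IsIndecList α S := by
  classical
  have := Fintype.ofFinite I
  let T := {X : Σ β : {β : I → ℕ // β ∈ Set.Iic α}, Rep src tgt K β.1 //
    IndecObj (⟨X.1.1, X.2⟩ : RepObj src tgt K)}
  have hT : Finite T := by
    have : Finite {β : I → ℕ // β ∈ Set.Iic α} := (Set.finite_Iic α).to_subtype
    exact inferInstance
  let o : T → RepObj src tgt K := fun X => ⟨X.1.1.1, X.1.2⟩
  let r : Setoid T := ⟨fun X Y => Nonempty (o X ≅ o Y), fun X => ⟨Iso.refl _⟩,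
    fun ⟨e⟩ => ⟨e.symm⟩, fun ⟨e⟩ ⟨f⟩ => ⟨e.trans f⟩⟩
  refine ⟨Quotient r, Fintype.ofFinite _, fun s => o s.out, fun s => s.out.2, fun s t h => ?_,
    fun s => s.out.1.1.2, fun J hJ hle => ?_⟩
  · refine ⟨fun e => h ?_⟩
    rw [← s.out_eq, ← t.out_eq]
    exact Quotient.sound (⟨e⟩ : Nonempty (o s.out ≅ o t.out))
  · let X : T := ⟨⟨⟨J.dim, hle⟩, J.rep⟩, hJ⟩
    exact ⟨Quotient.mk r X, Setoid.symm (Quotient.mk_out X : Nonempty (o _ ≅ o X))⟩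

namespace IsIndecList
variable {α : I → ℕ} {ι : Type} {S : ι → RepObj src tgt K} (h : IsIndecList α S)
include h

theorem mult_eq [DecidableEq ι] (s t : ι) : mult K (S s) (S t) = if s = t then 1 else 0 := by
  split_ifs with hst
  · subst hst
    exact mult_of_iso (h.indec s) (Iso.refl _)
  · exact mult_of_isEmpty (h.indec s) (h.indec t) (h.ne s t hst)

theorem dim_eq_sum [Fintype ι] (X : RepObj src tgt K) (hX : X.dim ≤ α) :
    X.dim = ∑ s, mult K (S s) X • (S s).dim := by
  classical
  revert hX
  refine indec_induction K (P := fun X : RepObj src tgt K => X.dim ≤ α →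
    X.dim = ∑ s, mult K (S s) X • (S s).dim) (fun X hX _ => ?_) (fun X J Z hs hJ hZ hX => ?_) X
  · rw [(id_eq_zero_iff X).1 hX]
    simp [mult_of_dim_zero _ ((id_eq_zero_iff X).1 hX)]
  · have hd := dim_isSum hs
    rw [hd] at hX
    obtain ⟨t, ⟨e⟩⟩ := h.cover J hJ (le_self_add.trans hX)
    rw [hd]
    simp only [mult_isSum (h.indec _) hs, add_smul, Finset.sum_add_distrib]
    rw [← hZ (le_add_self.trans hX)]
    congr 1
    rw [dim_eq_of_iso e, Finset.sum_eq_single t]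
    · rw [mult_congr _ e, h.mult_eq]
      simp
    · intro s _ hst
      rw [mult_congr _ e, h.mult_eq, if_neg hst, zero_smul]
    · simp

theorem nonempty_iso {X Y : RepObj src tgt K} (hX : X.dim ≤ α) (hY : Y.dim ≤ α)
    (hXY : ∀ s, mult K (S s) X = mult K (S s) Y) : Nonempty (X ≅ Y) := by
  refine nonempty_iso_of_tdim_eq K X Y fun J hJ => ?_
  by_cases hle : J.dim ≤ α
  · obtain ⟨s, ⟨e⟩⟩ := h.cover J hJ hle
    rw [hJ.tdim_congr_left K e, hJ.tdim_congr_left K e, ← mult_mul (h.indec s), hXY,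
      mult_mul (h.indec s)]
  · have h1 : ∀ X : RepObj src tgt K, X.dim ≤ α → tdim K J X = 0 := fun X hX => by
      by_contra h0
      exact hle ((dim_le_of_tdim_ne_zero hJ h0).trans hX)
    rw [h1 X hX, h1 Y hY]

theorem exists_mult_eq [Fintype ι] (m : ι → ℕ) : ∃ X : RepObj src tgt K,
    X.dim = ∑ s, m s • (S s).dim ∧ ∀ s, mult K (S s) X = m s := by
  classical
  obtain ⟨X, hX, hX'⟩ := exists_direct_sum S m
  refine ⟨X, hX, fun s => ?_⟩
  apply Nat.eq_of_mul_eq_mul_right ((h.indec s).tdim_self_pos K)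
  rw [mult_mul (h.indec s), hX', Finset.sum_eq_single s]
  · intro t _ hts
    rw [← mult_mul (h.indec s), h.mult_eq, if_neg (Ne.symm hts), zero_mul, mul_zero]
  · simp

end IsIndecList

end

end QRep

end

section
open CategoryTheory PowerSeries

namespace QRep

theorem finite_solutions {ι J : Type} (β : ι → J →₀ ℕ) (hβ : ∀ s, β s ≠ 0) (γ : J →₀ ℕ)
    [Fintype ι] : Finite {m : ι → ℕ // ∑ s, m s • β s = γ} := by
  classical
  choose j hj using fun s => DFunLike.ne_iff.1 (hβ s)
  refine Set.Finite.subset (Set.finite_Iic fun s => γ (j s)) fun m (hm : ∑ s, m s • β s = γ) s => ?_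
  have h : m s * β s (j s) ≤ γ (j s) := by
    rw [← hm, Finsupp.finsetSum_apply]
    exact Finset.single_le_sum (f := fun s' => (m s' • β s') (j s)) (fun _ _ => Nat.zero_le _)
      (Finset.mem_univ s)
  exact (Nat.le_mul_of_pos_right _ (Nat.pos_of_ne_zero (hj s))).trans h

theorem coeff_prod_phi {ι J : Type} [Fintype ι] (β : ι → J →₀ ℕ) (hβ : ∀ s, β s ≠ 0)
    (F : ι → PowerSeries ℚ) (γ : J →₀ ℕ) [Fintype {m : ι → ℕ // ∑ s, m s • β s = γ}] :
    MvPowerSeries.coeff γ (∏ s, phi (β s) (hβ s) (F s)) =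
      ∑ m : {m : ι → ℕ // ∑ s, m s • β s = γ}, ∏ s, coeff (m.1 s) (F s) := by
  classical
  rw [MvPowerSeries.coeff_prod]
  symm
  refine Finset.sum_of_injOn (fun m => Finsupp.equivFunOnFinite.symm fun s => m.1 s • β s)
    ?_ ?_ ?_ ?_
  · intro m _ m' _ h
    apply Subtype.ext
    funext s
    exact smul_left_inj_of_ne (β s) (hβ s) (DFunLike.congr_fun h s)
  · intro m _
    rw [Finset.mem_coe, Finset.mem_finsuppAntidiag]
    exact ⟨m.2, Finset.subset_univ _⟩
  · intro l hl hne
    by_contra h0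
    have h1 : ∀ s, ∃ n : ℕ, l s = n • β s := fun s => by
      by_contra hno
      push Not at hno
      exact h0 (Finset.prod_eq_zero (Finset.mem_univ s) (coeff_phi_of_ne _ _ _ _ hno))
    choose m hm using h1
    refine hne ⟨⟨m, ?_⟩, by simp, ?_⟩
    · rw [← (Finset.mem_finsuppAntidiag.1 hl).1]
      exact Finset.sum_congr rfl fun s _ => (hm s).symm
    · ext1 s
      exact (hm s).symm
  · intro m _
    exact Finset.prod_congr rfl fun s _ => (coeff_phi_smul (β s) (hβ s) _ _).symm

section
variable {I Ω : Type} [Fintype I] [Fintype Ω] {src tgt : Ω → I} {K : Type} [Field K]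

/-- A dimension vector as an exponent. -/
noncomputable def expo (β : I → ℕ) : I →₀ ℕ := Finsupp.equivFunOnFinite.symm β

theorem expo_apply (β : I → ℕ) (i : I) : expo β i = β i := rfl

theorem expo_injective : Function.Injective (expo : (I → ℕ) → I →₀ ℕ) :=
  Finsupp.equivFunOnFinite.symm.injective

theorem expo_smul (n : ℕ) (β : I → ℕ) : expo (n • β) = n • expo β := Finsupp.ext fun _ => rfl

theorem expo_ne_zero {β : I → ℕ} (h : β ≠ 0) : expo β ≠ 0 := fun h' =>
  h (funext fun i => DFunLike.congr_fun h' i)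

theorem sum_smul_expo {ι : Type} [Fintype ι] (m : ι → ℕ) (β : ι → I → ℕ) :
    ∑ s, m s • expo (β s) = expo (∑ s, m s • β s) := by
  ext i
  simp [expo_apply, Finsupp.finsetSum_apply]

omit [Fintype I] [Fintype Ω] in
theorem IndecObj.dim_ne_zero {J : RepObj src tgt K} (h : IndecObj J) : J.dim ≠ 0 :=
  fun h0 => h.1 ((id_eq_zero_iff J).2 h0)

namespace IsIndecList
variable {α : I → ℕ} {ι : Type} [Fintype ι] {S : ι → RepObj src tgt K} (h : IsIndecList α S)
include h

omit [Fintype ι] [Fintype Ω] in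
theorem dim_ne_zero (s : ι) : expo (S s).dim ≠ 0 := expo_ne_zero (h.indec s).dim_ne_zero

/-- The multiplicities of the indecomposables in a representation. -/
noncomputable def classify (x : Rep src tgt K α) :
    {m : ι → ℕ // ∑ s, m s • expo (S s).dim = expo α} :=
  ⟨fun s => mult K (S s) ⟨α, x⟩, by
    rw [sum_smul_expo]
    exact congrArg expo (h.dim_eq_sum ⟨α, x⟩ le_rfl).symm⟩

omit [Fintype Ω] in
theorem classify_surjective : Function.Surjective h.classify := by
  rintro ⟨m, hm⟩
  obtain ⟨⟨β, x⟩, hX, hX'⟩ := h.exists_mult_eq m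
  rw [sum_smul_expo] at hm
  have : β = α := hX.trans (expo_injective hm)
  subst this
  exact ⟨x, Subtype.ext (funext hX')⟩

omit [Fintype Ω] in
theorem classify_eq_iff (x y : Rep src tgt K α) :
    h.classify x = h.classify y ↔ Nonempty ((⟨α, x⟩ : RepObj src tgt K) ≅ ⟨α, y⟩) := by
  constructor
  · intro hxy
    exact h.nonempty_iso le_rfl le_rfl fun s => congrFun (congrArg Subtype.val hxy) s
  · rintro ⟨e⟩
    exact Subtype.ext (funext fun s => mult_congr _ e)

theorem nilSum_eq [Finite K] : nilSum src tgt K α = (∏ i, surjNum (α i) (α i) (Nat.card K)) *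
    MvPowerSeries.coeff (expo α) (∏ s, phi (expo (S s).dim) (h.dim_ne_zero s)
      (PowerSeries.mk fun n => nu n ((Nat.card K : ℚ) ^ tdim K (S s) (S s)))) := by
  have := finite_solutions (fun s => expo (S s).dim) h.dim_ne_zero (expo α)
  have := Fintype.ofFinite {m : ι → ℕ // ∑ s, m s • expo (S s).dim = expo α}
  rw [coeff_prod_phi]
  simp only [coeff_mk]
  refine nilSum_eq_mul_sum h.classify h.classify_surjective h.classify_eq_iff
    (fun m => ∏ s, nu (m.1 s) ((Nat.card K : ℚ) ^ tdim K (S s) (S s))) fun x => ?_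
  exact card_nilpotent_mul_card_isUnit_inv K h.indec h.ne fun J hJ hJx =>
    h.cover J hJ (dim_le_of_tdim_ne_zero hJ hJx)

open Classical in
theorem orbitCount_eq (P : Rep src tgt K α → Prop) (good : ι → Prop)
    (hP : ∀ x, P x ↔ ∀ s, mult K (S s) ⟨α, x⟩ ≠ 0 → good s) :
    (orbitCount src tgt α P : ℚ) =
    MvPowerSeries.coeff (expo α) (∏ s, phi (expo (S s).dim) (h.dim_ne_zero s)
      (if good s then PowerSeries.mk fun _ => 1 else 1)) := by
  have := finite_solutions (fun s => expo (S s).dim) h.dim_ne_zero (expo α)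
  have := Fintype.ofFinite {m : ι → ℕ // ∑ s, m s • expo (S s).dim = expo α}
  rw [coeff_prod_phi, orbitCount_eq_card h.classify h.classify_surjective h.classify_eq_iff P
    (fun m => ∀ s, m.1 s ≠ 0 → good s) hP, Nat.card_eq_fintype_card, Fintype.card_subtype,
    Finset.card_filter, Nat.cast_sum]
  refine Finset.sum_congr rfl fun m _ => ?_
  split_ifs with hm
  · rw [Nat.cast_one, Finset.prod_eq_one]
    intro s _
    split_ifs with hs
    · rw [coeff_mk]
    · rw [coeff_one, if_pos]
      by_contra h0
      exact hs (hm s h0)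
  · push Not at hm
    obtain ⟨s, hs, hs'⟩ := hm
    rw [Nat.cast_zero, eq_comm]
    refine Finset.prod_eq_zero (Finset.mem_univ s) ?_
    rw [if_neg hs', coeff_one, if_neg hs]

end IsIndecList

end

end QRep

end

section
open CategoryTheory

namespace QRep

section
variable {I Ω : Type} {src tgt : Ω → I} {K L : Type} [Field K] [Field L]

/-- Base change of objects. -/
def bc (f : K →+* L) (X : RepObj src tgt K) : RepObj src tgt L :=
  ⟨X.dim, baseChange src tgt f X.rep⟩

/-- Base change of morphisms. -/
def bcHom (f : K →+* L) {X Y : RepObj src tgt K} (φ : X ⟶ Y) : bc f X ⟶ bc f Y :=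
  ⟨fun i => (φ.1 i).map f, fun a => by
    change (Y.rep a).map f * (φ.1 (src a)).map f = (φ.1 (tgt a)).map f * (X.rep a).map f
    rw [← Matrix.map_mul, ← Matrix.map_mul, φ.2 a]⟩

variable (f : K →+* L) {X Y Z : RepObj src tgt K}

theorem bcHom_comp (φ : X ⟶ Y) (ψ : Y ⟶ Z) : bcHom f (φ ≫ ψ) = bcHom f φ ≫ bcHom f ψ :=
  hom_ext fun i => Matrix.map_mul

theorem bcHom_id : bcHom f (𝟙 X) = 𝟙 (bc f X) :=
  hom_ext fun i => Matrix.map_one f (map_zero f) (map_one f)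

theorem bcHom_zero : bcHom f (0 : X ⟶ Y) = 0 :=
  hom_ext fun i => Matrix.map_zero f (map_zero f)

theorem bcHom_add (φ ψ : X ⟶ Y) : bcHom f (φ + ψ) = bcHom f φ + bcHom f ψ :=
  hom_ext fun i => Matrix.map_add f (map_add f) _ _

theorem bcHom_smul (c : K) (φ : X ⟶ Y) : bcHom f (c • φ) = f c • bcHom f φ :=
  hom_ext fun i => Matrix.ext fun j k => map_mul f _ _

theorem bcHom_injective : Function.Injective (bcHom f : (X ⟶ Y) → (bc f X ⟶ bc f Y)) := by
  intro φ ψ h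
  refine hom_ext fun i => Matrix.ext fun j k => f.injective ?_
  exact congrFun (congrFun (congrFun (congrArg Subtype.val h) i) j) k

theorem bc_isSum (h : IsSum X Y Z) : IsSum (bc f X) (bc f Y) (bc f Z) := by
  obtain ⟨i, p, j, r, h1, h2, h3, h4, h5⟩ := h
  refine ⟨bcHom f i, bcHom f p, bcHom f j, bcHom f r, ?_, ?_, ?_, ?_, ?_⟩
  · rw [← bcHom_comp, h1, bcHom_id]
  · rw [← bcHom_comp, h2, bcHom_id]
  · rw [← bcHom_comp, h3, bcHom_zero]
  · rw [← bcHom_comp, h4, bcHom_zero]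
  · rw [← bcHom_comp, ← bcHom_comp, ← bcHom_add, h5, bcHom_id]

/-- Base change of isomorphisms. -/
def bcIso (e : X ≅ Y) : bc f X ≅ bc f Y where
  hom := bcHom f e.hom
  inv := bcHom f e.inv
  hom_inv_id := by rw [← bcHom_comp, e.hom_inv_id, bcHom_id]
  inv_hom_id := by rw [← bcHom_comp, e.inv_hom_id, bcHom_id]

end

section
variable {I Ω : Type} [Finite I] {src tgt : Ω → I} {K L : Type} [Field K] [Field L] [Algebra K L]
variable {X Y Z : RepObj src tgt K}

theorem mem_span_bcHom (h : bc (algebraMap K L) X ⟶ bc (algebraMap K L) Y) :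
    h ∈ Submodule.span L (Set.range (bcHom (algebraMap K L) : (X ⟶ Y) → _)) := by
  classical
  have := Fintype.ofFinite I
  let b := Module.Basis.ofVectorSpace K L
  let H : ∀ i, Matrix (Fin (Y.dim i)) (Fin (X.dim i)) L := h.1
  have hH : ∀ a, (Y.rep a).map (algebraMap K L) * H (src a) =
    H (tgt a) * (X.rep a).map (algebraMap K L) := h.2
  let c : ∀ _ : Module.Basis.ofVectorSpaceIndex K L, X ⟶ Y := fun s =>
    ⟨fun i => (H i).map fun x => b.repr x s, fun a => by
      ext j k
      have := congrArg (fun x => b.repr x s) (congrFun (congrFun (hH a) j) k)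
      simp only [Matrix.mul_apply, Matrix.map_apply, map_sum, ← Algebra.smul_def,
        Finsupp.finsetSum_apply, map_smul, Finsupp.smul_apply] at this
      simp only [mul_comm _ (algebraMap K L _), ← Algebra.smul_def, map_smul,
        Finsupp.smul_apply, smul_eq_mul] at this
      simp only [Matrix.mul_apply, Matrix.map_apply]
      rw [this]
      exact Finset.sum_congr rfl fun _ _ => mul_comm _ _⟩
  let T : Finset (Module.Basis.ofVectorSpaceIndex K L) :=
    Finset.univ.biUnion fun i : I => Finset.univ.biUnion fun j => Finset.univ.biUnion fun k =>
      (b.repr (H i j k)).support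
  have hT : ∀ i j k, (b.repr (H i j k)).support ⊆ T := fun i j k s hs =>
    Finset.mem_biUnion.2 ⟨i, Finset.mem_univ _, Finset.mem_biUnion.2 ⟨j, Finset.mem_univ _,
      Finset.mem_biUnion.2 ⟨k, Finset.mem_univ _, hs⟩⟩⟩
  have : h = ∑ s ∈ T, b s • bcHom (algebraMap K L) (c s) := by
    refine hom_ext fun i => Matrix.ext fun (j : Fin (Y.dim i)) (k : Fin (X.dim i)) => ?_
    let ev : (bc (algebraMap K L) X ⟶ bc (algebraMap K L) Y) →+ L :=
      { toFun := fun f => f.1 i j k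
        map_zero' := rfl
        map_add' := fun _ _ => rfl }
    change H i j k = ev _
    rw [map_sum]
    have h1 := b.linearCombination_repr (H i j k)
    rw [Finsupp.linearCombination_apply, Finsupp.sum_of_support_subset _ (hT i j k)
      (fun s a => a • b s) (fun s _ => zero_smul _ _)] at h1
    rw [← h1]
    refine Finset.sum_congr rfl fun s _ => ?_
    rw [Algebra.smul_def, mul_comm]
    rfl
  rw [this]
  exact Submodule.sum_mem _ fun s _ => Submodule.smul_mem _ _ (Submodule.subset_span ⟨c s, rfl⟩)

/-- The ideal of endomorphisms which come from the radical is nil. -/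
theorem isNilpotent_of_mem_span_jacobson {f : bc (algebraMap K L) X ⟶ bc (algebraMap K L) X}
    (hf : f ∈ Submodule.span L (bcHom (algebraMap K L) ''
      {g : X ⟶ X | End.of g ∈ Ring.jacobson (End X)})) : IsNilpotent (End.of f) := by
  have : IsArtinianRing (End X) := IsArtinianRing.of_finite K (End X)
  obtain ⟨n, hn⟩ : IsNilpotent (Ring.jacobson (End X)) := IsSemiprimaryRing.isNilpotent
  refine ⟨n, ?_⟩
  have key : ∀ m, (End.of f ^ m : End (bc (algebraMap K L) X)) ∈
      Submodule.span L ((fun g : End X => End.of (bcHom (algebraMap K L) g)) ''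
        ((Ring.jacobson (End X) ^ m : Ideal (End X)) : Set (End X))) := by
    intro m
    induction m with
    | zero =>
      rw [pow_zero, Submodule.pow_zero]
      exact Submodule.subset_span ⟨1, Submodule.one_le.1 le_rfl, bcHom_id _⟩
    | succ m ih =>
      rw [pow_succ, Submodule.pow_succ]
      generalize End.of f ^ m = g at ih
      induction ih using Submodule.span_induction with
      | mem x hx =>
        obtain ⟨x, hx, rfl⟩ := hx
        induction hf using Submodule.span_induction with
        | mem y hy =>
          obtain ⟨y, hy, rfl⟩ := hy
          exact Submodule.subset_span ⟨x * End.of y, Submodule.mul_mem_mul hx hy, bcHom_comp _ _ _⟩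
        | zero =>
          rw [show End.of (0 : bc (algebraMap K L) X ⟶ bc (algebraMap K L) X) = 0 from rfl,
            mul_zero]
          exact Submodule.zero_mem _
        | add y z _ _ hy hz =>
          rw [show End.of (y + z) = End.of y + End.of z from rfl, mul_add]
          exact Submodule.add_mem _ hy hz
        | smul c y _ hy =>
          rw [show End.of (c • y) = c • End.of y from rfl, mul_smul_comm]
          exact Submodule.smul_mem _ _ hy
      | zero => rw [zero_mul]; exact Submodule.zero_mem _
      | add y z _ _ hy hz => rw [add_mul]; exact Submodule.add_mem _ hy hz
      | smul c y _ hy => rw [smul_mul_assoc]; exact Submodule.smul_mem _ _ hy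
  have h2 := key n
  rw [hn] at h2
  have h3 : (fun g : End X => End.of (bcHom (algebraMap K L) g)) ''
      ((0 : Ideal (End X)) : Set (End X)) = {0} := by
    ext g
    constructor
    · rintro ⟨g', hg', rfl⟩
      have : g' = 0 := hg'
      subst this
      exact bcHom_zero _
    · rintro rfl
      exact ⟨0, rfl, bcHom_zero _⟩
  rw [h3, Submodule.mem_span_singleton] at h2
  obtain ⟨c, hc⟩ := h2
  rw [← hc, smul_zero]

end

end QRep

end

section
open CategoryTheory

namespace QRep

/-- The data expressing that a finite separable extension is a direct summand of the base change of
itself. -/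
theorem exists_separability_data (K F : Type) [Field K] [Field F] [Algebra K F]
    [FiniteDimensional K F] [Algebra.IsSeparable K F] :
    ∃ (m : ℕ) (M : F → Matrix (Fin m) (Fin m) K) (u v : Fin m → F),
      (∀ c s, ∑ t, u t * algebraMap K F (M c t s) = c * u s) ∧
      (∀ c t, ∑ s, algebraMap K F (M c t s) * v s = v t * c) ∧ ∑ s, u s * v s = 1 := by
  classical
  let b := Module.finBasis K F
  let B := Algebra.traceForm K F
  have hB : B.Nondegenerate := traceForm_nondegenerate K F
  let v := B.dualBasis hB b
  have hsep : ∀ x y : F, (∀ z, Algebra.trace K F (x * z) = Algebra.trace K F (y * z)) → x = y := by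
    intro x y h
    rw [← sub_eq_zero]
    refine hB.1 _ fun z => ?_
    change Algebra.trace K F ((x - y) * z) = 0
    rw [sub_mul, map_sub, h, sub_self]
  have hvb : ∀ i j, Algebra.trace K F (v i * b j) = if j = i then 1 else 0 := fun i j =>
    LinearMap.BilinForm.apply_dualBasis_left hB b i j
  have hM : ∀ c t s, Algebra.leftMulMatrix b c t s = Algebra.trace K F (v t * (c * b s)) := by
    intro c t s
    rw [Algebra.leftMulMatrix_eq_repr_mul]
    conv_rhs => rw [← b.sum_repr (c * b s), Finset.mul_sum, map_sum]
    simp only [mul_smul_comm, map_smul, hvb]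
    simp
  have hu : ∀ c s, ∑ t, b t * algebraMap K F (Algebra.leftMulMatrix b c t s) = c * b s := by
    intro c s
    conv_rhs => rw [← b.sum_repr (c * b s)]
    refine Finset.sum_congr rfl fun t _ => ?_
    rw [Algebra.leftMulMatrix_eq_repr_mul, Algebra.smul_def, mul_comm]
  have hbsep : ∀ x y : F, (∀ s, Algebra.trace K F (x * b s) = Algebra.trace K F (y * b s)) →
      x = y := by
    intro x y h
    refine hsep x y fun z => ?_
    rw [← b.sum_repr z]
    simp only [Finset.mul_sum, map_sum, mul_smul_comm, map_smul, h]
  refine ⟨_, Algebra.leftMulMatrix b, b, v, hu, fun c t => ?_, ?_⟩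
  · refine hbsep _ _ fun s => ?_
    rw [mul_assoc, ← hM, Finset.sum_mul, map_sum]
    have h1 : ∀ x, Algebra.trace K F (algebraMap K F (Algebra.leftMulMatrix b c t x) * v x * b s) =
        if s = x then Algebra.leftMulMatrix b c t x else 0 := by
      intro x
      rw [mul_assoc, ← Algebra.smul_def, map_smul, hvb, smul_eq_mul, mul_ite, mul_one, mul_zero]
    exact (Finset.sum_congr rfl fun x _ => h1 x).trans (by simp)
  · refine hsep _ _ fun z => ?_
    rw [one_mul, Algebra.trace_eq_matrix_trace b z, Matrix.trace, Finset.sum_mul]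
    refine (map_sum (Algebra.trace K F) _ _).trans ?_
    refine Finset.sum_congr rfl fun s _ => ?_
    rw [Matrix.diag_apply, hM]
    congr 1
    ring

/-- Restriction of scalars along a finite separable extension, on the level of matrices. -/
theorem exists_restriction (K F : Type) [Field K] [Field F] [Algebra K F]
    [FiniteDimensional K F] [Algebra.IsSeparable K F] :
    ∃ (m : ℕ) (B : ∀ a b : ℕ, Matrix (Fin a) (Fin b) F → Matrix (Fin (a * m)) (Fin (b * m)) K)
      (P : ∀ n, Matrix (Fin n) (Fin (n * m)) F) (Q : ∀ n, Matrix (Fin (n * m)) (Fin n) F),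
      (∀ a b A, A * P b = P a * (B a b A).map (algebraMap K F)) ∧
      (∀ a b A, (B a b A).map (algebraMap K F) * Q b = Q a * A) ∧ ∀ n, P n * Q n = 1 := by
  classical
  obtain ⟨m, M, u, v, hu, hv, huv⟩ := exists_separability_data K F
  let B : ∀ a b : ℕ, Matrix (Fin a) (Fin b) F → Matrix (Fin a × Fin m) (Fin b × Fin m) K :=
    fun a b A => Matrix.of fun r s => M (A r.1 s.1) r.2 s.2
  let P : ∀ n, Matrix (Fin n) (Fin n × Fin m) F := fun n => Matrix.of fun j s =>
    if j = s.1 then u s.2 else 0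
  let Q : ∀ n, Matrix (Fin n × Fin m) (Fin n) F := fun n => Matrix.of fun s j =>
    if s.1 = j then v s.2 else 0
  have hP : ∀ a b A, A * P b = P a * (B a b A).map (algebraMap K F) := by
    intro a b A
    ext j s
    simp only [Matrix.mul_apply, Fintype.sum_prod_type, Matrix.map_apply, P, B, Matrix.of_apply]
    simp only [mul_ite, ite_mul, mul_zero, zero_mul, Finset.sum_ite_eq', Finset.mem_univ, if_true]
    rw [Finset.sum_comm]
    simp only [Finset.sum_ite_eq, Finset.mem_univ, if_true]
    exact (hu _ _).symm
  have hQ : ∀ a b A, (B a b A).map (algebraMap K F) * Q b = Q a * A := by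
    intro a b A
    ext s k
    simp only [Matrix.mul_apply, Fintype.sum_prod_type, Matrix.map_apply, Q, B, Matrix.of_apply]
    simp only [mul_ite, ite_mul, mul_zero, zero_mul, Finset.sum_ite_eq, Finset.mem_univ, if_true]
    rw [Finset.sum_comm]
    simp only [Finset.sum_ite_eq', Finset.mem_univ, if_true]
    exact hv _ _
  have hPQ : ∀ n, P n * Q n = 1 := by
    intro n
    ext j k
    simp only [Matrix.mul_apply, Fintype.sum_prod_type, P, Q, Matrix.of_apply]
    simp only [mul_ite, ite_mul, mul_zero, zero_mul]
    rw [Finset.sum_comm]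
    simp only [Finset.sum_ite_eq', Finset.mem_univ, if_true, Matrix.one_apply]
    split_ifs
    · exact huv
    · exact Finset.sum_const_zero
  refine ⟨m, fun a b A => (B a b A).submatrix finProdFinEquiv.symm finProdFinEquiv.symm,
    fun n => (P n).submatrix id finProdFinEquiv.symm,
    fun n => (Q n).submatrix finProdFinEquiv.symm id, fun a b A => ?_, fun a b A => ?_,
    fun n => ?_⟩
  · rw [← Matrix.submatrix_map, Matrix.submatrix_mul_equiv, ← hP]
    rfl
  · rw [← Matrix.submatrix_map, Matrix.submatrix_mul_equiv, hQ]
    rfl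
  · rw [Matrix.submatrix_mul_equiv, hPQ]
    rfl

section
variable {I Ω : Type} [Finite I] [Finite Ω] {src tgt : Ω → I} {K L : Type} [Field K] [Field L]
  [Algebra K L] [Finite K] [Algebra.IsAlgebraic K L]

omit [Finite I] in
/-- Every representation over an algebraic extension is a direct summand of one which is defined
over the base field. -/
theorem exists_section_bc (y : RepObj src tgt L) :
    ∃ (X : RepObj src tgt K) (i : y ⟶ bc (algebraMap K L) X) (p : bc (algebraMap K L) X ⟶ y),
      i ≫ p = 𝟙 y := by
  classical
  let T : Set L := ⋃ a, Set.range fun x : Fin (y.dim (tgt a)) × Fin (y.dim (src a)) =>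
    y.rep a x.1 x.2
  have hT : T.Finite := Set.finite_iUnion fun a => Set.finite_range _
  have := hT.to_subtype
  let F := IntermediateField.adjoin K T
  have : FiniteDimensional K F := IntermediateField.finiteDimensional_adjoin
    fun x _ => (Algebra.IsAlgebraic.isAlgebraic x).isIntegral
  obtain ⟨m, B, P, Q, hP, hQ, hPQ⟩ := exists_restriction K F
  let y0 : ∀ a, Matrix (Fin (y.dim (tgt a))) (Fin (y.dim (src a))) F := fun a =>
    Matrix.of fun j k => ⟨y.rep a j k, IntermediateField.subset_adjoin _ _
      (Set.mem_iUnion.2 ⟨a, ⟨(j, k), rfl⟩⟩)⟩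
  have hy0 : ∀ a, (y0 a).map (algebraMap F L) = y.rep a := fun a => rfl
  have hB : ∀ a, ((B _ _ (y0 a)).map (algebraMap K F)).map (algebraMap F L) =
    (B _ _ (y0 a)).map (algebraMap K L) := fun a => rfl
  refine ⟨⟨fun i => y.dim i * m, fun a => B _ _ (y0 a)⟩,
    ⟨fun i => (Q (y.dim i)).map (algebraMap F L), fun a => ?_⟩,
    ⟨fun i => (P (y.dim i)).map (algebraMap F L), fun a => ?_⟩, hom_ext fun i => ?_⟩
  · have := congrArg (fun A => A.map (algebraMap F L)) (hQ _ _ (y0 a))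
    simp only [Matrix.map_mul, hB, hy0] at this
    exact this
  · have := congrArg (fun A => A.map (algebraMap F L)) (hP _ _ (y0 a))
    simp only [Matrix.map_mul, hB, hy0] at this
    exact this
  · have := congrArg (fun A => A.map (algebraMap F L)) (hPQ (y.dim i))
    simp only [Matrix.map_mul, Matrix.map_one _ (map_zero (algebraMap F L)) (map_one _)] at this
    exact this

end

end QRep

end

section
open CategoryTheory

namespace QRep

section
variable {I Ω : Type} [Finite I] {src tgt : Ω → I} {K L : Type} [Field K] [Field L] [Algebra K L]
variable {X Y Z : RepObj src tgt K}

omit [Finite I] in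
theorem comp_mem_span_bcHom {S : Set (X ⟶ Y)} {T : Set (Y ⟶ Z)} {U : Set (X ⟶ Z)}
    (h : ∀ φ ∈ S, ∀ ψ ∈ T, φ ≫ ψ ∈ U) {u : bc (algebraMap K L) X ⟶ bc (algebraMap K L) Y}
    {v : bc (algebraMap K L) Y ⟶ bc (algebraMap K L) Z}
    (hu : u ∈ Submodule.span L (bcHom (algebraMap K L) '' S))
    (hv : v ∈ Submodule.span L (bcHom (algebraMap K L) '' T)) :
    u ≫ v ∈ Submodule.span L (bcHom (algebraMap K L) '' U) := by
  induction hu using Submodule.span_induction with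
  | mem x hx =>
    obtain ⟨x, hx, rfl⟩ := hx
    induction hv using Submodule.span_induction with
    | mem y hy =>
      obtain ⟨y, hy, rfl⟩ := hy
      exact Submodule.subset_span ⟨x ≫ y, h x hx y hy, bcHom_comp _ _ _⟩
    | zero => rw [Limits.comp_zero]; exact Submodule.zero_mem _
    | add y z _ _ hy hz => rw [Preadditive.comp_add]; exact Submodule.add_mem _ hy hz
    | smul c y _ hy => rw [Linear.comp_smul]; exact Submodule.smul_mem _ _ hy
  | zero => rw [Limits.zero_comp]; exact Submodule.zero_mem _
  | add y z _ _ hy hz => rw [Preadditive.add_comp]; exact Submodule.add_mem _ hy hz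
  | smul c y _ hy => rw [Linear.smul_comp]; exact Submodule.smul_mem _ _ hy

theorem eq_zero_of_mem_span_jacobson {e : bc (algebraMap K L) X ⟶ bc (algebraMap K L) X}
    (he : e ∈ Submodule.span L (bcHom (algebraMap K L) ''
      {g : X ⟶ X | End.of g ∈ Ring.jacobson (End X)})) (hee : e ≫ e = e) : e = 0 := by
  obtain ⟨n, hn⟩ := isNilpotent_of_mem_span_jacobson he
  have h1 : IsIdempotentElem (End.of e) := hee
  have := h1.pow_succ_eq n
  rw [pow_succ, hn, zero_mul] at this
  exact this.symm

/-- Base changes of different indecomposable objects have no common direct summand. -/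
theorem IndecObj.nonempty_iso_of_bc_sections (hX : IndecObj X) (hY : IndecObj Y)
    {z : RepObj src tgt L} (hz : 𝟙 z ≠ 0)
    {p : z ⟶ bc (algebraMap K L) X} {h : bc (algebraMap K L) X ⟶ z} (hp : p ≫ h = 𝟙 z)
    {p' : z ⟶ bc (algebraMap K L) Y} {h' : bc (algebraMap K L) Y ⟶ z} (hp' : p' ≫ h' = 𝟙 z) :
    Nonempty (X ≅ Y) := by
  by_contra hno
  have := hX.nontrivial
  have hJ : ∀ φ ∈ (Set.univ : Set (X ⟶ Y)), ∀ ψ ∈ (Set.univ : Set (Y ⟶ X)),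
      φ ≫ ψ ∈ {g : X ⟶ X | End.of g ∈ Ring.jacobson (End X)} := by
    intro φ _ ψ _
    refine (mem_jacobson_iff_not_isUnit (hX.nilp_or_unit K)).2 fun hu => hno ?_
    have := (isUnit_iff_isIso (End.of (φ ≫ ψ))).1 hu
    exact hX.nonempty_iso_of_section hY (i := φ) (p := ψ ≫ inv (End.of (φ ≫ ψ)))
      ((Category.assoc _ _ _).symm.trans (IsIso.hom_inv_id (End.of (φ ≫ ψ))))
  have hu : h ≫ p' ∈ Submodule.span L (bcHom (algebraMap K L) '' (Set.univ : Set (X ⟶ Y))) := by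
    rw [Set.image_univ]
    exact mem_span_bcHom _
  have hv : h' ≫ p ∈ Submodule.span L (bcHom (algebraMap K L) '' (Set.univ : Set (Y ⟶ X))) := by
    rw [Set.image_univ]
    exact mem_span_bcHom _
  have huv : (h ≫ p') ≫ (h' ≫ p) = h ≫ p := by simp [reassoc_of% hp']
  have h0 := eq_zero_of_mem_span_jacobson (comp_mem_span_bcHom hJ hu hv)
    (by rw [huv]; simp [reassoc_of% hp])
  apply hz
  have : p ≫ (h ≫ p) ≫ h = 𝟙 z := by simp [hp]
  rw [← this, ← huv, h0]
  simp

/-- `χ` is the character by which `End X` acts on the multiplicity space of `z` in the base change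
of `X`. -/
def IsChar (f : K →+* L) (X : RepObj src tgt K) (z : RepObj src tgt L) (χ : End X → L) : Prop :=
  ∀ (φ : End X) (h : bc f X ⟶ z), bcHom f φ ≫ h - χ φ • h ∈ radT z (bc f X)

theorem tmap_bcHom_eq_zero {z : RepObj src tgt L} (hz : IndecObj z) {φ : X ⟶ X}
    (hφ : End.of φ ∈ Ring.jacobson (End X)) : tmap z (bcHom (algebraMap K L) φ) = 0 := by
  refine LinearMap.ext fun v => ?_
  obtain ⟨h, rfl⟩ := Submodule.Quotient.mk_surjective _ v
  rw [tmap_mk]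
  refine (Submodule.Quotient.mk_eq_zero _).2 ((hz.mem_radT L).2 fun p hu => hz.1 ?_)
  have := (isUnit_iff_isIso (End.of (p ≫ bcHom (algebraMap K L) φ ≫ h))).1 hu
  obtain ⟨h', hh'⟩ : ∃ h' : bc (algebraMap K L) X ⟶ z,
      p ≫ bcHom (algebraMap K L) φ ≫ h' = 𝟙 z :=
    ⟨h ≫ inv (End.of (p ≫ bcHom (algebraMap K L) φ ≫ h)), by
      have h1 := IsIso.hom_inv_id (End.of (p ≫ bcHom (algebraMap K L) φ ≫ h))
      refine Eq.trans ?_ h1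
      change _ = (p ≫ bcHom (algebraMap K L) φ ≫ h) ≫ _
      simp only [Category.assoc]⟩
  have hv : h' ≫ p ∈ Submodule.span L (bcHom (algebraMap K L) '' (Set.univ : Set (X ⟶ X))) := by
    rw [Set.image_univ]
    exact mem_span_bcHom _
  have h0 := eq_zero_of_mem_span_jacobson (comp_mem_span_bcHom (S := {φ})
    (U := {g : X ⟶ X | End.of g ∈ Ring.jacobson (End X)})
    (fun a ha ψ _ => by
      rw [Set.mem_singleton_iff.1 ha]
      exact Ideal.mul_mem_left _ (End.of ψ) hφ)
    (Submodule.subset_span ⟨φ, rfl, rfl⟩) hv) (by simp [reassoc_of% hh'])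
  have h2 : p ≫ (bcHom (algebraMap K L) φ ≫ h' ≫ p) ≫ bcHom (algebraMap K L) φ ≫ h' = 𝟙 z := by
    simp [hh']
  rw [← h2, h0]
  simp

omit [Finite I] in
theorem tmap_smul_hom {z w w' : RepObj src tgt L} (c : L) (g : w ⟶ w') (v : TT z w') :
    tmap z (c • g) v = c • tmap z g v := by
  obtain ⟨h, rfl⟩ := Submodule.Quotient.mk_surjective _ v
  rw [tmap_mk, tmap_mk, Linear.smul_comp]
  rfl

theorem IndecObj.exists_isChar [Finite K] [IsAlgClosed L] (hX : IndecObj X)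
    {z : RepObj src tgt L} (hz : IndecObj z) (hzX : tdim L z (bc (algebraMap K L) X) ≠ 0) :
    tdim L z (bc (algebraMap K L) X) = 1 ∧
      ∃ χ : End X →ₐ[K] L, IsChar (algebraMap K L) X z χ := by
  let V := TT z (bc (algebraMap K L) X)
  have : Nontrivial V := by
    by_contra hV
    rw [not_nontrivial_iff_subsingleton] at hV
    exact hzX Module.finrank_zero_of_subsingleton
  let T : (bc (algebraMap K L) X ⟶ bc (algebraMap K L) X) → Module.End L V :=
    fun g => (tmap z g).restrictScalars L
  have hTcomp : ∀ g g', T (g ≫ g') = T g * T g' := fun g g' => by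
    change (tmap z (g ≫ g')).restrictScalars L = _
    rw [tmap_comp]
    rfl
  have hTadd : ∀ g g', T (g + g') = T g + T g' := fun g g' => by
    change (tmap z (g + g')).restrictScalars L = _
    rw [tmap_add]
    rfl
  have hTsmul : ∀ (c : L) g, T (c • g) = c • T g := fun c g =>
    LinearMap.ext fun v => tmap_smul_hom c g v
  have hTid : T (𝟙 _) = 1 := by
    change (tmap z (𝟙 _)).restrictScalars L = _
    rw [tmap_id]
    rfl
  obtain ⟨k, _, _, ρ, -, hρ, -⟩ := hX.exists_residue (K := K)
  have hcomm : ∀ φ ψ : X ⟶ X, Commute (T (bcHom (algebraMap K L) φ))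
      (T (bcHom (algebraMap K L) ψ)) := by
    intro φ ψ
    have h1 : End.of (φ ≫ ψ - ψ ≫ φ) ∈ Ring.jacobson (End X) := by
      rw [← hρ]
      change ρ (End.of ψ * End.of φ - End.of φ * End.of ψ) = 0
      rw [map_sub, map_mul, map_mul, mul_comm, sub_self]
    have h2 : T (bcHom (algebraMap K L) (φ ≫ ψ - ψ ≫ φ)) = 0 := by
      change (tmap z _).restrictScalars L = _
      rw [tmap_bcHom_eq_zero hz h1]
      rfl
    have h3 : T (bcHom (algebraMap K L) (φ ≫ ψ)) = T (bcHom (algebraMap K L) (ψ ≫ φ)) := by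
      rw [← sub_add_cancel (φ ≫ ψ) (ψ ≫ φ), bcHom_add, hTadd, h2, zero_add]
    rw [bcHom_comp, bcHom_comp, hTcomp, hTcomp] at h3
    exact h3
  have hcomm' : ∀ (φ : X ⟶ X) g, Commute (T (bcHom (algebraMap K L) φ)) (T g) := by
    intro φ g
    have hg := mem_span_bcHom g
    induction hg using Submodule.span_induction with
    | mem g hg =>
      obtain ⟨ψ, rfl⟩ := hg
      exact hcomm φ ψ
    | zero =>
      have := hTsmul 0 0
      rw [zero_smul, zero_smul] at this
      rw [this]
      exact Commute.zero_right _
    | add g g' _ _ h h' => rw [hTadd]; exact h.add_right h'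
    | smul c g _ h => rw [hTsmul]; exact h.smul_right c
  have htrans : ∀ u w : V, u ≠ 0 → ∃ g, T g u = w := by
    intro u w hu
    obtain ⟨h, rfl⟩ := Submodule.Quotient.mk_surjective _ u
    obtain ⟨h', rfl⟩ := Submodule.Quotient.mk_surjective _ w
    rw [Ne, Submodule.Quotient.mk_eq_zero, hz.mem_radT L] at hu
    push Not at hu
    obtain ⟨p, hp⟩ := hu
    have := (isUnit_iff_isIso (End.of (p ≫ h))).1 hp
    have h2 : inv (End.of (p ≫ h)) ≫ (p ≫ h) = 𝟙 z := IsIso.inv_hom_id (End.of (p ≫ h))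
    refine ⟨h' ≫ inv (End.of (p ≫ h)) ≫ p, ?_⟩
    change tmap z _ (Submodule.Quotient.mk h) = _
    rw [tmap_mk]
    congr 1
    rw [Category.assoc, Category.assoc, h2, Category.comp_id]
  have hscalar : ∀ φ : X ⟶ X, ∃ c : L, T (bcHom (algebraMap K L) φ) = c • 1 := by
    intro φ
    obtain ⟨c, hc⟩ := Module.End.exists_eigenvalue (T (bcHom (algebraMap K L) φ))
    obtain ⟨u, hu⟩ := hc.exists_hasEigenvector
    refine ⟨c, LinearMap.ext fun w => ?_⟩
    obtain ⟨g, rfl⟩ := htrans u w hu.2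
    have h1 := LinearMap.congr_fun (hcomm' φ g).eq u
    simp only [Module.End.mul_apply, hu.apply_eq_smul, map_smul] at h1
    exact h1
  have hscalar' : ∀ g, ∃ c : L, T g = c • 1 := by
    intro g
    have hg := mem_span_bcHom g
    induction hg using Submodule.span_induction with
    | mem g hg =>
      obtain ⟨ψ, rfl⟩ := hg
      exact hscalar ψ
    | zero =>
      have := hTsmul 0 0
      rw [zero_smul, zero_smul] at this
      exact ⟨0, by rw [this, zero_smul]⟩
    | add g g' _ _ h h' =>
      obtain ⟨c, hc⟩ := h
      obtain ⟨c', hc'⟩ := h'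
      exact ⟨c + c', by rw [hTadd, hc, hc', add_smul]⟩
    | smul c g _ h =>
      obtain ⟨c', hc'⟩ := h
      exact ⟨c * c', by rw [hTsmul, hc', mul_smul]⟩
  obtain ⟨v, hv⟩ := exists_ne (0 : V)
  have hinj : ∀ {a b : L}, a • (1 : Module.End L V) = b • 1 → a = b := fun {a b} hab =>
    smul_left_injective L hv (LinearMap.congr_fun hab v)
  constructor
  · refine finrank_eq_one v hv fun w => ?_
    obtain ⟨g, rfl⟩ := htrans v w hv
    obtain ⟨c, hc⟩ := hscalar' g
    exact ⟨c, by rw [hc]; rfl⟩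
  · choose χ hχ using hscalar
    let χ' : End X →ₐ[K] L :=
      { toFun := fun φ => χ φ
        map_one' := hinj (by
          rw [← hχ, one_smul]
          change T (bcHom _ (𝟙 X)) = 1
          rw [bcHom_id, hTid])
        map_mul' := fun φ ψ => hinj (by
          rw [← hχ]
          change T (bcHom _ (ψ ≫ φ)) = _
          rw [bcHom_comp, hTcomp, hχ, hχ, smul_mul_smul_comm, mul_one, mul_comm])
        map_zero' := hinj (by
          rw [← hχ, zero_smul]
          change T (bcHom _ (0 : X ⟶ X)) = 0
          rw [bcHom_zero]
          have := hTsmul 0 0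
          rwa [zero_smul, zero_smul] at this)
        map_add' := fun φ ψ => hinj (by
          rw [← hχ]
          change T (bcHom _ ((φ : X ⟶ X) + ψ)) = _
          rw [bcHom_add, hTadd, hχ, hχ, add_smul])
        commutes' := fun c => hinj (by
          rw [← hχ, Algebra.algebraMap_eq_smul_one]
          change T (bcHom _ (c • 𝟙 X)) = _
          rw [bcHom_smul, bcHom_id, hTsmul, hTid]) }
    refine ⟨χ', fun φ h => ?_⟩
    have h1 := LinearMap.congr_fun (hχ φ) (Submodule.Quotient.mk h)
    exact (Submodule.Quotient.eq _).1 h1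

end

end QRep

end

section
open CategoryTheory

namespace QRep

section
variable {K L : Type} [Field K] [Finite K] [Field L] [Algebra K L]

theorem pow_eq_pow_iff_modEq_finrank {k : Type} [Field k] [Finite k] [Algebra K k]
    (χ : k →ₐ[K] L) (i j : ℕ) :
    (∀ a, χ a ^ Nat.card K ^ i = χ a ^ Nat.card K ^ j) ↔ i ≡ j [MOD Module.finrank K k] := by
  have := Fintype.ofFinite K
  have : Module.Finite K k := Module.Finite.of_finite
  have hfin : IsOfFinOrder (FiniteField.frobeniusAlgHom K k) := by
    rw [← orderOf_pos_iff, FiniteField.orderOf_frobeniusAlgHom]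
    exact Module.finrank_pos
  rw [← FiniteField.orderOf_frobeniusAlgHom K k, ← hfin.pow_eq_pow_iff_modEq]
  constructor
  · intro h
    refine AlgHom.ext fun a => χ.injective ?_
    rw [AlgHom.coe_pow, AlgHom.coe_pow, FiniteField.coe_frobeniusAlgHom, pow_iterate, pow_iterate,
      ← Nat.card_eq_fintype_card, map_pow, map_pow]
    exact h a
  · intro h a
    have := congrArg (fun g => χ (g a)) h
    simpa only [AlgHom.coe_pow, FiniteField.coe_frobeniusAlgHom, pow_iterate,
      ← Nat.card_eq_fintype_card, map_pow] using this

theorem exists_forall_eq_pow_pow [IsAlgClosed L] {k : Type} [Field k] [Finite k] [Algebra K k]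
    (χ χ' : k →ₐ[K] L) : ∃ j < Module.finrank K k, ∀ a, χ' a = χ a ^ Nat.card K ^ j := by
  have := Fintype.ofFinite K
  have : Module.Finite K k := Module.Finite.of_finite
  let F : Fin (Module.finrank K k) → (k →ₐ[K] L) := fun j =>
    χ.comp (FiniteField.frobeniusAlgHom K k ^ (j : ℕ))
  have hF : ∀ j a, F j a = χ a ^ Nat.card K ^ (j : ℕ) := fun j a => by
    change χ ((FiniteField.frobeniusAlgHom K k ^ (j : ℕ)) a) = _
    rw [AlgHom.coe_pow, FiniteField.coe_frobeniusAlgHom, pow_iterate, map_pow,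
      ← Nat.card_eq_fintype_card]
  have hinj : Function.Injective F := fun i j hij => Fin.ext <| by
    have := (pow_eq_pow_iff_modEq_finrank χ i j).1 fun a => by rw [← hF, ← hF, hij]
    exact Nat.ModEq.eq_of_lt_of_lt this i.2 j.2
  have hbij : Function.Bijective F := (Fintype.bijective_iff_injective_and_card F).2
    ⟨hinj, by rw [Fintype.card_fin, AlgHom.card]⟩
  obtain ⟨j, hj⟩ := hbij.2 χ'
  exact ⟨j, j.2, fun a => by rw [← hF, hj]⟩

omit [Finite K] in
theorem exists_algHom_factor {R k : Type} [Ring R] [Algebra K R] [Field k] [Algebra K k]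
    (ρ : R →ₐ[K] k) (hρ : Function.Surjective ρ) (hker : ∀ a, ρ a = 0 → IsNilpotent a)
    (χ : R →ₐ[K] L) : ∃ χ' : k →ₐ[K] L, ∀ a, χ' (ρ a) = χ a := by
  let g := (ρ : R →+* k).liftOfSurjective hρ ⟨(χ : R →+* L), fun a ha => by
    have := hker a ha
    exact (this.map χ).eq_zero⟩
  have hg : ∀ a, g (ρ a) = χ a := fun a => RingHom.liftOfRightInverse_comp_apply _ _ _ _ _
  refine ⟨{ g with commutes' := fun c => ?_ }, hg⟩
  change g (algebraMap K k c) = _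
  rw [← ρ.commutes, hg, χ.commutes]

theorem exists_pow_of_residue [IsAlgClosed L] {R k : Type} [Ring R] [Algebra K R] [Field k]
    [Finite k] (ρ : R →+* k) (hρ : Function.Surjective ρ)
    (hker : ∀ a, ρ a = 0 → IsNilpotent a) {d : ℕ} (hd : Nat.card k = Nat.card K ^ d)
    (χ : R →ₐ[K] L) :
    (∀ χ' : R →ₐ[K] L, ∃ j < d, ∀ a, χ' a = χ a ^ Nat.card K ^ j) ∧
    ∀ i j, (∀ a, χ a ^ Nat.card K ^ i = χ a ^ Nat.card K ^ j) ↔ i ≡ j [MOD d] := by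
  let _ : Algebra K k := (ρ.comp (algebraMap K R)).toAlgebra
  let ρ' : R →ₐ[K] k := { ρ with commutes' := fun _ => rfl }
  have : Module.Finite K k := Module.Finite.of_finite
  obtain rfl : d = Module.finrank K k :=
    Nat.pow_right_injective Finite.one_lt_card (hd.symm.trans (Module.natCard_eq_pow_finrank (K := K)))
  obtain ⟨c, hc⟩ := exists_algHom_factor ρ' hρ hker χ
  constructor
  · intro χ'
    obtain ⟨c', hc'⟩ := exists_algHom_factor ρ' hρ hker χ'
    obtain ⟨j, hj, h⟩ := exists_forall_eq_pow_pow c c'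
    exact ⟨j, hj, fun a => by rw [← hc, ← hc', h]⟩
  · intro i j
    rw [← pow_eq_pow_iff_modEq_finrank c]
    constructor
    · intro h a
      obtain ⟨a, rfl⟩ := hρ a
      change c (ρ' a) ^ _ = c (ρ' a) ^ _
      rw [hc, h]
    · intro h a
      rw [← hc, h]

end

end QRep

end

section
open CategoryTheory

namespace QRep

section
variable {I Ω : Type} {src tgt : Ω → I} {K L : Type} [Field K] [Field L]

theorem bcHom_surjective {g : K →+* L} (hg : Function.Bijective g) {X Y : RepObj src tgt K}
    [Finite I] : Function.Surjective (bcHom g : (X ⟶ Y) → (bc g X ⟶ bc g Y)) := by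
  intro φ
  have := Fintype.ofFinite I
  let s : L → K := Function.surjInv hg.2
  have hs : ∀ x, g (s x) = x := Function.surjInv_eq hg.2
  let F : ∀ i, Matrix (Fin (Y.dim i)) (Fin (X.dim i)) L := φ.1
  have hF : ∀ a, (Y.rep a).map g * F (src a) = F (tgt a) * (X.rep a).map g := φ.2
  have hFs : ∀ i, ((F i).map s).map g = F i := fun i => Matrix.ext fun j k => hs _
  refine ⟨⟨fun i => (F i).map s, fun a => ?_⟩, hom_ext fun i => hFs i⟩
  refine Matrix.map_injective g.injective ?_
  refine Matrix.map_mul.trans (Eq.trans ?_ Matrix.map_mul.symm)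
  refine (congrArg (_ * ·) (hFs _)).trans ((hF a).trans (congrArg (· * _) (hFs _)).symm)

variable [Finite I]

theorem isUnit_of_bcHom {g : K →+* L} (hg : Function.Bijective g) {X : RepObj src tgt K}
    {u : X ⟶ X} (hu : IsUnit (End.of (bcHom g u))) : IsUnit (End.of u) := by
  obtain ⟨⟨a, b, hab, hba⟩, rfl : a = _⟩ := hu
  obtain ⟨v, rfl⟩ := bcHom_surjective hg b
  refine ⟨⟨End.of u, End.of v, bcHom_injective g ?_, bcHom_injective g ?_⟩, rfl⟩
  · refine (bcHom_comp g v u).trans ?_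
    exact Eq.trans hab (bcHom_id g).symm
  · refine (bcHom_comp g u v).trans ?_
    exact Eq.trans hba (bcHom_id g).symm

theorem IndecObj.baseChange_of_bijective {g : K →+* L} (hg : Function.Bijective g) {X : RepObj src tgt K}
    (hX : IndecObj X) : IndecObj (bc g X) := by
  refine ⟨fun h => hX.1 (bcHom_injective g ?_), fun e he => ?_⟩
  · rw [bcHom_id, h, bcHom_zero]
  · obtain ⟨u, rfl⟩ := bcHom_surjective hg e
    rw [← bcHom_comp] at he
    rcases hX.2 u (bcHom_injective g he) with rfl | rfl
    · exact Or.inl (bcHom_zero g)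
    · exact Or.inr (bcHom_id g)

variable {f : K →+* L} {X : RepObj src tgt K} {z z' : RepObj src tgt L}

omit [Finite I] in
theorem exists_section_bc_bc {g : L →+* L} (hgf : g.comp f = f) {p : z ⟶ bc f X} {h : bc f X ⟶ z}
    (hp : p ≫ h = 𝟙 z) : ∃ (p' : bc g z ⟶ bc f X) (h' : bc f X ⟶ bc g z),
      p' ≫ h' = 𝟙 (bc g z) := by
  have : ∃ (p' : bc g z ⟶ bc (g.comp f) X)
      (h' : bc (g.comp f) X ⟶ bc g z), p' ≫ h' = 𝟙 (bc g z) :=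
    ⟨bcHom g p, bcHom g h, by rw [← bcHom_id, ← hp]; exact (bcHom_comp g p h).symm⟩
  rwa [hgf] at this

theorem IsChar.twist (hz : IndecObj z) {χ : End X → L} (hχ : IsChar f X z χ) {g : L →+* L}
    (hg : Function.Bijective g) (hgf : g.comp f = f) :
    IsChar f X (bc g z) fun φ => g (χ φ) := by
  have : IsChar (g.comp f) X (bc g z) fun φ => g (χ φ) := by
    intro φ h
    obtain ⟨h, rfl⟩ := bcHom_surjective hg (X := bc f X) (Y := z) h
    rw [(hz.baseChange_of_bijective hg).mem_radT L]
    intro p hu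
    obtain ⟨p, rfl⟩ := bcHom_surjective hg (X := z) (Y := bc f X) p
    refine (hz.mem_radT L).1 (hχ φ h) p (isUnit_of_bcHom hg ?_)
    have h1 : bcHom g (bcHom f φ ≫ h - χ φ • h) =
        bcHom g (bcHom f φ) ≫ bcHom g h - g (χ φ) • bcHom g h := by
      rw [sub_eq_add_neg, ← neg_smul, bcHom_add, bcHom_comp, bcHom_smul, map_neg, neg_smul,
        ← sub_eq_add_neg]
    rw [bcHom_comp, h1]
    exact hu
  rwa [hgf] at this

theorem IsChar.unique (hz : IndecObj z) (hz' : IndecObj z') (e : z ≅ z') {p : z ⟶ bc f X}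
    {h : bc f X ⟶ z} (hp : p ≫ h = 𝟙 z) {χ χ' : End X → L} (hχ : IsChar f X z χ)
    (hχ' : IsChar f X z' χ') : χ = χ' := by
  funext φ
  have := hz.nontrivial
  have hJ : ∀ u : z ⟶ z, ¬ IsUnit (End.of u) → End.of u ∈ Ring.jacobson (End z) := fun u hu =>
    (mem_jacobson_iff_not_isUnit (hz.nilp_or_unit L)).2 hu
  have h1 : End.of (p ≫ bcHom f φ ≫ h - χ φ • 𝟙 z) ∈ Ring.jacobson (End z) := hJ _ fun hu => by
    refine (hz.mem_radT L).1 (hχ φ h) p ?_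
    rwa [Preadditive.comp_sub, Linear.comp_smul, hp]
  have h2 : End.of (p ≫ bcHom f φ ≫ h - χ' φ • 𝟙 z) ∈ Ring.jacobson (End z) := hJ _ fun hu => by
    refine (hz'.mem_radT L).1 (hχ' φ (h ≫ e.hom)) (e.inv ≫ p) ?_
    have h3 := (isUnit_iff_isIso (End.of (p ≫ bcHom f φ ≫ h - χ' φ • 𝟙 z))).1 hu
    have h3 : IsIso (p ≫ bcHom f φ ≫ h - χ' φ • 𝟙 z) := h3
    have h4 : (e.inv ≫ p) ≫ (bcHom f φ ≫ h ≫ e.hom - χ' φ • h ≫ e.hom) =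
        e.inv ≫ (p ≫ bcHom f φ ≫ h - χ' φ • 𝟙 z) ≫ e.hom := by
      simp only [Preadditive.comp_sub, Preadditive.sub_comp, Category.assoc, Linear.comp_smul,
        Linear.smul_comp, Category.id_comp, reassoc_of% hp]
    rw [h4]
    refine (isUnit_iff_isIso (End.of (e.inv ≫ (p ≫ bcHom f φ ≫ h - χ' φ • 𝟙 z) ≫ e.hom))).2 ?_
    change IsIso (e.inv ≫ (p ≫ bcHom f φ ≫ h - χ' φ • 𝟙 z) ≫ e.hom)
    infer_instance
  have h5 : End.of ((χ' φ - χ φ) • 𝟙 z) ∈ Ring.jacobson (End z) := by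
    have := sub_mem h1 h2
    refine (congrArg (· ∈ Ring.jacobson (End z)) ?_).mp this
    change p ≫ bcHom f φ ≫ h - χ φ • 𝟙 z - (p ≫ bcHom f φ ≫ h - χ' φ • 𝟙 z) = _
    rw [sub_smul, sub_sub_sub_cancel_left]
  by_contra hne
  rw [mem_jacobson_iff_not_isUnit (hz.nilp_or_unit L)] at h5
  have h6 : IsUnit ((χ' φ - χ φ) • (1 : End z)) := by
    rw [← Algebra.algebraMap_eq_smul_one]
    exact (IsUnit.mk0 _ (sub_ne_zero.2 (Ne.symm hne))).map (algebraMap L (End z))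
  exact h5 h6

end

section
variable {I Ω : Type} [Finite I] {src tgt : Ω → I} {K L : Type} [Field K] [Field L] [Algebra K L]
variable {X : RepObj src tgt K} {z z' : RepObj src tgt L}

/-- Indecomposable summands of a base change are separated by their characters. -/
theorem IsChar.nonempty_iso (hz : IndecObj z) (hz' : IndecObj z')
    {p : z ⟶ bc (algebraMap K L) X} {h : bc (algebraMap K L) X ⟶ z} (hp : p ≫ h = 𝟙 z)
    {p' : z' ⟶ bc (algebraMap K L) X} {h' : bc (algebraMap K L) X ⟶ z'} (hp' : p' ≫ h' = 𝟙 z')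
    {χ : End X → L} (hχ : IsChar (algebraMap K L) X z χ)
    (hχ' : IsChar (algebraMap K L) X z' χ) : Nonempty (z' ≅ z) := by
  have := hz'.nontrivial
  have key : ∀ e : bc (algebraMap K L) X ⟶ bc (algebraMap K L) X, ∃ c : L,
      e ≫ h - c • h ∈ radT z (bc (algebraMap K L) X) ∧
      e ≫ h' - c • h' ∈ radT z' (bc (algebraMap K L) X) := by
    intro e
    have he := mem_span_bcHom e
    induction he using Submodule.span_induction with
    | mem g hg =>
      obtain ⟨φ, rfl⟩ := hg
      exact ⟨χ φ, hχ φ h, hχ' φ h'⟩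
    | zero =>
      refine ⟨0, ?_, ?_⟩ <;>
      · rw [Limits.zero_comp, zero_smul, sub_zero]
        exact Submodule.zero_mem _
    | add g g' _ _ hg hg' =>
      obtain ⟨c, h1, h2⟩ := hg
      obtain ⟨c', h3, h4⟩ := hg'
      refine ⟨c + c', ?_, ?_⟩
      · rw [Preadditive.add_comp, add_smul, add_sub_add_comm]
        exact Submodule.add_mem _ h1 h3
      · rw [Preadditive.add_comp, add_smul, add_sub_add_comm]
        exact Submodule.add_mem _ h2 h4
    | smul a g _ hg =>
      obtain ⟨c, h1, h2⟩ := hg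
      refine ⟨a * c, ?_, ?_⟩
      · rw [Linear.smul_comp, mul_smul, ← smul_sub]
        exact Submodule.smul_of_tower_mem _ a h1
      · rw [Linear.smul_comp, mul_smul, ← smul_sub]
        exact Submodule.smul_of_tower_mem _ a h2
  obtain ⟨c, h1, h2⟩ := key (h ≫ p)
  have hc : c = 1 := by
    by_contra hne
    refine (hz.mem_radT L).1 h1 p ?_
    have : p ≫ ((h ≫ p) ≫ h - c • h) = (1 - c) • 𝟙 z := by
      rw [Preadditive.comp_sub, Linear.comp_smul, Category.assoc, reassoc_of% hp, hp, sub_smul,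
        one_smul]
    rw [this]
    have h6 : IsUnit ((1 - c) • (1 : End z)) := by
      rw [← Algebra.algebraMap_eq_smul_one]
      exact (IsUnit.mk0 _ (sub_ne_zero.2 (Ne.symm hne))).map (algebraMap L (End z))
    exact h6
  subst hc
  have h3 : IsUnit (End.of (p' ≫ h ≫ p ≫ h')) := by
    by_contra hu
    have hn := (hz'.nilp_or_unit L (End.of (p' ≫ h ≫ p ≫ h'))).resolve_right hu
    refine (hz'.mem_radT L).1 h2 p' ?_
    have h4 : p' ≫ ((h ≫ p) ≫ h' - (1 : L) • h') = (p' ≫ h ≫ p ≫ h') - 𝟙 z' := by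
      rw [Preadditive.comp_sub, one_smul, hp', Category.assoc]
    rw [h4]
    exact hn.isUnit_sub_one
  have h4 := (isUnit_iff_isIso (End.of (p' ≫ h ≫ p ≫ h'))).1 h3
  refine hz'.nonempty_iso_of_section hz (i := p' ≫ h)
    (p := (p ≫ h') ≫ inv (End.of (p' ≫ h ≫ p ≫ h'))) ?_
  refine Eq.trans ?_ (IsIso.hom_inv_id (End.of (p' ≫ h ≫ p ≫ h')))
  change _ = (p' ≫ h ≫ p ≫ h') ≫ _
  simp only [Category.assoc]

end

end QRep

end

section
open CategoryTheory

namespace QRep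

section
variable {K L : Type} [Field K] [Field L]

theorem frobenius_pow_apply {τ : L →+* L} {q : ℕ} (hτ : ∀ x, τ x = x ^ q) (j : ℕ) (x : L) :
    (τ ^ j) x = x ^ q ^ j := by
  induction j generalizing x with
  | zero => simp
  | succ j ih => rw [pow_succ, RingHom.mul_def, RingHom.comp_apply, ih, hτ, ← pow_mul, ← pow_succ']

theorem frobenius_pow_bijective [IsAlgClosed L] {τ : L →+* L} {q : ℕ} (hτ : ∀ x, τ x = x ^ q)
    (hq : 0 < q) (j : ℕ) : Function.Bijective (τ ^ j : L →+* L) := by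
  refine ⟨(τ ^ j).injective, fun x => ?_⟩
  obtain ⟨y, hy⟩ := IsAlgClosed.exists_pow_nat_eq x (pow_pos hq j)
  exact ⟨y, by rw [frobenius_pow_apply hτ, hy]⟩

theorem frobenius_pow_comp_algebraMap [Finite K] [Algebra K L] {τ : L →+* L}
    (hτ : ∀ x, τ x = x ^ Nat.card K) (j : ℕ) :
    (τ ^ j).comp (algebraMap K L) = algebraMap K L := by
  have := Fintype.ofFinite K
  refine RingHom.ext fun x => ?_
  rw [RingHom.comp_apply, frobenius_pow_apply hτ, ← map_pow, Nat.card_eq_fintype_card,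
    FiniteField.pow_card_pow]

end

section
variable {I Ω : Type} [Finite I] {src tgt : Ω → I} {K L : Type} [Field K] [Field L] [Algebra K L]
variable [Finite K] [IsAlgClosed L]

/-- The base change of an indecomposable object to an algebraically closed field is the sum of the
Frobenius twists of an indecomposable object. -/
theorem IndecObj.exists_twists {τ : L →+* L} (hτ : ∀ x, τ x = x ^ Nat.card K)
    {X : RepObj src tgt K} (hX : IndecObj X) :
    ∃ y : RepObj src tgt L, (∀ j, IndecObj (bc (τ ^ j) y)) ∧
      (∀ i j, Nonempty (bc (τ ^ i) y ≅ bc (τ ^ j) y) ↔ i ≡ j [MOD tdim K X X]) ∧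
      (∀ z : RepObj src tgt L, IndecObj z → (tdim L z (bc (algebraMap K L) X) ≠ 0 ↔
        ∃ j < tdim K X X, Nonempty (z ≅ bc (τ ^ j) y))) ∧
      X.dim = tdim K X X • y.dim := by
  classical
  have hX0 : 𝟙 (bc (algebraMap K L) X) ≠ 0 := fun h => hX.1
    (bcHom_injective (algebraMap K L) (by rw [bcHom_id, h, bcHom_zero]))
  obtain ⟨y, p, h, hy, hp⟩ := exists_indec_section L _ hX0
  obtain ⟨-, χ, hχ⟩ := hX.exists_isChar hy (tdim_ne_zero_of_section L hy hp)
  have hcard : 0 < Nat.card K := Nat.card_pos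
  have hbij := frobenius_pow_bijective hτ hcard
  have hcomp := frobenius_pow_comp_algebraMap (K := K) hτ
  have hyj : ∀ j, IndecObj (bc (τ ^ j) y) := fun j => hy.baseChange_of_bijective (hbij j)
  have hχj : ∀ j, IsChar (algebraMap K L) X (bc (τ ^ j) y) fun φ => χ φ ^ Nat.card K ^ j := by
    intro j
    have := hχ.twist hy (hbij j) (hcomp j)
    simpa only [frobenius_pow_apply hτ] using this
  have hsec := fun j => exists_section_bc_bc (hcomp j) hp
  obtain ⟨k, _, _, ρ, hρ, hker, hk⟩ := hX.exists_residue (K := K)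
  have := hX.nontrivial
  obtain ⟨h1, h2⟩ := exists_pow_of_residue ρ hρ (fun a ha => (hX.nilp_or_unit K a).resolve_right
    ((mem_jacobson_iff_not_isUnit (hX.nilp_or_unit K)).1 ((hker a).1 ha))) hk χ
  have hiso : ∀ i j, Nonempty (bc (τ ^ i) y ≅ bc (τ ^ j) y) ↔ i ≡ j [MOD tdim K X X] := by
    intro i j
    rw [← h2]
    obtain ⟨p₁, h₁, hp₁⟩ := hsec i
    obtain ⟨p₂, h₂, hp₂⟩ := hsec j
    constructor
    · rintro ⟨e⟩ a
      exact congrFun ((hχj i).unique (hyj i) (hyj j) e hp₁ (hχj j)) a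
    · intro ha
      have : IsChar (algebraMap K L) X (bc (τ ^ i) y) fun φ => χ φ ^ Nat.card K ^ j := by
        simpa only [ha] using hχj i
      exact (hχj j).nonempty_iso (hyj j) (hyj i) hp₂ hp₁ this
  have hsum : ∀ z : RepObj src tgt L, IndecObj z → (tdim L z (bc (algebraMap K L) X) ≠ 0 ↔
        ∃ j < tdim K X X, Nonempty (z ≅ bc (τ ^ j) y)) := by
    intro z hz
    constructor
    · intro h0
      obtain ⟨-, χ', hχ'⟩ := hX.exists_isChar hz h0
      obtain ⟨p', h', hp'⟩ := exists_section_of_tdim_ne_zero L hz h0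
      obtain ⟨j, hj, hj'⟩ := h1 χ'
      obtain ⟨p₂, h₂, hp₂⟩ := hsec j
      refine ⟨j, hj, (hχj j).nonempty_iso (hyj j) hz hp₂ hp' ?_⟩
      rwa [show (χ' : End X → L) = _ from funext hj'] at hχ'
    · rintro ⟨j, -, ⟨e⟩⟩
      obtain ⟨p₂, h₂, hp₂⟩ := hsec j
      exact tdim_ne_zero_of_section L hz (i := e.hom ≫ p₂) (p := h₂ ≫ e.inv)
        (by simp [reassoc_of% hp₂])
  refine ⟨y, hyj, hiso, hsum, ?_⟩
  obtain ⟨Z, hZdim, hZ⟩ := exists_direct_sum (K := L)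
    (fun j : Fin (tdim K X X) => bc (τ ^ (j : ℕ)) y) fun _ => 1
  obtain ⟨e⟩ : Nonempty (bc (algebraMap K L) X ≅ Z) := by
    refine nonempty_iso_of_tdim_eq L _ _ fun J hJ => ?_
    rw [hZ]
    by_cases h0 : tdim L J (bc (algebraMap K L) X) = 0
    · rw [h0]
      refine (Finset.sum_eq_zero fun j _ => ?_).symm
      rw [one_mul]
      refine hJ.tdim_eq_zero L (hyj j) ⟨fun e => ?_⟩
      exact (hsum J hJ).2 ⟨j, j.2, ⟨e⟩⟩ h0
    · obtain ⟨j, hj, ⟨e⟩⟩ := (hsum J hJ).1 h0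
      have hJ1 := (hX.exists_isChar hJ h0).1
      have hJJ : tdim L J J = 1 := by
        obtain ⟨i', p', hp'⟩ := exists_section_of_tdim_ne_zero L hJ h0
        obtain ⟨W, hW⟩ := isSum_of_section hp'
        have := tdim_isSum L J hW
        have := hJ.tdim_self_pos L
        omega
      rw [hJ1, Finset.sum_eq_single_of_mem (⟨j, hj⟩ : Fin _) (Finset.mem_univ _), one_mul,
        ← tdim_congr L J e, hJJ]
      intro j' _ hne
      rw [one_mul]
      refine hJ.tdim_eq_zero L (hyj j') ⟨fun e' => hne (Fin.ext ?_)⟩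
      exact Nat.ModEq.eq_of_lt_of_lt ((hiso j' j).1 ⟨e'.symm ≪≫ e⟩) j'.2 hj
  have := dim_eq_of_iso e
  rw [hZdim] at this
  change X.dim = _ at this
  rw [this]
  simp only [one_smul]
  change ∑ _ : Fin (tdim K X X), y.dim = _
  rw [Finset.sum_const, Finset.card_univ, Fintype.card_fin]

omit [IsAlgClosed L] [Finite K] in
theorem exists_tdim_ne_zero_of_bc (z : RepObj src tgt L) (X : RepObj src tgt K)
    (h0 : tdim L z (bc (algebraMap K L) X) ≠ 0) :
    ∃ J : RepObj src tgt K, IndecObj J ∧ tdim K J X ≠ 0 ∧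
      tdim L z (bc (algebraMap K L) J) ≠ 0 := by
  revert h0
  refine indec_induction K (P := fun X => tdim L z (bc (algebraMap K L) X) ≠ 0 →
    ∃ J : RepObj src tgt K, IndecObj J ∧ tdim K J X ≠ 0 ∧
      tdim L z (bc (algebraMap K L) J) ≠ 0) ?_ ?_ X
  · intro X hX h
    exact absurd (tdim_of_id_eq_zero L z (by rw [← bcHom_id, hX, bcHom_zero])) h
  · intro X J Z h hJ ih h0
    by_cases hJ0 : tdim L z (bc (algebraMap K L) J) = 0
    · obtain ⟨J', hJ', h1, h2⟩ := ih fun hZ => h0 (by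
        rw [tdim_isSum L z (bc_isSum (algebraMap K L) h), hJ0, hZ])
      refine ⟨J', hJ', ?_, h2⟩
      rw [tdim_isSum K J' h]
      omega
    · refine ⟨J, hJ, ?_, hJ0⟩
      have := hJ.tdim_self_pos K
      rw [tdim_isSum K J h]
      omega

end

end QRep

end

section
open CategoryTheory

namespace QRep

section
variable {I Ω : Type} [Finite I] {src tgt : Ω → I} {K L : Type} [Field K] [Field L] [Algebra K L]

/-- The base change of `X` is the sum of the twists of `y` by the powers of `τ`. -/
structure IsTwistSum (τ : L →+* L) (X : RepObj src tgt K) (y : RepObj src tgt L) : Prop where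
  indec : ∀ j, IndecObj (bc (τ ^ j) y)
  iso_iff : ∀ i j, Nonempty (bc (τ ^ i) y ≅ bc (τ ^ j) y) ↔ i ≡ j [MOD tdim K X X]
  tdim_iff : ∀ z : RepObj src tgt L, IndecObj z → (tdim L z (bc (algebraMap K L) X) ≠ 0 ↔
    ∃ j < tdim K X X, Nonempty (z ≅ bc (τ ^ j) y))
  dim : X.dim = tdim K X X • y.dim

omit [Finite I] in
theorem IsTwistSum.dvd {τ : L →+* L} {X : RepObj src tgt K} {y z : RepObj src tgt L}
    (h : IsTwistSum τ X y) {j m : ℕ} (e : z ≅ bc (τ ^ j) y) (e' : bc (τ ^ m) z ≅ z) :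
    tdim K X X ∣ m := by
  have : Nonempty (bc (τ ^ (m + j)) y ≅ bc (τ ^ j) y) := by
    rw [pow_add]
    exact ⟨(bcIso (τ ^ m) e).symm ≪≫ e' ≪≫ e⟩
  rw [h.iso_iff] at this
  exact (Nat.modEq_zero_iff_dvd).1 (Nat.ModEq.add_right_cancel' j (by rwa [zero_add]))

/-- The number of isomorphism classes of indecomposable objects of dimension `β` which are
fixed by `τ`. -/
noncomputable def fixedIndecCount (src tgt : Ω → I) (τ : L →+* L) (β : I → ℕ) : ℕ :=
  Nat.card {c : Quotient (isIsomorphicSetoid (RepObj src tgt L)) //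
    ∃ y, Quotient.mk _ y = c ∧ IndecObj y ∧ y.dim = β ∧ Nonempty (bc τ y ≅ y)}

open Classical in
theorem sum_tdim_eq_fixedIndecCount [Finite Ω] [Finite K] [IsAlgClosed L]
    [Algebra.IsAlgebraic K L] {τ : L →+* L} (hτ : ∀ x, τ x = x ^ Nat.card K)
    {α : I → ℕ} {ι : Type} [Fintype ι] {S : ι → RepObj src tgt K} (hS : IsIndecList α S)
    {y : ι → RepObj src tgt L} (hy : ∀ s, IsTwistSum τ (S s) (y s)) {m : ℕ} (hm : m ≠ 0)
    {β : I → ℕ} (hβ : m • β ≤ α) :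
    ∑ s with (y s).dim = β ∧ tdim K (S s) (S s) ∣ m, tdim K (S s) (S s) =
      fixedIndecCount src tgt (τ ^ m) β := by
  let T := {s // (y s).dim = β ∧ tdim K (S s) (S s) ∣ m}
  let F : (Σ s : T, Fin (tdim K (S s) (S s))) →
      {c : Quotient (isIsomorphicSetoid (RepObj src tgt L)) //
        ∃ y, Quotient.mk _ y = c ∧ IndecObj y ∧ y.dim = β ∧ Nonempty (bc (τ ^ m) y ≅ y)} :=
    fun p => ⟨Quotient.mk _ (bc (τ ^ (p.2 : ℕ)) (y p.1)), _, rfl, (hy p.1).indec _, p.1.2.1, by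
      have h1 : Nonempty (bc (τ ^ (m + (p.2 : ℕ))) (y p.1) ≅ bc (τ ^ (p.2 : ℕ)) (y p.1)) := by
        rw [(hy p.1).iso_iff]
        have := (Nat.modEq_zero_iff_dvd.2 p.1.2.2).add_right (p.2 : ℕ)
        rwa [zero_add] at this
      rwa [pow_add] at h1⟩
  have hF : Function.Bijective F := by
    constructor
    · rintro ⟨⟨s, hs⟩, j⟩ ⟨⟨s', hs'⟩, j'⟩ h
      obtain ⟨e⟩ : Nonempty (bc (τ ^ (j : ℕ)) (y s) ≅ bc (τ ^ (j' : ℕ)) (y s')) :=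
        Quotient.exact (congrArg Subtype.val h)
      have hz := (hy s).indec j
      obtain ⟨p, q, hpq⟩ := exists_section_of_tdim_ne_zero L hz
        (((hy s).tdim_iff _ hz).2 ⟨j, j.2, ⟨Iso.refl _⟩⟩)
      obtain ⟨p', q', hpq'⟩ := exists_section_of_tdim_ne_zero L hz
        (((hy s').tdim_iff _ hz).2 ⟨j', j'.2, ⟨e⟩⟩)
      have hss := (hS.indec s).nonempty_iso_of_bc_sections (hS.indec s') hz.1 hpq hpq'
      obtain rfl : s = s' := by
        by_contra hne
        exact (hS.ne s s' hne).false hss.some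
      obtain rfl : j = j' := Fin.ext
        (Nat.ModEq.eq_of_lt_of_lt (((hy s).iso_iff _ _).1 ⟨e⟩) j.2 j'.2)
      rfl
    · rintro ⟨c, z, rfl, hz, hzβ, ⟨e'⟩⟩
      obtain ⟨X₀, i₀, p₀, hp₀⟩ := exists_section_bc (K := K) z
      obtain ⟨X, hX, -, hzX⟩ := exists_tdim_ne_zero_of_bc z X₀
        (tdim_ne_zero_of_section L hz hp₀)
      obtain ⟨y', h1, h2, h3, h4⟩ := hX.exists_twists hτ
      have hy' : IsTwistSum τ X y' := ⟨h1, h2, h3, h4⟩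
      obtain ⟨j, -, ⟨e⟩⟩ := (h3 z hz).1 hzX
      have hXα : X.dim ≤ α := by
        refine le_trans (fun i => ?_) hβ
        have hd : y'.dim = β := (dim_eq_of_iso e).symm.trans hzβ
        rw [h4, hd]
        exact Nat.mul_le_mul_right _ (Nat.le_of_dvd (Nat.pos_of_ne_zero hm) (hy'.dvd e e'))
      obtain ⟨s, ⟨eX⟩⟩ := hS.cover X hX hXα
      rw [tdim_congr L z (bcIso (algebraMap K L) eX), (hy s).tdim_iff z hz] at hzX
      obtain ⟨j, hj, ⟨e⟩⟩ := hzX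
      refine ⟨⟨⟨s, (dim_eq_of_iso e).symm.trans hzβ, (hy s).dvd e e'⟩, ⟨j, hj⟩⟩, ?_⟩
      exact Subtype.ext (Quotient.sound ⟨e.symm⟩)
  rw [fixedIndecCount, ← Nat.card_eq_of_bijective F hF, Nat.card_sigma]
  simp only [Nat.card_eq_fintype_card, Fintype.card_fin]
  exact Finset.sum_subtype _ (fun s => by simp) fun s => tdim K (S s) (S s)

theorem levelAtMost_iff [Finite Ω] [Finite K] {τ : AlgebraicClosure K →+* AlgebraicClosure K}
    {α : I → ℕ} {ι : Type} {S : ι → RepObj src tgt K} (hS : IsIndecList α S)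
    {y : ι → RepObj src tgt (AlgebraicClosure K)} (hy : ∀ s, IsTwistSum τ (S s) (y s))
    (V : Set (I → ℕ)) (x : Rep src tgt K α) : LevelAtMost src tgt x V ↔
      ∀ s, mult K (S s) (⟨α, x⟩ : RepObj src tgt K) ≠ 0 → (y s).dim ∈ V := by
  constructor
  · intro h s hs
    rw [mult_ne_zero_iff (hS.indec s)] at hs
    obtain ⟨i, p, hip⟩ := exists_section_of_tdim_ne_zero K (hS.indec s) hs
    have hz := (hy s).indec 0
    obtain ⟨i', p', hip'⟩ := exists_section_of_tdim_ne_zero _ hz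
      (((hy s).tdim_iff _ hz).2 ⟨0, (hS.indec s).tdim_self_pos K, ⟨Iso.refl _⟩⟩)
    have hsec : (i' ≫ bcHom (algebraMap K _) i) ≫ (bcHom (algebraMap K _) p ≫ p') = 𝟙 _ := by
      rw [Category.assoc, ← Category.assoc (bcHom (algebraMap K _) i), ← bcHom_comp, hip,
        bcHom_id, Category.id_comp, hip']
    obtain ⟨Z, hZ⟩ := isSum_of_section hsec
    exact h _ _ (bc (τ ^ 0) (y s)).rep Z.rep (indec_iff.2 hz) (isSum_iff.1 hZ)
  · intro h γ δ Y z hY hYz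
    have hY' : IndecObj (⟨γ, Y⟩ : RepObj src tgt (AlgebraicClosure K)) := indec_iff.1 hY
    have hsum : IsSum (bc (algebraMap K (AlgebraicClosure K)) (⟨α, x⟩ : RepObj src tgt K))
      ⟨γ, Y⟩ ⟨δ, z⟩ := isSum_iff.2 hYz
    have h0 : tdim (AlgebraicClosure K) (⟨γ, Y⟩ : RepObj src tgt (AlgebraicClosure K))
        (bc (algebraMap K (AlgebraicClosure K)) (⟨α, x⟩ : RepObj src tgt K)) ≠ 0 := by
      have := hY'.tdim_self_pos (AlgebraicClosure K)
      rw [tdim_isSum _ _ hsum]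
      omega
    obtain ⟨J, hJ, hJx, hYJ⟩ := exists_tdim_ne_zero_of_bc _ _ h0
    obtain ⟨s, ⟨e⟩⟩ := hS.cover J hJ (dim_le_of_tdim_ne_zero hJ hJx)
    rw [tdim_congr _ _ (bcIso (algebraMap K (AlgebraicClosure K)) e),
      (hy s).tdim_iff _ hY'] at hYJ
    obtain ⟨j, -, ⟨e'⟩⟩ := hYJ
    have := h s (by
      rw [mult_ne_zero_iff (hS.indec s), ← hJ.tdim_congr_left K e]
      exact hJx)
    rwa [← show γ = (y s).dim from dim_eq_of_iso e'] at this

end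

theorem exists_field_extension {K L : Type} [Field K] [Finite K] [Field L] [IsAlgClosed L]
    [Algebra K L] [Algebra.IsAlgebraic K L] {m : ℕ} (hm : m ≠ 0) :
    ∃ (E : Type) (_ : Field E) (_ : Finite E) (_ : Algebra E L),
      Algebra.IsAlgebraic E L ∧ Nat.card E = Nat.card K ^ m := by
  have := Fintype.ofFinite K
  obtain ⟨p, hp⟩ := CharP.exists K
  obtain ⟨n, hpr, hn⟩ := FiniteField.card K p
  have : Fact p.Prime := ⟨hpr⟩
  have : CharP L p := charP_of_injective_algebraMap (algebraMap K L).injective p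
  let _ : Algebra (ZMod p) K := ZMod.algebra K p
  let _ : Algebra (ZMod p) L := ZMod.algebra L p
  have : IsScalarTower (ZMod p) K L := IsScalarTower.of_algebraMap_eq' (Subsingleton.elim _ _)
  have : Algebra.IsAlgebraic (ZMod p) L := Algebra.IsAlgebraic.trans (ZMod p) K L
  let E := GaloisField p (n * m)
  let f : E →ₐ[ZMod p] L := IsAlgClosed.lift
  let _ : Algebra E L := f.toRingHom.toAlgebra
  have : IsScalarTower (ZMod p) E L := IsScalarTower.of_algebraMap_eq' (Subsingleton.elim _ _)
  refine ⟨E, inferInstance, inferInstance, inferInstance,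
    Algebra.IsAlgebraic.tower_top (K := ZMod p) E, ?_⟩
  rw [GaloisField.card p _ (Nat.mul_ne_zero n.ne_zero hm), Nat.card_eq_fintype_card, hn, pow_mul]

end QRep

end

section
open CategoryTheory PowerSeries

namespace QRep

section
variable {ι J H : Type}

open Classical in
theorem prod_phi_eq [Fintype ι] [Fintype J] (c : ι → J) (d : ι → ℕ) (hd : ∀ s, d s ≠ 0) (β : J → H →₀ ℕ)
    (hβ : ∀ j, β j ≠ 0) (γ : ι → H →₀ ℕ) (hγ0 : ∀ s, γ s ≠ 0) (hγ : ∀ s, γ s = d s • β (c s))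
    (good : J → Prop) (F : ι → PowerSeries ℚ) :
    ∏ s, phi (γ s) (hγ0 s) (if good (c s) then F s else 1) =
      ∏ j, phi (β j) (hβ j)
        (if good j then ∏ s with c s = j, expand (d s) (hd s) (F s) else 1) := by
  rw [← Finset.prod_fiberwise Finset.univ c]
  refine Finset.prod_congr rfl fun j _ => ?_
  have h : ∀ s ∈ Finset.univ.filter (fun s => c s = j),
      phi (γ s) (hγ0 s) (if good (c s) then F s else 1) =
        phi (β j) (hβ j) (if good j then expand (d s) (hd s) (F s) else 1) := by
    intro s hs
    obtain rfl := (Finset.mem_filter.1 hs).2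
    have key : ∀ (γ' : H →₀ ℕ) (h0 : γ' ≠ 0) (_ : γ' = d s • β (c s)) (G : PowerSeries ℚ),
        phi γ' h0 G = phi (β (c s)) (hβ _) (expand (d s) (hd s) G) := by
      rintro _ h0 rfl G
      exact (phi_expand _ _ _ _ h0 G).symm
    rw [key _ _ (hγ s)]
    split_ifs
    · rfl
    · rw [map_one]
  rw [Finset.prod_congr rfl h, ← map_prod]
  split_ifs
  · rfl
  · rw [Finset.prod_const_one]

theorem constantCoeff_prod_expand (T : Finset ι) (d : ι → ℕ) (hd : ∀ s, d s ≠ 0)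
    (F : ι → PowerSeries ℚ) (hF : ∀ s, constantCoeff (F s) = 1) :
    constantCoeff (∏ s ∈ T, expand (d s) (hd s) (F s)) = 1 := by
  rw [map_prod]
  refine Finset.prod_eq_one fun s _ => ?_
  rw [← coeff_zero_eq_constantCoeff_apply, coeff_expand, if_pos (dvd_zero _), Nat.zero_div,
    coeff_zero_eq_constantCoeff_apply, hF]

theorem LD_prod_expand (T : Finset ι) (d : ι → ℕ) (hd : ∀ s, d s ≠ 0)
    (F : ι → PowerSeries ℚ) (c : ℕ → ℚ)
    (hF : ∀ s, LD (F s) (mk fun m => if m = 0 then 0 else c (d s * m))) :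
    LD (∏ s ∈ T, expand (d s) (hd s) (F s))
      (mk fun m => if m = 0 then 0 else ((∑ s ∈ T with d s ∣ m, d s : ℕ) : ℚ) * c m) := by
  have h := LD.prod T _ _ fun s _ => (hF s).expand (d s) (hd s)
  convert h using 1
  ext m
  rw [map_sum, coeff_mk]
  have h' : ∀ s ∈ T, coeff m ((d s : ℚ) • expand (d s) (hd s)
      (mk fun m => if m = 0 then 0 else c (d s * m))) =
      if m = 0 then 0 else if d s ∣ m then (d s : ℚ) * c m else 0 := by
    intro s _
    rw [coeff_smul, coeff_expand, smul_eq_mul]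
    by_cases hm : m = 0
    · simp [hm]
    · rw [if_neg hm]
      split_ifs with hs
      · rw [coeff_mk, if_neg, Nat.mul_div_cancel' hs]
        exact (Nat.div_pos (Nat.le_of_dvd (Nat.pos_of_ne_zero hm) hs)
          (Nat.pos_of_ne_zero (hd s))).ne'
      · rw [mul_zero]
  rw [Finset.sum_congr rfl h']
  split_ifs with hm
  · simp
  · rw [← Finset.sum_filter, Nat.cast_sum, Finset.sum_mul]

theorem constantCoeff_phi (β : H →₀ ℕ) (hβ : β ≠ 0) (F : PowerSeries ℚ) :
    MvPowerSeries.constantCoeff (phi β hβ F) = constantCoeff F := by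
  rw [← MvPowerSeries.coeff_zero_eq_constantCoeff_apply, ← coeff_zero_eq_constantCoeff_apply,
    ← coeff_phi_smul β hβ F 0, zero_smul]

theorem coeff_mul_phi (β : H →₀ ℕ) (hβ : β ≠ 0) (F : PowerSeries ℚ) (hF : constantCoeff F = 1)
    (G : MvPowerSeries H ℚ) (hG : MvPowerSeries.constantCoeff G = 1) :
    MvPowerSeries.coeff β (G * phi β hβ F) = MvPowerSeries.coeff β G + coeff 1 F := by
  classical
  rw [MvPowerSeries.coeff_mul, Finset.sum_eq_add_of_mem (β, 0) (0, β)]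
  · rw [MvPowerSeries.coeff_zero_eq_constantCoeff_apply, MvPowerSeries.coeff_zero_eq_constantCoeff_apply,
      constantCoeff_phi, hF, hG, mul_one, one_mul]
    congr 1
    rw [← coeff_phi_smul β hβ F 1, one_smul]
  · simp
  · simp
  · simpa using fun h => (hβ h).elim
  · rintro ⟨u, v⟩ huv ⟨h1, h2⟩
    rw [Finset.HasAntidiagonal.mem_antidiagonal] at huv
    simp only at huv
    rw [coeff_phi_of_ne, mul_zero]
    rintro n rfl
    obtain ⟨i, hi⟩ := DFunLike.ne_iff.1 hβ
    have h3 := DFunLike.congr_fun huv i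
    simp only [Finsupp.coe_add, Pi.add_apply, Finsupp.coe_smul, Pi.smul_apply, smul_eq_mul] at h3
    have hi' : 0 < β i := Nat.pos_of_ne_zero hi
    have hn : n ≤ 1 := by
      by_contra hn
      have : 2 * β i ≤ n * β i := Nat.mul_le_mul_right _ (by omega)
      omega
    interval_cases n
    · exact h1 (by simpa using huv)
    · exact h2 (by simpa using huv)

theorem LD.coeff_one {F s : PowerSeries ℚ} (h : LD F s) (hF : constantCoeff F = 1)
    (hs : constantCoeff s = 0) : coeff 1 F = coeff 1 s := by
  have := congrArg (coeff 1) h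
  rw [coeff_X_mul_derivative, coeff_mul, Finset.Nat.antidiagonal_succ] at this
  simpa [hF, hs] using this

end

end QRep

end

section
open CategoryTheory PowerSeries

namespace QRep

section
variable {I Ω : Type} [Fintype I] {src tgt : Ω → I} {K L : Type} [Field K] [Field L] [Algebra K L]
  {τ : L →+* L} {α : I → ℕ} {ι : Type} {S : ι → RepObj src tgt K} {y : ι → RepObj src tgt L}

omit [Fintype I] in
theorem IsTwistSum.dim_ne_zero {X : RepObj src tgt K} {z : RepObj src tgt L}
    (h : IsTwistSum τ X z) : z.dim ≠ 0 :=
  (h.indec 0).dim_ne_zero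

theorem IsTwistSum.dim_le {X : RepObj src tgt K} {z : RepObj src tgt L}
    (h : IsTwistSum τ X z) (hX : IndecObj X) : z.dim ≤ X.dim := by
  rw [h.dim]
  exact fun i => Nat.le_mul_of_pos_left _ (hX.tdim_self_pos K)

/-- The nonzero dimension vectors bounded by `α`. -/
abbrev DimLE (α : I → ℕ) : Type := {β : I → ℕ // β ≠ 0 ∧ β ≤ α}

theorem finite_dimLE (α : I → ℕ) : Finite (DimLE α) := by
  classical
  exact Set.Finite.subset (Set.finite_Iic α) fun _ h => h.2

noncomputable instance (α : I → ℕ) : Fintype (DimLE α) :=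
  have := finite_dimLE α
  Fintype.ofFinite _

variable [Finite Ω] [Finite K] [IsAlgClosed L] [Algebra.IsAlgebraic K L] [Fintype ι]
  (hτ : ∀ x, τ x = x ^ Nat.card K) (hS : IsIndecList α S) (hy : ∀ s, IsTwistSum τ (S s) (y s))

/-- The contribution to a product over indecomposables of those whose geometric summands have
dimension vector `β`. -/
noncomputable def dimFactor (hS : IsIndecList α S) (y : ι → RepObj src tgt L)
    (F : ℕ → PowerSeries ℚ) (β : I → ℕ) : PowerSeries ℚ :=
  open Classical in
  ∏ s with (y s).dim = β, expand (tdim K (S s) (S s)) ((hS.indec s).tdim_self_pos K).ne'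
    (F (tdim K (S s) (S s)))

omit [Algebra K L] [Finite Ω] [Finite K] [IsAlgClosed L] [Algebra.IsAlgebraic K L] in
theorem constantCoeff_dimFactor {F : ℕ → PowerSeries ℚ} (hF : ∀ d, constantCoeff (F d) = 1)
    (β : I → ℕ) : constantCoeff (dimFactor hS y F β) = 1 :=
  constantCoeff_prod_expand _ _ _ (fun _ => F _) fun _ => hF _

open Classical in
include hy in
omit [Finite Ω] [Finite K] [IsAlgClosed L] [Algebra.IsAlgebraic K L] in
theorem prod_phi_eq_dimFactor (V : Set (I → ℕ)) (F : ℕ → PowerSeries ℚ) :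
    ∏ s, phi (expo (S s).dim) (hS.dim_ne_zero s)
        (if (y s).dim ∈ V then F (tdim K (S s) (S s)) else 1) =
      ∏ β : DimLE α, phi (expo β.1) (expo_ne_zero β.2.1)
        (if β.1 ∈ V then dimFactor hS y F β.1 else 1) := by
  have h := prod_phi_eq (J := DimLE α)
    (fun s => ⟨(y s).dim, (hy s).dim_ne_zero, ((hy s).dim_le (hS.indec s)).trans (hS.le s)⟩)
    (fun s => tdim K (S s) (S s)) (fun s => ((hS.indec s).tdim_self_pos K).ne')
    (fun β => expo β.1) (fun β => expo_ne_zero β.2.1) (fun s => expo (S s).dim)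
    (fun s => hS.dim_ne_zero s) (fun s => (congrArg expo (hy s).dim).trans (expo_smul _ _)) (fun β => β.1 ∈ V)
    (fun s => F (tdim K (S s) (S s)))
  refine h.trans (Finset.prod_congr rfl fun β _ => ?_)
  congr 2
  unfold dimFactor
  refine Finset.prod_congr ?_ fun _ _ => rfl
  ext s
  simp only [Finset.mem_filter]
  exact and_congr_right fun _ => Subtype.ext_iff

open Classical in
omit [Algebra K L] [Finite Ω] [Finite K] [IsAlgClosed L] [Algebra.IsAlgebraic K L] in
theorem LD_dimFactor {F : ℕ → PowerSeries ℚ} {c : ℕ → ℚ}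
    (hF : ∀ d, d ≠ 0 → LD (F d) (mk fun m => if m = 0 then 0 else c (d * m))) (β : I → ℕ) :
    LD (dimFactor hS y F β) (mk fun m => if m = 0 then 0 else
      ((∑ s with (y s).dim = β ∧ tdim K (S s) (S s) ∣ m, tdim K (S s) (S s) : ℕ) : ℚ) * c m) := by
  have h := LD_prod_expand (Finset.univ.filter fun s => (y s).dim = β)
    (fun s => tdim K (S s) (S s)) (fun s => ((hS.indec s).tdim_self_pos K).ne')
    (fun s => F (tdim K (S s) (S s))) c fun s => hF _ ((hS.indec s).tdim_self_pos K).ne'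
  simp only [Finset.filter_filter] at h
  exact h

include hτ hy in
theorem coeff_dimFactor {F : ℕ → PowerSeries ℚ} {c : ℕ → ℚ}
    (hF : ∀ d, d ≠ 0 → LD (F d) (mk fun m => if m = 0 then 0 else c (d * m)))
    (hF0 : ∀ d, constantCoeff (F d) = 1) {β : I → ℕ} {G : PowerSeries ℚ} {a : ℕ → ℚ}
    (hG : LD G (mk fun m => if m = 0 then 0 else a m * c m)) (hG0 : constantCoeff G = 1) (n : ℕ)
    (hn : n • β ≤ α) (ha : ∀ m, m ≠ 0 → m • β ≤ α → (fixedIndecCount src tgt (τ ^ m) β : ℚ) = a m) :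
    coeff n (dimFactor hS y F β) = coeff n G := by
  refine (LD_dimFactor hS hF β).coeff_eq hG (constantCoeff_dimFactor hS hF0 β) hG0 n fun m hm => ?_
  rw [coeff_mk, coeff_mk]
  split_ifs with h0
  · rfl
  · have hm' : m • β ≤ α := le_trans (fun i => Nat.mul_le_mul_right _ hm) hn
    rw [← ha m h0 hm', ← sum_tdim_eq_fixedIndecCount hτ hS hy h0 hm']
    congr!

include hτ hy in
theorem coeff_one_dimFactor {F : ℕ → PowerSeries ℚ} {c : ℕ → ℚ}
    (hF : ∀ d, d ≠ 0 → LD (F d) (mk fun m => if m = 0 then 0 else c (d * m)))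
    (hF0 : ∀ d, constantCoeff (F d) = 1) :
    coeff 1 (dimFactor hS y F α) = fixedIndecCount src tgt τ α * c 1 := by
  have h1 : (1 : ℕ) • α ≤ α := by rw [one_smul]
  rw [(LD_dimFactor hS hF α).coeff_one (constantCoeff_dimFactor hS hF0 α) (by simp), coeff_mk,
    if_neg one_ne_zero, ← pow_one τ, ← sum_tdim_eq_fixedIndecCount hτ hS hy one_ne_zero h1]
  congr!

end

end QRep

end

section
open CategoryTheory PowerSeries

namespace QRep

section
variable {I Ω : Type} [Fintype I] [Fintype Ω] (src tgt : Ω → I)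

/-- The number of isomorphism classes of indecomposables of dimension vector `β` fixed by the
Frobenius `τ` of any finite field of cardinality `q` is given by `a` at `q`. -/
def IsFixedCount (β : I → ℕ) (a : Polynomial ℤ) : Prop :=
  ∀ (K L : Type) [Field K] [Field L] [Finite K] [IsAlgClosed L] [Algebra K L]
    [Algebra.IsAlgebraic K L] (τ : L →+* L), (∀ x, τ x = x ^ Nat.card K) →
    (fixedIndecCount src tgt τ β : ℤ) = a.eval (Nat.card K : ℤ)

variable {src tgt}

omit [Fintype I] [Fintype Ω] in
theorem IsFixedCount.pow {β : I → ℕ} {a : Polynomial ℤ} (ha : IsFixedCount src tgt β a)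
    {K L : Type} [Field K] [Field L] [Finite K] [IsAlgClosed L] [Algebra K L]
    [Algebra.IsAlgebraic K L] {τ : L →+* L} (hτ : ∀ x, τ x = x ^ Nat.card K) {m : ℕ} (hm : m ≠ 0) :
    (fixedIndecCount src tgt (τ ^ m) β : ℤ) = a.eval ((Nat.card K : ℤ) ^ m) := by
  obtain ⟨E, _, _, _, hE, hc⟩ := exists_field_extension (K := K) (L := L) hm
  rw [ha E L (τ ^ m) fun x => by rw [frobenius_pow_apply hτ, hc], hc, Nat.cast_pow]

open Classical in
theorem exists_ratFun_coeff (src tgt : Ω → I) (α : I → ℕ) (V : Set (I → ℕ)) (N c : ℕ → ℕ → ℚ)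
    (hN : ∀ n, (fun q => N n q) ∈ ratFun) (hN0 : ∀ q, N 0 q = 1)
    (hLD : ∀ q, 2 ≤ q → LD (mk fun n => N n q) (mk fun m => if m = 0 then 0 else c m q))
    (hc : ∀ d m q, c m (q ^ d) = c (d * m) q) (a : (I → ℕ) → Polynomial ℤ)
    (ha : ∀ β ∈ V, β ≠ 0 → β ≤ α → IsFixedCount src tgt β (a β)) :
    ∃ g ∈ ratFun, ∀ (K L : Type) [Field K] [Field L] [Finite K] [IsAlgClosed L] [Algebra K L]
      [Algebra.IsAlgebraic K L] (τ : L →+* L), (∀ x, τ x = x ^ Nat.card K) →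
      ∀ (ι : Type) [Fintype ι] (S : ι → RepObj src tgt K) (y : ι → RepObj src tgt L)
        (hS : IsIndecList α S), (∀ s, IsTwistSum τ (S s) (y s)) →
        MvPowerSeries.coeff (expo α) (∏ s, phi (expo (S s).dim) (hS.dim_ne_zero s)
          (if (y s).dim ∈ V then mk fun n => N n (Nat.card K ^ tdim K (S s) (S s)) else 1)) =
        g (Nat.card K) := by
  choose G hG0 hG using fun β => exists_LD_poly N (fun m q => if m = 0 then 0 else c m q) hN hN0
    hLD (a β)
  have := finite_solutions (fun β : DimLE α => expo β.1) (fun β => expo_ne_zero β.2.1) (expo α)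
  have := Fintype.ofFinite {m : DimLE α → ℕ // ∑ β, m β • expo β.1 = expo α}
  refine ⟨((∑ m : {m : DimLE α → ℕ // ∑ β, m β • expo β.1 = expo α}, ∏ β : DimLE α,
    coeff (m.1 β) (if β.1 ∈ V then G β.1 else 1) : ratFun) : ℕ → ℚ), Subtype.coe_prop _, ?_⟩
  intro K L _ _ _ _ _ _ τ hτ ι _ S y hS hy
  have hq : 2 ≤ Nat.card K := Finite.one_lt_card
  let ev : ratFun →+* ℚ := (Pi.evalRingHom (fun _ => ℚ) (Nat.card K)).comp ratFun.subtype
  rw [prod_phi_eq_dimFactor hS hy V fun d => mk fun n => N n (Nat.card K ^ d), coeff_prod_phi]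
  change _ = ev _
  rw [map_sum]
  refine Finset.sum_congr rfl fun m _ => ?_
  rw [map_prod]
  refine Finset.prod_congr rfl fun β _ => ?_
  rw [← PowerSeries.coeff_map]
  split_ifs with hβ
  · refine coeff_dimFactor hτ hS hy (c := fun m => c m (Nat.card K)) (fun d hd => ?_)
      (fun d => ?_) (a := fun m => ((a β.1).eval ((Nat.card K : ℤ) ^ m) : ℤ)) ?_ ?_ _ ?_ ?_
    · convert hLD (Nat.card K ^ d) (hq.trans (Nat.le_self_pow hd _)) using 4
      exact (hc _ _ _).symm
    · rw [← coeff_zero_eq_constantCoeff_apply, coeff_mk, hN0]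
    · convert hG β.1 _ hq using 3
      split_ifs <;> simp
    · rw [← coeff_zero_eq_constantCoeff_apply, coeff_map, coeff_zero_eq_constantCoeff_apply, hG0,
        map_one]
    · intro i
      have h := DFunLike.congr_fun m.2 i
      rw [Finsupp.finsetSum_apply] at h
      exact (Finset.single_le_sum (f := fun β : DimLE α => (m.1 β • expo β.1) i)
        (fun _ _ => Nat.zero_le _) (Finset.mem_univ β)).trans h.le
    · intro j hj _
      exact_mod_cast (ha β.1 hβ β.2.1 β.2.2).pow hτ hj
  · rw [map_one (PowerSeries.map ev)]

open Classical in
theorem coeff_prod_eq_add {K L : Type} [Field K] [Field L] [Finite K] [IsAlgClosed L] [Algebra K L]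
    [Algebra.IsAlgebraic K L] {τ : L →+* L} (hτ : ∀ x, τ x = x ^ Nat.card K) {α : I → ℕ}
    (hα : α ≠ 0) {ι : Type} [Fintype ι] {S : ι → RepObj src tgt K} {y : ι → RepObj src tgt L}
    (hS : IsIndecList α S) (hy : ∀ s, IsTwistSum τ (S s) (y s)) {F : ℕ → PowerSeries ℚ} {c : ℕ → ℚ}
    (hF : ∀ d, d ≠ 0 → LD (F d) (mk fun m => if m = 0 then 0 else c (d * m)))
    (hF0 : ∀ d, constantCoeff (F d) = 1) :
    MvPowerSeries.coeff (expo α) (∏ s, phi (expo (S s).dim) (hS.dim_ne_zero s)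
        (F (tdim K (S s) (S s)))) =
      MvPowerSeries.coeff (expo α) (∏ s, phi (expo (S s).dim) (hS.dim_ne_zero s)
        (if (y s).dim ∈ ({α} : Set (I → ℕ))ᶜ then F (tdim K (S s) (S s)) else 1)) +
      fixedIndecCount src tgt τ α * c 1 := by
  have h1 : ∀ W : Set (I → ℕ), W = {α} → ∏ s, phi (expo (S s).dim) (hS.dim_ne_zero s)
      (if (y s).dim ∈ W then F (tdim K (S s) (S s)) else 1) =
      phi (expo α) (expo_ne_zero hα) (dimFactor hS y F α) := by
    rintro W rfl
    rw [prod_phi_eq_dimFactor hS hy _ F, Finset.prod_eq_single (⟨α, hα, le_rfl⟩ : DimLE α)]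
    · rw [if_pos (Set.mem_singleton _)]
    · rintro β - hβ
      rw [if_neg, map_one]
      exact fun h => hβ (Subtype.ext h)
    · exact fun h => (h (Finset.mem_univ _)).elim
  rw [← coeff_one_dimFactor hτ hS hy hF hF0, ← coeff_mul_phi _ (expo_ne_zero hα) _
    (constantCoeff_dimFactor hS hF0 α), ← h1 _ rfl, ← Finset.prod_mul_distrib]
  · congr 1
    refine Finset.prod_congr rfl fun s _ => ?_
    rw [← map_mul]
    by_cases h : (y s).dim = α <;> simp [h]
  · rw [map_prod]
    refine Finset.prod_eq_one fun s _ => ?_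
    rw [constantCoeff_phi]
    split_ifs
    · exact hF0 _
    · exact map_one _

omit [Fintype Ω] in
theorem exists_isTwistSum {K L : Type} [Field K] [Field L] [Finite K] [IsAlgClosed L] [Algebra K L]
    [Algebra.IsAlgebraic K L] {τ : L →+* L} (hτ : ∀ x, τ x = x ^ Nat.card K) {α : I → ℕ} {ι : Type}
    {S : ι → RepObj src tgt K} (hS : IsIndecList α S) :
    ∃ y : ι → RepObj src tgt L, ∀ s, IsTwistSum τ (S s) (y s) := by
  refine ⟨fun s => ((hS.indec s).exists_twists hτ).choose, fun s => ?_⟩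
  obtain ⟨h1, h2, h3, h4⟩ := ((hS.indec s).exists_twists hτ).choose_spec
  exact ⟨h1, h2, h3, h4⟩

theorem exists_frobenius (K : Type) [Field K] [Finite K] :
    ∃ τ : AlgebraicClosure K →+* AlgebraicClosure K, ∀ x, τ x = x ^ Nat.card K := by
  have := Fintype.ofFinite K
  obtain ⟨p, hp⟩ := CharP.exists K
  obtain ⟨n, hpr, hn⟩ := FiniteField.card K p
  have : Fact p.Prime := ⟨hpr⟩
  have : CharP (AlgebraicClosure K) p :=
    charP_of_injective_algebraMap (algebraMap K _).injective p
  exact ⟨iterateFrobenius _ p n, fun x => by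
    rw [iterateFrobenius_def, Nat.card_eq_fintype_card, hn]⟩

theorem exists_isFixedCount (src tgt : Ω → I) (α : I → ℕ) (hα : α ≠ 0) :
    ∃ a, IsFixedCount src tgt α a := by
  induction α using WellFoundedLT.induction with
  | ind α ih =>
  have ih' : ∀ β, ∃ a, β ≠ 0 → β < α → IsFixedCount src tgt β a := fun β => by
    by_cases h : β ≠ 0 ∧ β < α
    · obtain ⟨a, ha⟩ := ih β h.2 h.1
      exact ⟨a, fun _ _ => ha⟩
    · exact ⟨0, fun h1 h2 => (h ⟨h1, h2⟩).elim⟩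
  choose a ha using ih'
  have hLD : ∀ q : ℕ, 2 ≤ q → LD (mk fun n => nu n q)
      (mk fun m => if m = 0 then 0 else ((q : ℚ) ^ m - 1)⁻¹) := fun q hq =>
    LD_nu q (by exact_mod_cast hq)
  obtain ⟨g, hg, hgK⟩ := exists_ratFun_coeff src tgt α {α}ᶜ (fun n q => nu n q)
    (fun m q => ((q : ℚ) ^ m - 1)⁻¹) nu_mem_ratFun (fun q => nu_zero _) hLD
    (fun d m q => by rw [Nat.cast_pow, pow_mul]) a
    (fun β hβ h0 hle => ha β h0 (lt_of_le_of_ne hle hβ))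
  obtain ⟨f, hf, hfK⟩ := nilSum_ratFun src tgt α
  let s : ℕ → ℚ := ∏ i, fun q : ℕ => (surjNum (α i) (α i) q)⁻¹
  have hs : s ∈ ratFun := prod_mem fun i _ => inv_gl_mem_ratFun (α i)
  have hA : ((fun q : ℕ => (q : ℚ) ^ 1) - 1) * (f * s - g) ∈ ratFun :=
    ratFun.mul_mem (ratFun.sub_mem (pow_mem_ratFun 1) ratFun.one_mem)
      (ratFun.sub_mem (ratFun.mul_mem hf hs) hg)
  have key : ∀ (K L : Type) [Field K] [Field L] [Finite K] [IsAlgClosed L] [Algebra K L]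
      [Algebra.IsAlgebraic K L] (τ : L →+* L), (∀ x, τ x = x ^ Nat.card K) →
      (((fun q : ℕ => (q : ℚ) ^ 1) - 1) * (f * s - g)) (Nat.card K) =
        fixedIndecCount src tgt τ α := by
    intro K L _ _ _ _ _ _ τ hτ
    have hq : 2 ≤ Nat.card K := Finite.one_lt_card
    have hq' := one_lt_natCard_rat K
    obtain ⟨ι, _, S, hS⟩ := exists_isIndecList src tgt K α
    obtain ⟨y, hy⟩ := exists_isTwistSum hτ hS
    have h1 := hS.nilSum_eq
    have h2 := coeff_prod_eq_add hτ hα hS hy (F := fun d => mk fun n => nu n ((Nat.card K : ℚ) ^ d))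
      (c := fun m => ((Nat.card K : ℚ) ^ m - 1)⁻¹)
      (fun d hd => by
        have := hLD (Nat.card K ^ d) (hq.trans (Nat.le_self_pow hd _))
        simpa only [Nat.cast_pow, pow_mul] using this)
      (fun d => by rw [← coeff_zero_eq_constantCoeff_apply, coeff_mk, nu_zero])
    have h3 := hgK K L τ hτ ι S y hS hy
    simp only [Nat.cast_pow] at h3
    have h0 : ∏ i, surjNum (α i) (α i) (Nat.card K) ≠ 0 :=
      Finset.prod_ne_zero_iff.2 fun i _ => surjNum_self_ne_zero _ hq'
    have h4 : (f * s) (Nat.card K) = g (Nat.card K) + fixedIndecCount src tgt τ α *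
        ((Nat.card K : ℚ) ^ 1 - 1)⁻¹ := by
      have h5 : s (Nat.card K) = (∏ i, surjNum (α i) (α i) (Nat.card K))⁻¹ :=
        (Finset.prod_apply _ _ _).trans (Finset.prod_inv_distrib _)
      rw [← h3, ← h2, Pi.mul_apply, ← hfK K, h1, h5,
        mul_right_comm, mul_inv_cancel₀ h0, one_mul]
    rw [Pi.mul_apply, Pi.sub_apply, Pi.sub_apply, h4, Pi.one_apply, add_sub_cancel_left,
      mul_left_comm, mul_inv_cancel₀ (by rw [pow_one]; exact sub_ne_zero.2 hq'.ne'), mul_one]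
  obtain ⟨M, hM⟩ := exists_poly_of_ratFun hA fun p hp => by
    have : Fact p.Prime := ⟨hp⟩
    obtain ⟨τ, hτ⟩ := exists_frobenius (ZMod p)
    have := key (ZMod p) (AlgebraicClosure (ZMod p)) τ hτ
    rw [Nat.card_zmod] at this
    exact ⟨_, this⟩
  refine ⟨M, fun K L _ _ _ _ _ _ τ hτ => ?_⟩
  have h := key K L τ hτ
  rw [hM _ Finite.one_lt_card] at h
  exact_mod_cast h.symm

theorem exists_poly_orbitCount (src tgt : Ω → I) (α : I → ℕ) (V : Set (I → ℕ)) :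
    ∃ M : Polynomial ℤ, ∀ (F : Type) [Field F] [Finite F], M.eval (Nat.card F : ℤ) =
      (orbitCount src tgt (K := F) α (fun x => LevelAtMost src tgt x V) : ℤ) := by
  have h' : ∀ β, ∃ a, β ≠ 0 → IsFixedCount src tgt β a := fun β => by
    by_cases h : β = 0
    · exact ⟨0, fun h' => (h' h).elim⟩
    · obtain ⟨a, ha⟩ := exists_isFixedCount src tgt β h
      exact ⟨a, fun _ => ha⟩
  choose a ha using h'
  obtain ⟨g, hg, hgK⟩ := exists_ratFun_coeff src tgt α V (fun _ _ => 1) (fun _ _ => 1)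
    (fun _ => ratFun.one_mem) (fun _ => rfl) (fun _ _ => LD_inv_one_sub) (fun _ _ _ => rfl) a
    (fun β _ h0 _ => ha β h0)
  have key : ∀ (F : Type) [Field F] [Finite F], g (Nat.card F) =
      (orbitCount src tgt (K := F) α (fun x => LevelAtMost src tgt x V) : ℚ) := by
    intro F _ _
    obtain ⟨τ, hτ⟩ := exists_frobenius F
    obtain ⟨ι, _, S, hS⟩ := exists_isIndecList src tgt F α
    obtain ⟨y, hy⟩ := exists_isTwistSum hτ hS
    rw [← hgK F _ τ hτ ι S y hS hy,
      hS.orbitCount_eq _ (fun s => (y s).dim ∈ V) (levelAtMost_iff hS hy V)]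
  obtain ⟨M, hM⟩ := exists_poly_of_ratFun hg fun p hp => by
    have : Fact p.Prime := ⟨hp⟩
    have := key (ZMod p)
    rw [Nat.card_zmod] at this
    exact ⟨_, this⟩
  refine ⟨M, fun F _ _ => ?_⟩
  have h := key F
  rw [hM _ Finite.one_lt_card] at h
  exact_mod_cast h

end

end QRep

end

open QRep in
/-- For every finite quiver `Q = (I, Ω)`, dimension vector `α` and subset
`V ⊆ ℕ^I`, there is a polynomial `M ∈ ℤ[t]` such that for every finite field `𝔽_q`
(`q` a prime power), `M(q)` is the number of `GL_α(𝔽_q)`-orbits of representations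
`x ∈ R(Q,α)(𝔽_q)` all of whose indecomposable direct summands over `𝔽̄_q` have dimension
vector in `V`. -/
theorem statement0 (I Ω : Type) [Fintype I] [Fintype Ω] (src tgt : Ω → I)
    (α : I → ℕ) (V : Set (I → ℕ)) :
    ∃ M : Polynomial ℤ,
      ∀ (F : Type) [Field F] [Fintype F],
        M.eval (Fintype.card F : ℤ) =
          (orbitCount src tgt (K := F) α (fun x => LevelAtMost src tgt x V) : ℤ) := by
  obtain ⟨M, hM⟩ := exists_poly_orbitCount src tgt α V
  refine ⟨M, fun F _ _ => ?_⟩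
  rw [← hM F, Nat.card_eq_fintype_card]
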